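/- Let σ = (σ_1 ≥ … ≥ σ_{2p}) be a weakly decreasing sequence of real numbers. If A and B are real symmetric 2p×2p matrices, each with ordered spectrum σ, and A + B has ordered spectrum γ = (γ_1 ≥ … ≥ γ_{2p}), then the sequence ν = ((γ_1+γ_2)/2, (γ_3+γ_4)/2, …, (γ_{2p-1}+γ_{2p})/2) is the ordered spectrum of a + b for some real symmetric p×p matrices a and b with ordered spectra σ_- and σ_+ respectively. -/

import Mathlib

open Polynomial in
/-- `μ` (weakly decreasing) is the ordered spectrum of the real matrix `A`:
the characteristic polynomial of `A` is `∏ i (X - μ i)`, i.e. the `μ i` are the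
eigenvalues of `A` with multiplicity, listed in weakly decreasing order. -/
def HasOrdSpecR {n : ℕ} (A : Matrix (Fin n) (Fin n) ℝ) (μ : Fin n → ℝ) : Prop :=
  Antitone μ ∧ A.charpoly = ∏ i, (X - C (μ i))

open Polynomial in
/-- `μ` (weakly decreasing, real) is the ordered spectrum of the complex matrix `A`. -/
def HasOrdSpecC {n : ℕ} (A : Matrix (Fin n) (Fin n) ℂ) (μ : Fin n → ℝ) : Prop :=
  Antitone μ ∧ A.charpoly = ∏ i, (X - C ((μ i : ℂ)))

/-- For `σ = (σ₁ ≥ … ≥ σ_{2p})`, `sminusR σ = σ₋ = (σ₁, σ₃, …, σ_{2p-1})`. -/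
def sminusR {p : ℕ} (σ : Fin (2 * p) → ℝ) : Fin p → ℝ :=
  fun i => σ ⟨2 * i.1, by have := i.2; omega⟩

/-- For `σ = (σ₁ ≥ … ≥ σ_{2p})`, `splusR σ = σ₊ = (σ₂, σ₄, …, σ_{2p})`. -/
def splusR {p : ℕ} (σ : Fin (2 * p) → ℝ) : Fin p → ℝ :=
  fun i => σ ⟨2 * i.1 + 1, by have := i.2; omega⟩

/-- For `ν = (ν₁ ≥ … ≥ ν_p)`, `dupR ν = ν⁽²⁾ = (ν₁, ν₁, ν₂, ν₂, …, ν_p, ν_p)`. -/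
def dupR {p : ℕ} (ν : Fin p → ℝ) : Fin (2 * p) → ℝ :=
  fun i => ν ⟨i.1 / 2, by have := i.2; omega⟩


namespace HSR
open Module Matrix

/-! ### Part A: flags, adapted bases -/

/-- Coordinate subspace of vectors supported on `S`. -/
def csS (K : Type*) [Field K] {n : ℕ} (S : Set (Fin n)) : Submodule K (Fin n → K) where
  carrier := {y | ∀ j, j ∉ S → y j = 0}
  add_mem' := by
    intro a b ha hb j hj
    simp [ha j hj, hb j hj]
  zero_mem' := by intro j _; rfl
  smul_mem' := by
    intro c a ha j hj
    simp [ha j hj]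

theorem mem_csS {K : Type*} [Field K] {n : ℕ} {S : Set (Fin n)} {y : Fin n → K} :
    y ∈ csS K S ↔ ∀ j, j ∉ S → y j = 0 := Iff.rfl

/-- The first `s` coordinates. -/
def lt (n s : ℕ) : Set (Fin n) := {j | j.1 < s}

theorem finrank_csS {K : Type*} [Field K] {n : ℕ} (S : Finset (Fin n)) :
    finrank K (csS K (S : Set (Fin n))) = S.card := by
  classical
  let f : (S → K) →ₗ[K] (Fin n → K) :=
    { toFun := fun v j => if h : j ∈ S then v ⟨j, h⟩ else 0
      map_add' := by intro a b; ext j; by_cases h : j ∈ S <;> simp [h]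
      map_smul' := by intro a b; ext j; by_cases h : j ∈ S <;> simp [h] }
  have hf : Function.Injective f := by
    intro a b hab
    ext ⟨j, hj⟩
    have := congrFun hab j
    simpa [f, hj] using this
  have hr : LinearMap.range f = csS K (S : Set (Fin n)) := by
    ext y
    constructor
    · rintro ⟨v, rfl⟩ j hj
      have : j ∉ S := by simpa using hj
      simp [f, this]
    · intro hy
      refine ⟨fun j => y j, ?_⟩
      ext j
      by_cases h : j ∈ S
      · simp [f, h]
      · simp [f, h, hy j (by simpa using h)]
  rw [← hr, LinearMap.finrank_range_of_inj hf]
  simp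

/-- The flag spanned by the columns of `M`. -/
def Fl {K : Type*} [Field K] {n : ℕ} (M : Matrix (Fin n) (Fin n) K) (s : ℕ) :
    Submodule K (Fin n → K) := (csS K (lt n s)).map M.mulVecLin

theorem mem_Fl {K : Type*} [Field K] {n : ℕ} {M : Matrix (Fin n) (Fin n) K} {s : ℕ}
    {x : Fin n → K} : x ∈ Fl M s ↔ ∃ y, (∀ j : Fin n, s ≤ j.1 → y j = 0) ∧ M *ᵥ y = x := by
  unfold Fl
  rw [Submodule.mem_map]
  constructor
  · rintro ⟨y, hy, rfl⟩
    exact ⟨y, fun j hj => hy j (by simp [lt]; omega), rfl⟩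
  · rintro ⟨y, hy, rfl⟩
    exact ⟨y, fun j hj => hy j (by simp [lt] at hj; omega), rfl⟩

theorem mulVec_inj {K : Type*} [Field K] {n : ℕ} {M : Matrix (Fin n) (Fin n) K}
    (hM : IsUnit M.det) : Function.Injective M.mulVec := 
  Matrix.mulVec_injective_iff_isUnit.2 ((Matrix.isUnit_iff_isUnit_det _).2 hM)

theorem mulVec_mem_Fl {K : Type*} [Field K] {n : ℕ} {M : Matrix (Fin n) (Fin n) K}
    (hM : IsUnit M.det) {s : ℕ} {y : Fin n → K} :
    M *ᵥ y ∈ Fl M s ↔ ∀ j : Fin n, s ≤ j.1 → y j = 0 := by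
  rw [mem_Fl]
  constructor
  · rintro ⟨z, hz, h⟩
    rwa [← mulVec_inj hM h]
  · intro h
    exact ⟨y, h, rfl⟩

theorem Fl_zero {K : Type*} [Field K] {n : ℕ} (M : Matrix (Fin n) (Fin n) K) : Fl M 0 = ⊥ := by
  rw [eq_bot_iff]
  intro x hx
  obtain ⟨y, hy, rfl⟩ := mem_Fl.1 hx
  have : y = 0 := by ext j; exact hy j (Nat.zero_le _)
  simp [this]

theorem mul_inv_mulVec {K : Type*} [Field K] {n : ℕ} {M : Matrix (Fin n) (Fin n) K}
    (hM : IsUnit M.det) (x : Fin n → K) : M *ᵥ (M⁻¹ *ᵥ x) = x := by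
  rw [mulVec_mulVec, Matrix.mul_nonsing_inv _ hM, one_mulVec]

theorem Fl_top {K : Type*} [Field K] {n : ℕ} {M : Matrix (Fin n) (Fin n) K}
    (hM : IsUnit M.det) {s : ℕ} (hs : n ≤ s) : Fl M s = ⊤ := by
  rw [eq_top_iff]
  intro x _
  exact mem_Fl.2 ⟨M⁻¹ *ᵥ x, fun j hj => by have := j.2; omega, mul_inv_mulVec hM x⟩

/-- Basis adapted to the standard flag and a subspace. -/
theorem bruhat_std {K : Type*} [Field K] {n : ℕ} (U : Submodule K (Fin n → K)) :
    ∃ u : Matrix (Fin n) (Fin n) K, (∀ i j, j < i → u i j = 0) ∧ (∀ i, u i i ≠ 0) ∧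
      ∃ I : Finset (Fin n), ∀ y, u *ᵥ y ∈ U ↔ ∀ j, j ∉ I → y j = 0 := by
  classical
  have h1 : ∀ i : Fin n, ∃ b : Fin n → K, (∀ j, i < j → b j = 0) ∧ b i ≠ 0 ∧
      ((∃ x ∈ U, (∀ j, i < j → x j = 0) ∧ x i ≠ 0) → b ∈ U) := by
    intro i
    by_cases h : ∃ x ∈ U, (∀ j, i < j → x j = 0) ∧ x i ≠ 0
    · obtain ⟨x, hx, h1, h2⟩ := h
      exact ⟨x, h1, h2, fun _ => hx⟩
    · refine ⟨Pi.single i 1, fun j hj => ?_, by simp, fun h' => absurd h' h⟩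
      rw [Pi.single_eq_of_ne (ne_of_gt hj)]
  choose b hb1 hb2 hb3 using h1
  have hmul : ∀ y : Fin n → K, (Matrix.of fun i j => b j i) *ᵥ y = ∑ j, y j • b j := by
    intro y
    ext i
    simp [Matrix.mulVec, dotProduct, mul_comm]
  refine ⟨Matrix.of fun i j => b j i, fun i j h => hb1 j i h, fun i => hb2 i,
    Finset.univ.filter fun i => b i ∈ U, fun y => ⟨fun hy => ?_, fun hy => ?_⟩⟩
  · by_contra hcon
    push Not at hcon
    set z : Fin n → K := fun j => if b j ∈ U then 0 else y j with hz
    have hzU : ∑ j, z j • b j ∈ U := by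
      have : ∑ j, z j • b j = ∑ j, y j • b j - ∑ j, (if b j ∈ U then y j else 0) • b j := by
        rw [← Finset.sum_sub_distrib]
        refine Finset.sum_congr rfl fun j _ => ?_
        by_cases h : b j ∈ U <;> simp [hz, h]
      rw [this, ← hmul]
      refine U.sub_mem hy (U.sum_mem fun j _ => ?_)
      by_cases h : b j ∈ U
      · simpa [h] using U.smul_mem _ h
      · simp [h]
    obtain ⟨m, hm, hmax⟩ : ∃ m, z m ≠ 0 ∧ ∀ j, m < j → z j = 0 := by
      obtain ⟨j0, hj0, hj0'⟩ := hcon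
      have hne : (Finset.univ.filter fun j => z j ≠ 0).Nonempty := by
        refine ⟨j0, ?_⟩
        simp only [Finset.mem_filter, Finset.mem_univ, true_and] at hj0 ⊢
        simpa [hz, hj0] using hj0'
      refine ⟨_, (Finset.mem_filter.1 (Finset.max'_mem _ hne)).2, fun j hj => ?_⟩
      by_contra hzj
      exact absurd (Finset.le_max' _ j (by simpa using hzj)) (not_le.2 hj)
    have hmU : b m ∉ U := by
      intro h
      apply hm
      simp [hz, h]
    apply hmU
    apply hb3
    refine ⟨_, hzU, fun i hi => ?_, ?_⟩
    · rw [Finset.sum_apply]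
      refine Finset.sum_eq_zero fun j _ => ?_
      rcases le_or_gt j m with h | h
      · simp [hb1 j i (lt_of_le_of_lt h hi)]
      · simp [hmax j h]
    · rw [Finset.sum_apply, Finset.sum_eq_single m]
      · simpa using ⟨hm, hb2 m⟩
      · intro j _ hj
        rcases lt_or_gt_of_ne hj with h | h
        · simp [hb1 j m h]
        · simp [hmax j h]
      · simp
  · rw [hmul]
    refine U.sum_mem fun j _ => ?_
    by_cases h : b j ∈ U
    · exact U.smul_mem _ h
    · rw [hy j (by simpa using h)]
      simp

theorem map_csS_of_upper {K : Type*} [Field K] {n : ℕ} {u : Matrix (Fin n) (Fin n) K}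
    (hu : ∀ i j, j < i → u i j = 0) (hd : IsUnit u.det) (s : ℕ) :
    (csS K (lt n s)).map u.mulVecLin = csS K (lt n s) := by
  apply Submodule.eq_of_le_of_finrank_eq
  · rintro _ ⟨y, hy, rfl⟩ i hi
    simp only [mulVecLin_apply, mulVec, dotProduct]
    refine Finset.sum_eq_zero fun j _ => ?_
    rcases lt_or_ge j i with h | h
    · simp [hu i j h]
    · rw [hy j (by simp [lt] at hi ⊢; exact hi.trans h), mul_zero]
  · exact (Submodule.equivMapOfInjective u.mulVecLin (mulVec_inj hd) _).finrank_eq.symm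
 
theorem bruhat {K : Type*} [Field K] {n : ℕ} {M : Matrix (Fin n) (Fin n) K}
    (hM : IsUnit M.det) (V : Submodule K (Fin n → K)) :
    ∃ g : Matrix (Fin n) (Fin n) K, IsUnit g.det ∧ (∀ s, Fl g s = Fl M s) ∧
      ∃ I : Finset (Fin n), ∀ y, g *ᵥ y ∈ V ↔ ∀ j, j ∉ I → y j = 0 := by
  obtain ⟨u, hu, hd, I, hI⟩ := bruhat_std (V.comap M.mulVecLin)
  have hdet : IsUnit u.det := by
    rw [Matrix.det_of_isUpperTriangular (M := u) (fun i j h => hu i j h)]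
    exact isUnit_iff_ne_zero.2 (Finset.prod_ne_zero_iff.2 fun i _ => hd i)
  refine ⟨M * u, by rw [det_mul]; exact hM.mul hdet, fun s => ?_, I, fun y => ?_⟩
  · unfold Fl
    rw [Matrix.mulVecLin_mul, Submodule.map_comp, map_csS_of_upper hu hdet]
  · rw [← hI, Submodule.mem_comap, mulVecLin_apply, mulVec_mulVec]

theorem finrank_inf_Fl {K : Type*} [Field K] {n : ℕ} {g : Matrix (Fin n) (Fin n) K}
    (hg : IsUnit g.det) {V : Submodule K (Fin n → K)} {I : Finset (Fin n)}
    (hI : ∀ y, g *ᵥ y ∈ V ↔ ∀ j, j ∉ I → y j = 0) (s : ℕ) :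
    finrank K ↥(V ⊓ Fl g s) = (I.filter fun j => j.1 < s).card := by
  have : V ⊓ Fl g s = (csS K ((I.filter fun j => j.1 < s : Finset (Fin n)) : Set (Fin n))).map
      g.mulVecLin := by
    ext x
    rw [Submodule.mem_inf, Submodule.mem_map]
    constructor
    · rintro ⟨h1, h2⟩
      obtain ⟨y, hy, rfl⟩ := mem_Fl.1 h2
      refine ⟨y, fun j hj => ?_, rfl⟩
      simp only [Finset.coe_filter, Set.mem_ofPred_eq, not_and_or] at hj
      rcases hj with hj | hj
      · exact (hI y).1 h1 j hj
      · exact hy j (by omega)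
    · rintro ⟨y, hy, rfl⟩
      refine ⟨(hI y).2 fun j hj => hy j ?_, mem_Fl.2 ⟨y, fun j hj => hy j ?_, rfl⟩⟩
      · simp [hj]
      · simp [hj]
  rw [this, ← (Submodule.equivMapOfInjective g.mulVecLin (mulVec_inj hg) _).finrank_eq,
    finrank_csS]

/-- Infinitesimal Schubert condition. -/
def TF {K : Type*} [Field K] {n : ℕ} (M : Matrix (Fin n) (Fin n) K)
    (V : Submodule K (Fin n → K)) (φ : Matrix (Fin n) (Fin n) K) : Prop :=
  ∀ s, ∀ x ∈ V, x ∈ Fl M s → φ *ᵥ x ∈ V ⊔ Fl M s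

/-- Vanishing of the obstruction space. -/
def ExtVan {K : Type*} [Field K] {n : ℕ} (M : Fin 3 → Matrix (Fin n) (Fin n) K)
    (V : Submodule K (Fin n → K)) : Prop :=
  ∀ ξ : Fin 3 → Matrix (Fin n) (Fin n) K, ∃ φ, ∀ k, TF (M k) V (ξ k - φ)

theorem TF_iff {K : Type*} [Field K] {n : ℕ} {M g : Matrix (Fin n) (Fin n) K}
    (hg : IsUnit g.det) (hgM : ∀ s, Fl g s = Fl M s)
    {V : Submodule K (Fin n → K)} {I : Finset (Fin n)}
    (hI : ∀ y, g *ᵥ y ∈ V ↔ ∀ j, j ∉ I → y j = 0) (φ : Matrix (Fin n) (Fin n) K) :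
    TF M V φ ↔ ∀ i j, j ∈ I → i ∉ I → j < i → (g⁻¹ * φ * g) i j = 0 := by
  classical
  have hgg : ∀ y, φ *ᵥ (g *ᵥ y) = g *ᵥ ((g⁻¹ * φ * g) *ᵥ y) := by
    intro y
    rw [mulVec_mulVec, mulVec_mulVec, ← Matrix.mul_assoc, ← Matrix.mul_assoc,
      Matrix.mul_nonsing_inv _ hg, Matrix.one_mul]
  constructor
  · intro h i j hj hi hji
    have h1 := h (j.1 + 1) (g *ᵥ Pi.single j 1) ((hI _).2 fun l hl => by
        rw [Pi.single_eq_of_ne]; rintro rfl; exact hl hj)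
      (by
        rw [← hgM, mulVec_mem_Fl hg]
        intro l hl
        rw [Pi.single_eq_of_ne]
        rintro rfl
        omega)
    rw [hgg, Submodule.mem_sup] at h1
    obtain ⟨a, ha, b, hb, hab⟩ := h1
    rw [← mul_inv_mulVec hg a, hI] at ha
    rw [← hgM, ← mul_inv_mulVec hg b, mulVec_mem_Fl hg] at hb
    have h2 : (g⁻¹ * φ * g) *ᵥ Pi.single j 1 = g⁻¹ *ᵥ a + g⁻¹ *ᵥ b := by
      apply mulVec_inj hg
      rw [← hab, mulVec_add, mul_inv_mulVec hg, mul_inv_mulVec hg]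
    have h3 := congrFun h2 i
    rw [mulVec_single_one] at h3
    simp only [Pi.add_apply] at h3
    rw [ha i hi, hb i (by exact hji)] at h3
    simpa [Matrix.col] using h3
  · intro h s x hxV hx
    rw [← hgM] at hx ⊢
    obtain ⟨y, hy, rfl⟩ := mem_Fl.1 hx
    rw [hI] at hxV
    rw [hgg]
    set z := (g⁻¹ * φ * g) *ᵥ y with hz
    have hsplit : z = (fun j => if j ∈ I then z j else 0) + (fun j => if j ∈ I then 0 else z j) := by
      ext j; by_cases hj : j ∈ I <;> simp [hj]
    rw [hsplit, mulVec_add]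
    refine Submodule.add_mem_sup ((hI _).2 fun j hj => by simp [hj]) ((mulVec_mem_Fl hg).2 ?_)
    intro i hi
    by_cases hiI : i ∈ I
    · simp [hiI]
    · simp only [hiI, if_false, hz, mulVec, dotProduct]
      refine Finset.sum_eq_zero fun j _ => ?_
      by_cases hj : j ∈ I
      · rcases lt_or_ge j i with h' | h'
        · rw [h i j hj hiI h', zero_mul]
        · rw [hy j (hi.trans h'), mul_zero]
      · rw [hxV j hj, mul_zero]

theorem pres_iff {K : Type*} [Field K] {n : ℕ} {g : Matrix (Fin n) (Fin n) K}
    (hg : IsUnit g.det)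
    {V : Submodule K (Fin n → K)} {I : Finset (Fin n)}
    (hI : ∀ y, g *ᵥ y ∈ V ↔ ∀ j, j ∉ I → y j = 0) (φ : Matrix (Fin n) (Fin n) K) :
    (∀ x ∈ V, φ *ᵥ x ∈ V) ↔ ∀ i j, j ∈ I → i ∉ I → (g⁻¹ * φ * g) i j = 0 := by
  classical
  have hgg : ∀ y, φ *ᵥ (g *ᵥ y) = g *ᵥ ((g⁻¹ * φ * g) *ᵥ y) := by
    intro y
    rw [mulVec_mulVec, mulVec_mulVec, ← Matrix.mul_assoc, ← Matrix.mul_assoc,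
      Matrix.mul_nonsing_inv _ hg, Matrix.one_mul]
  constructor
  · intro h i j hj hi
    have h1 := h (g *ᵥ Pi.single j 1) ((hI _).2 fun l hl => by
        rw [Pi.single_eq_of_ne]; rintro rfl; exact hl hj)
    rw [hgg, hI, mulVec_single_one] at h1
    simpa [Matrix.col] using h1 i hi
  · intro h x hx
    rw [← mul_inv_mulVec hg x, hI] at hx
    rw [← mul_inv_mulVec hg x, hgg, hI]
    intro i hi
    simp only [mulVec, dotProduct]
    refine Finset.sum_eq_zero fun j _ => ?_
    by_cases hj : j ∈ I
    · rw [h i j hj hi, zero_mul]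
    · have := hx j hj
      simp only [mulVec, dotProduct] at this
      rw [this, mul_zero]

theorem TF_split {K : Type*} [Field K] {n : ℕ} {M : Matrix (Fin n) (Fin n) K}
    (hM : IsUnit M.det) {V : Submodule K (Fin n → K)} {ψ : Matrix (Fin n) (Fin n) K}
    (h : TF M V ψ) : ∃ y z : Matrix (Fin n) (Fin n) K, ψ = y + z ∧ (∀ x ∈ V, y *ᵥ x ∈ V) ∧
      ∀ s, ∀ x ∈ Fl M s, z *ᵥ x ∈ Fl M s := by
  classical
  obtain ⟨g, hg, hgM, I, hI⟩ := bruhat hM V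
  rw [TF_iff hg hgM hI] at h
  set N := g⁻¹ * ψ * g with hN
  set Z : Matrix (Fin n) (Fin n) K := Matrix.of fun i j => if i ≤ j then N i j else 0 with hZ
  refine ⟨g * (N - Z) * g⁻¹, g * Z * g⁻¹, ?_, ?_, ?_⟩
  · rw [← Matrix.add_mul, ← Matrix.mul_add, sub_add_cancel, hN]
    simp only [Matrix.mul_assoc]
    rw [Matrix.mul_nonsing_inv _ hg, Matrix.mul_one, ← Matrix.mul_assoc,
      Matrix.mul_nonsing_inv _ hg, Matrix.one_mul]
  · rw [pres_iff hg hI]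
    intro i j hj hi
    have : g⁻¹ * (g * (N - Z) * g⁻¹) * g = N - Z := by
      simp only [Matrix.mul_assoc]
      rw [Matrix.nonsing_inv_mul _ hg, Matrix.mul_one, ← Matrix.mul_assoc,
        Matrix.nonsing_inv_mul _ hg, Matrix.one_mul]
    rw [this]
    simp only [Matrix.sub_apply, hZ, Matrix.of_apply]
    split_ifs with h'
    · simp
    · rw [h i j hj hi (not_le.1 h')]; simp
  · intro s x hx
    rw [← hgM] at hx ⊢
    obtain ⟨y, hy, rfl⟩ := mem_Fl.1 hx
    have : (g * Z * g⁻¹) *ᵥ (g *ᵥ y) = g *ᵥ (Z *ᵥ y) := by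
      rw [mulVec_mulVec, mulVec_mulVec, Matrix.mul_assoc, Matrix.nonsing_inv_mul _ hg,
        Matrix.mul_one]
    rw [this, mulVec_mem_Fl hg]
    intro i hi
    simp only [mulVec, dotProduct]
    refine Finset.sum_eq_zero fun j _ => ?_
    simp only [hZ, Matrix.of_apply]
    split_ifs with h'
    · rw [hy j (hi.trans h'), mul_zero]
    · simp

end HSR


namespace HSR
open Module Matrix

/-! ### Part B: generic real numbers -/

theorem exists_algInd (ι : Type) [Finite ι] : ∃ x : ι → ℝ, AlgebraicIndependent ℚ x := by
  obtain ⟨s, hs⟩ := exists_isTranscendenceBasis ℚ ℝ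
  have hinf : Infinite s := by
    by_contra hfin
    rw [not_infinite_iff_finite] at hfin
    have halg := hs.isAlgebraic
    have h := Algebra.IsAlgebraic.cardinalMk_le_max
      (Algebra.adjoin ℚ (Set.range ((↑) : s → ℝ))) ℝ
    have h2 : Cardinal.mk s ≤ Cardinal.aleph0 := (Cardinal.lt_aleph0_of_finite s).le
    have h3 : Cardinal.mk ℚ ≤ Cardinal.aleph0 := Cardinal.mk_le_aleph0
    have h4 : Cardinal.mk (Algebra.adjoin ℚ (Set.range ((↑) : s → ℝ))) ≤ Cardinal.aleph0 := by
      rw [← Cardinal.mk_congr hs.1.aevalEquiv.toEquiv]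
      exact MvPolynomial.cardinalMk_le_max.trans (max_le (max_le h3 h2) le_rfl)
    rw [Cardinal.mk_real] at h
    exact absurd (h.trans (max_le h4 le_rfl)) (not_le.2 Cardinal.aleph0_lt_continuum)
  obtain ⟨f⟩ : Nonempty (ι ↪ s) := by
    cases nonempty_fintype ι
    exact ⟨((Fintype.equivFin ι).toEmbedding.trans Fin.valEmbedding).trans (Infinite.natEmbedding s)⟩
  exact ⟨fun i => (f i : ℝ), hs.1.comp f f.injective⟩

section
variable {t : Type} {v : t → ℝ}

theorem tb_isAlgebraic (hv : IsTranscendenceBasis ℚ v) :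
    letI : Algebra (MvPolynomial t ℚ) ℝ := (MvPolynomial.aeval v).toAlgebra
    Algebra.IsAlgebraic (MvPolynomial t ℚ) ℝ := by
  let : Algebra (MvPolynomial t ℚ) ℝ := (MvPolynomial.aeval v).toAlgebra
  have h := hv.isAlgebraic
  refine ⟨fun x => ?_⟩
  obtain ⟨q, hq, hx⟩ := h.isAlgebraic x
  let e := hv.1.aevalEquiv
  refine ⟨q.map (e.symm : _ →+* MvPolynomial t ℚ), ?_, ?_⟩
  · rwa [Ne, Polynomial.map_eq_zero_iff]
    exact e.symm.injective
  · rw [Polynomial.aeval_def, Polynomial.eval₂_map]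
    rw [Polynomial.aeval_def] at hx
    convert hx using 2
    ext y
    change MvPolynomial.aeval v (e.symm y) = (y : ℝ)
    rw [← hv.1.algebraMap_aevalEquiv]
    simp [e]

theorem exists_derivation_tb (hv : IsTranscendenceBasis ℚ v) (ξ : t → ℝ) :
    ∃ D : Derivation ℚ ℝ ℝ, ∀ j, D (v j) = ξ j := by
  let : Algebra (MvPolynomial t ℚ) ℝ := (MvPolynomial.aeval v).toAlgebra
  have : IsScalarTower ℚ (MvPolynomial t ℚ) ℝ := IsScalarTower.of_algebraMap_eq' (Subsingleton.elim _ _)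
  have hinj : Function.Injective (algebraMap (MvPolynomial t ℚ) ℝ) := hv.1
  have : FaithfulSMul (MvPolynomial t ℚ) ℝ := (faithfulSMul_iff_algebraMap_injective _ _).2 hinj
  have := tb_isAlgebraic hv
  let : Algebra (FractionRing (MvPolynomial t ℚ)) ℝ := FractionRing.liftAlgebra _ _
  have : IsScalarTower (MvPolynomial t ℚ) (FractionRing (MvPolynomial t ℚ)) ℝ :=
    FractionRing.isScalarTower_liftAlgebra _ _
  have : Algebra.IsAlgebraic (FractionRing (MvPolynomial t ℚ)) ℝ :=
    (IsFractionRing.comap_isAlgebraic_iff (A := MvPolynomial t ℚ)).1 (tb_isAlgebraic hv)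
  have : Algebra.FormallyEtale (FractionRing (MvPolynomial t ℚ)) ℝ :=
    Algebra.FormallyEtale.of_isSeparable _ _
  have : Algebra.FormallyEtale (MvPolynomial t ℚ) (FractionRing (MvPolynomial t ℚ)) :=
    Algebra.FormallyEtale.of_isLocalization (nonZeroDivisors (MvPolynomial t ℚ))
  have : Algebra.FormallyEtale (MvPolynomial t ℚ) ℝ :=
    Algebra.FormallyEtale.comp _ (FractionRing (MvPolynomial t ℚ)) _
  let d : Derivation ℚ (MvPolynomial t ℚ) ℝ := MvPolynomial.mkDerivation ℚ ξ
  let l := d.liftKaehlerDifferential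
  let l' : TensorProduct (MvPolynomial t ℚ) ℝ (Ω[MvPolynomial t ℚ⁄ℚ]) →ₗ[ℝ] ℝ :=
    LinearMap.liftBaseChange ℝ l
  let e := KaehlerDifferential.tensorKaehlerEquivOfFormallyEtale ℚ (MvPolynomial t ℚ) ℝ
  refine ⟨(l'.comp e.symm.toLinearMap).compDer (KaehlerDifferential.D ℚ ℝ), fun j => ?_⟩
  have : v j = algebraMap (MvPolynomial t ℚ) ℝ (MvPolynomial.X j) := by
    change _ = MvPolynomial.aeval v _
    simp
  rw [this]
  have h := KaehlerDifferential.tensorKaehlerEquivOfFormallyEtale_symm_D_algebraMap ℚ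
    (MvPolynomial t ℚ) ℝ (MvPolynomial.X j)
  refine (congrArg l' h).trans ?_
  simp [l', l, d]

theorem exists_hom_tb (hv : IsTranscendenceBasis ℚ v) (r : t → ℚ) :
    ∃ τ : ℝ →+* ℂ, ∀ j, τ (v j) = ((v j + r j : ℝ) : ℂ) := by
  let : Algebra (MvPolynomial t ℚ) ℝ := (MvPolynomial.aeval v).toAlgebra
  have hinj : Function.Injective (algebraMap (MvPolynomial t ℚ) ℝ) := hv.1
  have : FaithfulSMul (MvPolynomial t ℚ) ℝ := (faithfulSMul_iff_algebraMap_injective _ _).2 hinj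
  have := tb_isAlgebraic hv
  let : Algebra (FractionRing (MvPolynomial t ℚ)) ℝ := FractionRing.liftAlgebra _ _
  have : IsScalarTower (MvPolynomial t ℚ) (FractionRing (MvPolynomial t ℚ)) ℝ :=
    FractionRing.isScalarTower_liftAlgebra _ _
  have : Algebra.IsAlgebraic (FractionRing (MvPolynomial t ℚ)) ℝ :=
    (IsFractionRing.comap_isAlgebraic_iff (A := MvPolynomial t ℚ)).1 (tb_isAlgebraic hv)
  let sh : (t → ℚ) → MvPolynomial t ℚ →ₐ[ℚ] MvPolynomial t ℚ := fun r =>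
    MvPolynomial.aeval fun j => MvPolynomial.X j + MvPolynomial.C (r j)
  have hsh : ∀ q, sh (-r) (sh r q) = q := by
    intro q
    have : (sh (-r)).comp (sh r) = AlgHom.id ℚ _ := by
      ext j
      simp [sh]
    exact DFunLike.congr_fun this q
  let f : MvPolynomial t ℚ →+* ℂ :=
    (Complex.ofRealHom.comp (algebraMap (MvPolynomial t ℚ) ℝ)).comp (sh r).toRingHom
  have hf : Function.Injective f := by
    refine (Complex.ofReal_injective.comp hinj).comp ?_
    exact Function.LeftInverse.injective hsh
  let : Algebra (FractionRing (MvPolynomial t ℚ)) ℂ := (IsFractionRing.lift hf).toAlgebra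
  let τ : ℝ →ₐ[FractionRing (MvPolynomial t ℚ)] ℂ := IsAlgClosed.lift
  refine ⟨τ, fun j => ?_⟩
  have h1 : v j = algebraMap (MvPolynomial t ℚ) ℝ (MvPolynomial.X j) := by
    change _ = MvPolynomial.aeval v _
    simp
  have h2 : τ (v j) = f (MvPolynomial.X j) := by
    rw [h1, IsScalarTower.algebraMap_apply _ (FractionRing (MvPolynomial t ℚ)) ℝ, AlgHom.commutes]
    exact IsFractionRing.lift_algebraMap hf _
  change τ (v j) = _
  rw [h2]
  change ((MvPolynomial.aeval v (sh r (MvPolynomial.X j)) : ℝ) : ℂ) = _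
  simp [sh]
end

theorem extend_tb {ι : Type} {x : ι → ℝ} (hx : AlgebraicIndependent ℚ x) :
    ∃ (t : Set ℝ) (f : ι → t), IsTranscendenceBasis ℚ ((↑) : t → ℝ) ∧ (∀ i, (f i : ℝ) = x i) ∧
      Function.Injective f := by
  obtain ⟨t, ht, h⟩ := exists_isTranscendenceBasis_superset (AlgebraicIndependent.to_subtype_range hx)
  refine ⟨t, fun i => ⟨x i, ht ⟨i, rfl⟩⟩, h, fun i => rfl, fun i j hij => ?_⟩
  exact AlgebraicIndependent.injective hx (by simpa using hij)

theorem exists_derivation {ι : Type} {x : ι → ℝ} (hx : AlgebraicIndependent ℚ x) (ξ : ι → ℝ) :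
    ∃ D : Derivation ℚ ℝ ℝ, ∀ j, D (x j) = ξ j := by
  obtain ⟨t, f, ht, hf, hi⟩ := extend_tb hx
  obtain ⟨D, hD⟩ := exists_derivation_tb ht (Function.extend f ξ 0)
  exact ⟨D, fun j => by rw [← hf, hD, hi.extend_apply]⟩

theorem exists_hom {ι : Type} {x : ι → ℝ} (hx : AlgebraicIndependent ℚ x) (r : ι → ℚ) :
    ∃ τ : ℝ →+* ℂ, ∀ j, τ (x j) = ((x j + r j : ℝ) : ℂ) := by
  obtain ⟨t, f, ht, hf, hi⟩ := extend_tb hx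
  obtain ⟨τ, hτ⟩ := exists_hom_tb ht (Function.extend f r 0)
  exact ⟨τ, fun j => by rw [← hf, hτ, hi.extend_apply]⟩

end HSR

namespace HSR
open Module Matrix

/-! ### Part C: generic flags -/

/-- generic triple of matrices -/
def Generic {n : ℕ} (M : Fin 3 → Matrix (Fin n) (Fin n) ℝ) : Prop :=
  AlgebraicIndependent ℚ (fun q : Fin 3 × Fin n × Fin n => M q.1 q.2.1 q.2.2)

theorem exists_generic (n : ℕ) : ∃ M : Fin 3 → Matrix (Fin n) (Fin n) ℝ, Generic M := by
  obtain ⟨x, hx⟩ := exists_algInd (Fin 3 × Fin n × Fin n)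
  exact ⟨fun k => Matrix.of fun i j => x (k, i, j), hx⟩

theorem Generic.det {n : ℕ} {M : Fin 3 → Matrix (Fin n) (Fin n) ℝ} (hM : Generic M) (k : Fin 3) :
    IsUnit (M k).det := by
  have h1 : AlgebraicIndependent ℚ (fun q : Fin n × Fin n => M k q.1 q.2) :=
    AlgebraicIndependent.comp hM (fun q : Fin n × Fin n => (k, q))
      (fun a b h => by simpa using h)
  have h2 := Matrix.det_mvPolynomialX_ne_zero (Fin n) ℚ
  rw [isUnit_iff_ne_zero]
  have h3 : (M k).det = MvPolynomial.aeval (fun q : Fin n × Fin n => M k q.1 q.2)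
      (Matrix.det (Matrix.mvPolynomialX (Fin n) (Fin n) ℚ)) := by
    rw [AlgHom.map_det]
    congr 1
    ext i j
    simp
  rw [h3]
  intro h
  exact h2 (h1 (by rw [h, map_zero]))

theorem extVan_generic {n : ℕ} {M : Fin 3 → Matrix (Fin n) (Fin n) ℝ} (hM : Generic M)
    (V : Submodule ℝ (Fin n → ℝ)) : ExtVan M V := by
  intro ξ
  obtain ⟨D, hD⟩ := exists_derivation hM (fun q => (ξ q.1 * M q.1) q.2.1 q.2.2)
  let b := Module.finBasis ℝ V
  obtain ⟨f, hf⟩ := LinearMap.exists_extend (p := V)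
    (b.constr ℝ (fun l => (fun i => D ((b l : Fin n → ℝ) i) : Fin n → ℝ)))
  refine ⟨LinearMap.toMatrix' f, fun k s x hx hxs => ?_⟩
  obtain ⟨y, hy, hyx⟩ := mem_Fl.1 hxs
  let c := b.repr ⟨x, hx⟩
  have h1 : x = ∑ l, c l • (b l : Fin n → ℝ) := by
    have := congrArg V.subtype (b.sum_repr ⟨x, hx⟩)
    rw [map_sum] at this
    exact this.symm
  have h2 : LinearMap.toMatrix' f *ᵥ x = ∑ l, c l • (fun i => D ((b l : Fin n → ℝ) i)) := by
    have e0 : f x = (f.comp V.subtype) ⟨x, hx⟩ := rfl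
    rw [LinearMap.toMatrix'_mulVec, e0, hf, Basis.constr_apply_fintype]
    rfl
  have h3 : (fun i => D (x i)) = LinearMap.toMatrix' f *ᵥ x + ∑ l, D (c l) • (b l : Fin n → ℝ) := by
    rw [h2]
    ext i
    conv_lhs => rw [h1]
    simp only [Finset.sum_apply, Pi.smul_apply, Pi.add_apply, smul_eq_mul, map_sum,
      Derivation.leibniz]
    rw [← Finset.sum_add_distrib]
    exact Finset.sum_congr rfl fun l _ => by ring
  have h4 : (fun i => D (x i)) = ξ k *ᵥ x + M k *ᵥ (fun j => D (y j)) := by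
    conv_rhs => rw [← hyx, mulVec_mulVec]
    rw [← hyx]
    ext i
    simp only [mulVec, dotProduct, Pi.add_apply, map_sum, Derivation.leibniz, smul_eq_mul]
    rw [← Finset.sum_add_distrib]
    refine Finset.sum_congr rfl fun j _ => ?_
    have := hD (k, i, j)
    simp only at this
    rw [this]; ring
  have h5 : (ξ k - LinearMap.toMatrix' f) *ᵥ x =
      ∑ l, D (c l) • (b l : Fin n → ℝ) + M k *ᵥ (fun j => -D (y j)) := by
    have e1 : (fun j => -D (y j)) = -(fun j => D (y j)) := rfl
    rw [sub_mulVec, e1, mulVec_neg]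
    have := h3.symm.trans h4
    rw [← sub_eq_zero] at this ⊢
    rw [← neg_eq_zero, ← this]
    abel
  rw [h5]
  refine Submodule.add_mem_sup ?_ ?_
  · exact Submodule.sum_mem _ fun l _ => Submodule.smul_mem _ _ (b l).2
  · refine mem_Fl.2 ⟨_, fun j hj => ?_, rfl⟩
    simp [hy j hj]

end HSR

namespace HSR
open Module Matrix

/-! ### Part D: degrees, counting -/

/-- weighted sum of jumps -/
def wsum {n : ℕ} (α : Fin n → ℝ) (e : ℕ → ℝ) : ℝ := ∑ i : Fin n, α i * (e (i.1 + 1) - e i.1)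

theorem wsum_sub {n : ℕ} (α : Fin n → ℝ) (e f : ℕ → ℝ) :
    wsum α (fun s => e s - f s) = wsum α e - wsum α f := by
  simp only [wsum, ← Finset.sum_sub_distrib]
  exact Finset.sum_congr rfl fun i _ => by ring

theorem abel_nonneg {n : ℕ} (α : Fin n → ℝ) (hα : Antitone α) (e : ℕ → ℝ) (h0 : e 0 = 0)
    (hn : e n = 0) (he : ∀ s, 0 ≤ e s) : 0 ≤ wsum α e := by
  have key : ∀ n : ℕ, ∀ α : Fin (n + 1) → ℝ, Antitone α →
      α (Fin.last n) * e (n + 1) ≤ wsum α e := by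
    intro n
    induction n with
    | zero =>
      intro α _
      simp [wsum, h0]
    | succ n ih =>
      intro α hα
      have h1 := ih (fun i => α i.castSucc) (fun i j hij => hα (by simpa using hij))
      have h2 : wsum α e = wsum (fun i : Fin (n + 1) => α i.castSucc) e +
          α (Fin.last (n + 1)) * (e (n + 1 + 1) - e (n + 1)) := by
        unfold wsum
        rw [Fin.sum_univ_castSucc]
        rfl
      rw [h2]
      have h3 : α (Fin.last (n + 1)) ≤ α (Fin.last n).castSucc := hα (Fin.le_last _)
      have h4 := mul_le_mul_of_nonneg_right h3 (he (n + 1))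
      linarith
  cases n with
  | zero => simp [wsum]
  | succ n =>
    have := key n α hα
    rwa [hn, mul_zero] at this

theorem abel_le {n : ℕ} (α : Fin n → ℝ) (hα : Antitone α) (e f : ℕ → ℝ) (h0 : e 0 = f 0)
    (hn : e n = f n) (he : ∀ s, f s ≤ e s) : wsum α f ≤ wsum α e := by
  have := abel_nonneg α hα (fun s => e s - f s) (by simp [h0]) (by simp [hn])
    (fun s => by have := he s; linarith)
  rw [wsum_sub] at this
  linarith

/-- degree of a subspace with respect to weighted flags -/
noncomputable def deg {K : Type*} [Field K] {n : ℕ} (α : Fin 3 → Fin n → ℝ)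
    (M : Fin 3 → Matrix (Fin n) (Fin n) K) (V : Submodule K (Fin n → K)) : ℝ :=
  ∑ k, wsum (α k) (fun s => (finrank K ↥(V ⊓ Fl (M k) s) : ℝ))

theorem finrank_map_add {K X Z : Type*} [Field K] [AddCommGroup X] [Module K X]
    [AddCommGroup Z] [Module K Z] [FiniteDimensional K X]
    (g : X →ₗ[K] Z) (S : Submodule K X) :
    finrank K ↥(S.map g) + finrank K ↥(S ⊓ LinearMap.ker g) = finrank K S := by
  have h := LinearMap.finrank_range_add_finrank_ker (g.domRestrict S)
  have h1 : LinearMap.range (g.domRestrict S) = S.map g := by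
    rw [LinearMap.range_domRestrict]
  have h2 : finrank K (LinearMap.ker (g.domRestrict S)) = finrank K ↥(S ⊓ LinearMap.ker g) := by
    rw [← LinearMap.finrank_range_of_inj (f := S.subtype.comp (LinearMap.ker (g.domRestrict S)).subtype)
      (by exact Subtype.val_injective.comp Subtype.val_injective)]
    have : LinearMap.range (S.subtype.comp (LinearMap.ker (g.domRestrict S)).subtype) =
        S ⊓ LinearMap.ker g := by
      ext x
      constructor
      · rintro ⟨y, rfl⟩
        exact ⟨y.1.2, y.2⟩
      · rintro ⟨h1, h2⟩
        exact ⟨⟨⟨x, h1⟩, h2⟩, rfl⟩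
    rw [this]
  rw [h1, h2] at h
  exact h

theorem hom_vanish {K X : Type*} [Field K] [AddCommGroup X] [Module K X]
    [FiniteDimensional K X] {n : ℕ} (α : Fin 3 → Fin n → ℝ) (hα : ∀ k, Antitone (α k))
    (H H' : Fin 3 → ℕ → Submodule K X)
    (h0 : ∀ k, H k 0 = ⊥) (h0' : ∀ k, H' k 0 = ⊥) (hn : ∀ k, H k n = ⊤) (hn' : ∀ k, H' k n = ⊤)
    (d : Submodule K X → ℝ)
    (hd : ∀ U, ∑ k, wsum (α k) (fun s => (finrank K ↥(U ⊓ H k s) : ℝ)) = d U)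
    (hd' : ∀ U, ∑ k, wsum (α k) (fun s => (finrank K ↥(U ⊓ H' k s) : ℝ)) = d U)
    (V : Submodule K X) (hV : ∀ U, d U ≤ d V) (hV2 : ∀ U, d U = d V → finrank K U ≤ finrank K V)
    (φ : X →ₗ[K] X) (hφ : ∀ k s, ∀ x ∈ V, x ∈ H k s → φ x ∈ V ⊔ H' k s) :
    ∀ x ∈ V, φ x ∈ V := by
  set U := V ⊓ V.comap φ with hU
  set U2 := V ⊔ V.map φ with hU2
  let g := V.mkQ.comp φ
  have hker : LinearMap.ker g = V.comap φ := by
    ext x; simp [g]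
  have a1 : ∀ k s, finrank K ↥((V ⊓ H k s).map g) + finrank K ↥(U ⊓ H k s) =
      finrank K ↥(V ⊓ H k s) := by
    intro k s
    rw [← finrank_map_add g (V ⊓ H k s), hker, hU]
    rw [inf_right_comm]
  have a2 : ∀ k s, finrank K ↥((U2 ⊓ H' k s).map V.mkQ) + finrank K ↥(V ⊓ H' k s) =
      finrank K ↥(U2 ⊓ H' k s) := by
    intro k s
    rw [← finrank_map_add V.mkQ (U2 ⊓ H' k s), Submodule.ker_mkQ]
    rw [inf_right_comm, inf_eq_right.2 (le_sup_left : V ≤ U2)]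
  have a3 : ∀ k s, (V ⊓ H k s).map g ≤ (U2 ⊓ H' k s).map V.mkQ := by
    rintro k s _ ⟨x, ⟨hx1, hx2⟩, rfl⟩
    obtain ⟨v, hv, h, hh, hvh⟩ := Submodule.mem_sup.1 (hφ k s x hx1 hx2)
    refine ⟨h, ⟨?_, hh⟩, ?_⟩
    · have : h = φ x - v := by rw [← hvh]; abel
      rw [this]
      exact Submodule.sub_mem _ (Submodule.mem_sup_right ⟨x, hx1, rfl⟩) (Submodule.mem_sup_left hv)
    · simp only [g, LinearMap.comp_apply, Submodule.mkQ_apply]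
      rw [Submodule.Quotient.eq, ← hvh]
      simpa using hv
  have a4 : V.map g = U2.map V.mkQ := by
    rw [hU2, Submodule.map_sup, Submodule.map_comp]
    have : V.map V.mkQ = ⊥ := by
      rw [eq_bot_iff]
      rintro _ ⟨x, hx, rfl⟩
      simpa using hx
    rw [this, bot_sup_eq]
  have a5 : ∀ k, wsum (α k) (fun s => (finrank K ↥(V ⊓ H k s) : ℝ)) -
      wsum (α k) (fun s => (finrank K ↥(U ⊓ H k s) : ℝ)) ≤
      wsum (α k) (fun s => (finrank K ↥(U2 ⊓ H' k s) : ℝ)) -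
      wsum (α k) (fun s => (finrank K ↥(V ⊓ H' k s) : ℝ)) := by
    intro k
    rw [← wsum_sub, ← wsum_sub]
    refine abel_le _ (hα k) _ _ ?_ ?_ ?_
    · rw [h0 k, h0' k]; rw [inf_bot_eq, inf_bot_eq, inf_bot_eq]
    · have b1 := a1 k n
      have b2 := a2 k n
      rw [hn k, inf_top_eq, inf_top_eq] at b1 ⊢
      rw [hn' k, inf_top_eq, inf_top_eq] at b2 ⊢
      rw [a4] at b1
      have b3 : ((finrank K ↥(Submodule.map V.mkQ U2) + finrank K ↥U : ℕ) : ℝ) = finrank K ↥V :=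
        congrArg _ b1
      have b4 : ((finrank K ↥(Submodule.map V.mkQ U2) + finrank K ↥V : ℕ) : ℝ) = finrank K ↥U2 :=
        congrArg _ b2
      push_cast at b3 b4
      linarith
    · intro s
      have b1 := a1 k s
      have b2 := a2 k s
      have b3 := Submodule.finrank_mono (a3 k s)
      rw [← b1, ← b2]
      push_cast
      have : (finrank K ↥((V ⊓ H k s).map g) : ℝ) ≤ finrank K ↥((U2 ⊓ H' k s).map V.mkQ) := by
        exact_mod_cast b3
      linarith
  have a6 := Finset.sum_le_sum fun k (_ : k ∈ Finset.univ) => a5 k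
  rw [Finset.sum_sub_distrib, Finset.sum_sub_distrib, hd, hd, hd', hd'] at a6
  have a7 := hV U
  have a8 := hV U2
  have a9 := hV2 U2 (by linarith)
  have a10 : V = U2 := Submodule.eq_of_le_of_finrank_le le_sup_left a9
  intro x hx
  rw [a10]
  exact Submodule.mem_sup_right ⟨x, hx, rfl⟩

/-- number of inversions -/
def cnt {n : ℕ} (I : Finset (Fin n)) : ℕ :=
  Fintype.card {q : Fin n × Fin n // q.2 ∈ I ∧ q.1 ∉ I ∧ q.2 < q.1}

theorem cnt_eq {n : ℕ} (I : Finset (Fin n)) :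
    2 * cnt I + I.card * I.card + I.card =
      2 * ∑ s ∈ Finset.range n, (I.filter fun j => j.1 < s + 1).card := by
  classical
  have h1 : cnt I = ∑ j ∈ I, ∑ i ∈ Iᶜ, if j < i then 1 else 0 := by
    unfold cnt
    rw [Fintype.card_subtype, Finset.sum_sigma']
    rw [← Finset.sum_filter, ← Finset.card_eq_sum_ones]
    refine Finset.card_bij (fun q _ => ⟨q.2, q.1⟩) ?_ ?_ ?_
    · intro q hq
      simp at hq ⊢
      tauto
    · rintro ⟨a, b⟩ _ ⟨c, d⟩ _ h
      simp at h
      simp [h]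
    · rintro ⟨a, b⟩ h
      refine ⟨(b, a), ?_, rfl⟩
      simp at h ⊢
      tauto
  have h2 : ∑ s ∈ Finset.range n, (I.filter fun j => j.1 < s + 1).card =
      ∑ j ∈ I, ∑ i : Fin n, if j ≤ i then 1 else 0 := by
    rw [Finset.sum_comm, ← Fin.sum_univ_eq_sum_range (fun s => (I.filter fun j => j.1 < s + 1).card)]
    refine Finset.sum_congr rfl fun i _ => ?_
    rw [Finset.card_filter]
    refine Finset.sum_congr rfl fun j _ => ?_
    simp only [Fin.le_def, Nat.lt_succ_iff]
  have h3 : ∑ j ∈ I, ∑ i : Fin n, (if j ≤ i then 1 else 0) =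
      (∑ j ∈ I, ∑ i ∈ I, if j ≤ i then 1 else 0) + cnt I := by
    rw [h1, ← Finset.sum_add_distrib]
    refine Finset.sum_congr rfl fun j hj => ?_
    rw [← Finset.sum_add_sum_compl I]
    congr 1
    refine Finset.sum_congr rfl fun i hi => ?_
    have : j ≠ i := by rintro rfl; simp at hi; exact hi hj
    simp [lt_iff_le_and_ne, this]
  have h4 : 2 * (∑ j ∈ I, ∑ i ∈ I, if j ≤ i then 1 else 0) = I.card * I.card + I.card := by
    have : ∑ j ∈ I, ∑ i ∈ I, (if j ≤ i then 1 else 0) = ∑ j ∈ I, ∑ i ∈ I, if i ≤ j then 1 else 0 :=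
      Finset.sum_comm
    rw [two_mul]
    nth_rw 2 [this]
    rw [← Finset.sum_add_distrib]
    have h5 : ∀ j ∈ I, (∑ i ∈ I, (if j ≤ i then 1 else 0)) + (∑ i ∈ I, if i ≤ j then 1 else 0) =
        I.card + 1 := by
      intro j hj
      rw [← Finset.sum_add_distrib]
      have : ∀ i ∈ I, ((if j ≤ i then 1 else 0) + if i ≤ j then 1 else 0) = 1 + if i = j then 1 else 0 := by
        intro i _
        rcases lt_trichotomy i j with h | h | h
        · simp [h.le, h.not_ge, h.ne]
        · simp [h]
        · simp [h.le, h.not_ge, h.ne']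
      rw [Finset.sum_congr rfl this, Finset.sum_add_distrib]
      simp [hj]
    rw [Finset.sum_congr rfl h5]
    simp; ring
  rw [h2, h3]
  omega

section count
variable {K : Type*} [Field K] {n : ℕ}

/-- index set for the obstruction coordinates -/
abbrev Sk (I : Finset (Fin n)) := {q : Fin n × Fin n // q.2 ∈ I ∧ q.1 ∉ I ∧ q.2 < q.1}

/-- index set for maps modulo the parabolic -/
abbrev Tk (I : Finset (Fin n)) := {q : Fin n × Fin n // q.2 ∈ I ∧ q.1 ∉ I}

theorem card_Tk (I : Finset (Fin n)) : Fintype.card (Tk I) = I.card * (n - I.card) := by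
  classical
  rw [Fintype.card_subtype]
  have : (Finset.univ.filter fun q : Fin n × Fin n => q.2 ∈ I ∧ q.1 ∉ I) = Iᶜ ×ˢ I := by
    ext q; simp [and_comm]
  rw [this, Finset.card_product, Finset.card_compl, Fintype.card_fin, mul_comm]

open Classical in
/-- matrix with given entries -/
noncomputable def ent (P : Fin n × Fin n → Prop) (t : {q // P q} → K) : Matrix (Fin n) (Fin n) K :=
  fun i j => if h : P (i, j) then t ⟨(i, j), h⟩ else 0

open Classical in
/-- `Phi` as linear map -/
noncomputable def Phi (g : Fin 3 → Matrix (Fin n) (Fin n) K) (I : Fin 3 → Finset (Fin n)) :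
    (Tk (I 0) → K) →ₗ[K] ((Σ k, Sk (I k)) → K) where
  toFun t := fun q => ((g q.1)⁻¹ * (g 0 * ent _ t * (g 0)⁻¹) * g q.1) q.2.1.1 q.2.1.2
  map_add' a b := by
    ext q
    have : (ent _ (a + b) : Matrix (Fin n) (Fin n) K) = ent _ a + ent _ b := by
      ext i j
      simp only [ent, Matrix.add_apply]
      split_ifs <;> simp
    simp [this, mul_add, add_mul]
  map_smul' c a := by
    ext q
    have : (ent _ (c • a) : Matrix (Fin n) (Fin n) K) = c • ent _ a := by
      ext i j
      simp only [ent, Matrix.smul_apply]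
      split_ifs <;> simp
    simp [this]

theorem inv_conj {g : Matrix (Fin n) (Fin n) K} (hg : IsUnit g.det) (T : Matrix (Fin n) (Fin n) K) :
    g⁻¹ * (g * T * g⁻¹) * g = T := by
  have h1 := Matrix.nonsing_inv_mul _ hg
  rw [← mul_assoc, ← mul_assoc, h1, one_mul, mul_assoc, h1, mul_one]

variable {M g : Fin 3 → Matrix (Fin n) (Fin n) K} (hg : ∀ k, IsUnit (g k).det)
    (hgM : ∀ k s, Fl (g k) s = Fl (M k) s)
    {V : Submodule K (Fin n → K)} {I : Fin 3 → Finset (Fin n)}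
    (hI : ∀ k y, g k *ᵥ y ∈ V ↔ ∀ j, j ∉ I k → y j = 0)
include hg hgM hI

theorem Phi_surj_iff : Function.Surjective (Phi g I) ↔ ExtVan M V := by
  classical
  constructor
  · intro h ξ
    obtain ⟨t, ht⟩ := h (fun q => ((g q.1)⁻¹ * ξ q.1 * g q.1) q.2.1.1 q.2.1.2)
    refine ⟨g 0 * ent _ t * (g 0)⁻¹, fun k => ?_⟩
    rw [TF_iff (hg k) (hgM k) (hI k)]
    intro i j hj hi hji
    have := congrFun ht ⟨k, ⟨(i, j), hj, hi, hji⟩⟩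
    simp only [Phi, LinearMap.coe_mk, AddHom.coe_mk] at this
    rw [mul_sub, sub_mul, Matrix.sub_apply, this, sub_self]
  · intro h u
    obtain ⟨φ, hφ⟩ := h (fun k => g k * ent _ (fun q => u ⟨k, q⟩) * (g k)⁻¹)
    refine ⟨fun q => ((g 0)⁻¹ * φ * g 0) q.1.1 q.1.2, ?_⟩
    ext ⟨k, ⟨⟨i, j⟩, hj, hi, hji⟩⟩
    have h1 := (TF_iff (hg k) (hgM k) (hI k) _).1 (hφ k) i j hj hi hji
    rw [mul_sub, sub_mul, inv_conj (hg k), Matrix.sub_apply, sub_eq_zero] at h1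
    simp only [Phi, LinearMap.coe_mk, AddHom.coe_mk]
    have h2 : (ent _ (fun q => u ⟨k, q⟩) : Matrix (Fin n) (Fin n) K) i j = u ⟨k, ⟨(i, j), hj, hi, hji⟩⟩ := by
      simp only [ent]
      rw [dif_pos ⟨hj, hi, hji⟩]
    rw [← h2, h1]
    set φ' := g 0 * ent (fun q => q.2 ∈ I 0 ∧ q.1 ∉ I 0)
      (fun q => ((g 0)⁻¹ * φ * g 0) q.1.1 q.1.2) * (g 0)⁻¹ with hφ'
    have h3 : ∀ x ∈ V, (φ' - φ) *ᵥ x ∈ V := by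
      rw [pres_iff (hg 0) (hI 0)]
      intro i j hj hi
      rw [mul_sub, sub_mul, hφ', inv_conj (hg 0), Matrix.sub_apply]
      simp only [ent]
      rw [dif_pos ⟨hj, hi⟩, sub_self]
    have h4 := (pres_iff (hg k) (hI k) _).1 h3 i j hj hi
    rw [mul_sub, sub_mul, Matrix.sub_apply, sub_eq_zero] at h4
    exact h4

theorem Phi_inj (h : ∀ φ, (∀ k, TF (M k) V φ) → ∀ x ∈ V, φ *ᵥ x ∈ V) :
    Function.Injective (Phi g I) := by
  classical
  rw [injective_iff_map_eq_zero]
  intro t ht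
  have h1 := h (g 0 * ent _ t * (g 0)⁻¹) (fun k => by
    rw [TF_iff (hg k) (hgM k) (hI k)]
    intro i j hj hi hji
    exact congrFun ht ⟨k, ⟨(i, j), hj, hi, hji⟩⟩)
  rw [pres_iff (hg 0) (hI 0)] at h1
  ext ⟨⟨i, j⟩, hj, hi⟩
  have := h1 i j hj hi
  rw [inv_conj (hg 0)] at this
  simp only [ent] at this
  rwa [dif_pos ⟨hj, hi⟩] at this

theorem count1 (h : ExtVan M V) : ∑ k, cnt (I k) ≤ (I 0).card * (n - (I 0).card) := by
  classical
  have h1 := (Phi_surj_iff hg hgM hI).2 h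
  have h2 := LinearMap.finrank_le_finrank_of_surjective (f := Phi g I) h1
  rw [finrank_fintype_fun_eq_card, finrank_fintype_fun_eq_card, card_Tk, Fintype.card_sigma] at h2
  exact h2

theorem count2 (h : ∀ φ, (∀ k, TF (M k) V φ) → ∀ x ∈ V, φ *ᵥ x ∈ V)
    (hc : ∑ k, cnt (I k) ≤ (I 0).card * (n - (I 0).card)) : ExtVan M V := by
  classical
  rw [← Phi_surj_iff hg hgM hI]
  have h1 := Phi_inj hg hgM hI h
  have h2 := LinearMap.finrank_le_finrank_of_injective (f := Phi g I) h1
  have h3 : finrank K ((Σ k, Sk (I k)) → K) ≤ finrank K (Tk (I 0) → K) := by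
    rw [finrank_fintype_fun_eq_card, finrank_fintype_fun_eq_card, card_Tk, Fintype.card_sigma]
    exact hc
  exact (LinearMap.injective_iff_surjective_of_finrank_eq_finrank (le_antisymm h2 h3)).1 h1

end count

end HSR

namespace HSR
open Module Matrix

/-! ### Part E: doubling -/

/-- interleaved index -/
def ix {p : ℕ} (b : Bool) (a : Fin p) : Fin (2 * p) :=
  ⟨2 * a.1 + b.toNat, by have := a.2; cases b <;> simp <;> omega⟩

/-- half -/
def hf {p : ℕ} (i : Fin (2 * p)) : Fin p := ⟨i.1 / 2, by have := i.2; omega⟩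

/-- parity -/
def par {p : ℕ} (i : Fin (2 * p)) : Bool := decide (i.1 % 2 = 1)

@[simp] theorem hf_ix {p : ℕ} (b : Bool) (a : Fin p) : hf (ix b a) = a := by
  cases b <;> simp [hf, ix, Fin.ext_iff] <;> omega

@[simp] theorem par_ix {p : ℕ} (b : Bool) (a : Fin p) : par (ix b a) = b := by
  cases b <;> simp [par, ix] <;> omega

@[simp] theorem ix_par_hf {p : ℕ} (i : Fin (2 * p)) : ix (par i) (hf i) = i := by
  rcases Nat.mod_two_eq_zero_or_one i.1 with h | h <;> simp [hf, ix, par, Fin.ext_iff, h] <;> omega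

/-- index equivalence -/
def ixE (p : ℕ) : Bool × Fin p ≃ Fin (2 * p) where
  toFun q := ix q.1 q.2
  invFun i := (par i, hf i)
  left_inv q := by simp
  right_inv i := by simp

theorem sum_ix {p : ℕ} {β : Type*} [AddCommMonoid β] (f : Fin (2 * p) → β) :
    ∑ i, f i = ∑ b, ∑ a, f (ix b a) := by
  rw [← Equiv.sum_comp (ixE p), Fintype.sum_prod_type]
  rfl

/-- half steps -/
def hs (b : Bool) (s : ℕ) : ℕ := if b then s / 2 else (s + 1) / 2

theorem hs_le (b : Bool) (s a : ℕ) : hs b s ≤ a ↔ s ≤ 2 * a + b.toNat := by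
  cases b <;> simp [hs] <;> omega

@[simp] theorem hs_zero (b : Bool) : hs b 0 = 0 := by cases b <;> simp [hs]
@[simp] theorem hs_two (b : Bool) (p : ℕ) : hs b (2 * p) = p := by cases b <;> simp [hs] <;> omega

theorem wsum_hs {p : ℕ} (σ : Fin (2 * p) → ℝ) (b : Bool) (e : ℕ → ℝ) :
    wsum σ (fun s => e (hs b s)) = wsum (fun a => σ (ix b a)) e := by
  unfold wsum
  rw [sum_ix, Fintype.sum_bool]
  cases b
  · have : ∀ a : Fin p, hs false ((ix true a).1 + 1) = hs false (ix true a).1 := by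
      intro a; simp [hs, ix]; omega
    simp only [this, sub_self, mul_zero, Finset.sum_const_zero, zero_add]
    refine Finset.sum_congr rfl fun a _ => ?_
    have h1 : hs false ((ix false a).1 + 1) = a.1 + 1 := by simp [hs, ix]; omega
    have h2 : hs false ((ix false a).1) = a.1 := by simp [hs, ix]; omega
    rw [h1, h2]
  · have : ∀ a : Fin p, hs true ((ix false a).1 + 1) = hs true (ix false a).1 := by
      intro a; simp [hs, ix]; omega
    simp only [this, sub_self, mul_zero, Finset.sum_const_zero, add_zero]
    refine Finset.sum_congr rfl fun a _ => ?_
    have h1 : hs true ((ix true a).1 + 1) = a.1 + 1 := by simp [hs, ix]; omega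
    have h2 : hs true ((ix true a).1) = a.1 := by simp [hs, ix]; omega
    rw [h1, h2]

section
variable {p : ℕ}

/-- projections -/
def pr (b : Bool) : (Fin (2 * p) → ℝ) →ₗ[ℝ] (Fin p → ℝ) where
  toFun y a := y (ix b a)
  map_add' _ _ := rfl
  map_smul' _ _ := rfl

/-- injections -/
def inj (b : Bool) : (Fin p → ℝ) →ₗ[ℝ] (Fin (2 * p) → ℝ) where
  toFun y i := if par i = b then y (hf i) else 0
  map_add' _ _ := by ext i; simp only [Pi.add_apply]; split_ifs <;> simp
  map_smul' _ _ := by ext i; simp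

theorem pr_inj (b c : Bool) (x : Fin p → ℝ) : pr b (inj c x) = if b = c then x else 0 := by
  ext a
  by_cases h : b = c <;> simp [pr, inj, h]

theorem ext_pr {x y : Fin (2 * p) → ℝ} (h : ∀ b, pr b x = pr b y) : x = y := by
  ext i
  have := congrFun (h (par i)) (hf i)
  simpa [pr] using this

/-- interleaved matrix -/
def inter (c : Bool) (R : Bool → Matrix (Fin p) (Fin p) ℝ) :
    Matrix (Fin (2 * p)) (Fin (2 * p)) ℝ :=
  fun i j => if par i = xor (par j) c then R (par j) (hf i) (hf j) else 0

theorem pr_inter (c b : Bool) (R : Bool → Matrix (Fin p) (Fin p) ℝ) (y : Fin (2 * p) → ℝ) :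
    pr (xor b c) (inter c R *ᵥ y) = R b *ᵥ pr b y := by
  ext a
  change ∑ j, inter c R (ix (xor b c) a) j * y j = ∑ j, R b a j * y (ix b j)
  rw [sum_ix, Fintype.sum_bool]
  cases b <;> cases c <;> simp [inter]

theorem inter_unit (c : Bool) (R : Bool → Matrix (Fin p) (Fin p) ℝ) (hR : ∀ b, IsUnit (R b).det) :
    IsUnit (inter c R).det := by
  rw [← Matrix.isUnit_iff_isUnit_det, ← Matrix.mulVec_injective_iff_isUnit]
  intro x y hxy
  refine ext_pr fun b => mulVec_inj (hR b) ?_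
  change R b *ᵥ _ = R b *ᵥ _
  rw [← pr_inter c, ← pr_inter c, hxy]

theorem mem_Fl_inter (c : Bool) (R : Bool → Matrix (Fin p) (Fin p) ℝ) (hR : ∀ b, IsUnit (R b).det)
    (s : ℕ) (x : Fin (2 * p) → ℝ) :
    x ∈ Fl (inter c R) s ↔ ∀ b, pr (xor b c) x ∈ Fl (R b) (hs b s) := by
  obtain ⟨y, rfl⟩ : ∃ y, inter c R *ᵥ y = x := ⟨_, mul_inv_mulVec (inter_unit c R hR) x⟩
  rw [mulVec_mem_Fl (inter_unit c R hR)]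
  simp only [pr_inter, mulVec_mem_Fl (hR _)]
  constructor
  · intro h b a ha
    exact h _ ((hs_le b s a.1).1 ha)
  · intro h j hj
    have := h (par j) (hf j) ((hs_le _ _ _).2 (by
      have e := congrArg Fin.val (ix_par_hf j)
      simp only [ix] at e
      rw [e]; exact hj))
    simpa [pr] using this

/-- product subspace -/
def prod2 (A : Bool → Submodule ℝ (Fin p → ℝ)) : Submodule ℝ (Fin (2 * p) → ℝ) :=
  ⨅ b, (A b).comap (pr b)

theorem mem_prod2 {A : Bool → Submodule ℝ (Fin p → ℝ)} {x : Fin (2 * p) → ℝ} :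
    x ∈ prod2 A ↔ ∀ b, pr b x ∈ A b := by simp [prod2]

theorem finrank_prod2 (A : Bool → Submodule ℝ (Fin p → ℝ)) :
    finrank ℝ (prod2 A) = finrank ℝ (A false) + finrank ℝ (A true) := by
  let f : (A false × A true) →ₗ[ℝ] (Fin (2 * p) → ℝ) :=
    LinearMap.coprod ((inj false).comp (A false).subtype) ((inj true).comp (A true).subtype)
  have hf : ∀ q, f q = inj false q.1.1 + inj true q.2.1 := fun q => rfl
  have h1 : Function.Injective f := by
    intro q q' h
    rw [hf, hf] at h
    have e1 := congrArg (pr false) h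
    have e2 := congrArg (pr true) h
    simp only [map_add, pr_inj] at e1 e2
    ext i
    · simpa using congrFun e1 i
    · simpa using congrFun e2 i
  have h2 : LinearMap.range f = prod2 A := by
    ext x
    rw [mem_prod2]
    constructor
    · rintro ⟨q, rfl⟩ b
      rw [hf, map_add, pr_inj, pr_inj]
      cases b
      · simp
      · simp
    · intro h
      refine ⟨(⟨pr false x, h false⟩, ⟨pr true x, h true⟩), ext_pr fun b => ?_⟩
      rw [hf, map_add, pr_inj, pr_inj]
      cases b <;> simp
  rw [← h2, LinearMap.finrank_range_of_inj h1, Module.finrank_prod]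

theorem finrank_prod2_Fl (c : Bool) (R : Bool → Matrix (Fin p) (Fin p) ℝ)
    (hR : ∀ b, IsUnit (R b).det) (V : Submodule ℝ (Fin p → ℝ)) (s : ℕ) :
    finrank ℝ ↥(prod2 (fun _ => V) ⊓ Fl (inter c R) s) =
      finrank ℝ ↥(V ⊓ Fl (R false) (hs false s)) + finrank ℝ ↥(V ⊓ Fl (R true) (hs true s)) := by
  have : prod2 (fun _ => V) ⊓ Fl (inter c R) s =
      prod2 (fun b => V ⊓ Fl (R (xor b c)) (hs (xor b c) s)) := by
    ext x
    simp only [Submodule.mem_inf, mem_prod2, mem_Fl_inter c R hR]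
    cases c
    · simp; tauto
    · simp; tauto
  rw [this, finrank_prod2]
  cases c
  · rfl
  · exact add_comm _ _
end

theorem exists_maximizer {p : ℕ} (α : Fin 3 → Fin p → ℝ) (F : Fin 3 → Matrix (Fin p) (Fin p) ℝ)
    : ∃ V, (∀ U, deg α F U ≤ deg α F V) ∧
      ∀ U, deg α F U = deg α F V → finrank ℝ U ≤ finrank ℝ V := by
  have hlt : ∀ U : Submodule ℝ (Fin p → ℝ), finrank ℝ U < p + 1 := by
    intro U
    have := Submodule.finrank_le U
    rw [finrank_fin_fun] at this
    omega
  have hfin : (Set.range (deg α F)).Finite := by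
    let S : (Fin 3 → Fin (p + 1) → Fin (p + 1)) → ℝ := fun t =>
      ∑ k, ∑ i : Fin p, α k i * ((t k i.succ : ℝ) - (t k i.castSucc : ℝ))
    refine (Set.finite_range S).subset ?_
    rintro _ ⟨U, rfl⟩
    exact ⟨fun k s => ⟨finrank ℝ ↥(U ⊓ Fl (F k) s), hlt _⟩, rfl⟩
  obtain ⟨_, ⟨V1, rfl⟩, h1⟩ := Set.exists_max_image _ id hfin ⟨_, ⟨⊥, rfl⟩⟩
  have hfin2 : ((fun U : Submodule ℝ (Fin p → ℝ) => finrank ℝ U) '' {U | deg α F U = deg α F V1}).Finite := by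
    refine (Set.finite_lt_nat (p + 1)).subset ?_
    rintro _ ⟨U, _, rfl⟩
    exact hlt U
  obtain ⟨_, ⟨V, hV, rfl⟩, h2⟩ := Set.exists_max_image _ id hfin2 ⟨_, ⟨V1, rfl, rfl⟩⟩
  have hV' : deg α F V = deg α F V1 := hV
  refine ⟨V, fun U => ?_, fun U hU => ?_⟩
  · rw [hV']
    exact h1 _ ⟨U, rfl⟩
  · exact h2 _ ⟨U, hU.trans hV', rfl⟩

/-- The triple of pairs of flags. -/
def RR {p : ℕ} (F : Fin 3 → Matrix (Fin p) (Fin p) ℝ) : Fin 3 → Bool → Matrix (Fin p) (Fin p) ℝ :=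
  ![fun b => if b then F 1 else F 0, fun b => if b then F 1 else F 0, fun _ => F 2]

/-- The twists. -/
def cc : Fin 3 → Bool := ![false, true, false]

theorem sum_two_mul (p : ℕ) (f : ℕ → ℕ) : ∑ s ∈ Finset.range (2 * p), f s =
      ∑ a ∈ Finset.range p, (f (2 * a) + f (2 * a + 1)) := by
  induction p with
  | zero => simp
  | succ p ih =>
    rw [show 2 * (p + 1) = 2 * p + 1 + 1 from by ring, Finset.sum_range_succ,
      Finset.sum_range_succ, Finset.sum_range_succ, ih]
    ring

theorem cnt_inter {p : ℕ} {c : Bool} {R : Bool → Matrix (Fin p) (Fin p) ℝ}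
    (hR : ∀ b, IsUnit (R b).det) {V : Submodule ℝ (Fin p → ℝ)}
    {g : Bool → Matrix (Fin p) (Fin p) ℝ} {I : Bool → Finset (Fin p)}
    (hg : ∀ b, IsUnit (g b).det) (hgR : ∀ b s, Fl (g b) s = Fl (R b) s)
    (hI : ∀ b y, g b *ᵥ y ∈ V ↔ ∀ j, j ∉ I b → y j = 0)
    {G : Matrix (Fin (2 * p)) (Fin (2 * p)) ℝ} {J : Finset (Fin (2 * p))}
    (hG : IsUnit G.det) (hGR : ∀ s, Fl G s = Fl (inter c R) s)
    (hJ : ∀ y, G *ᵥ y ∈ prod2 (fun _ => V) ↔ ∀ j, j ∉ J → y j = 0) :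
    cnt J = 2 * cnt (I false) + 2 * cnt (I true) ∧ J.card = 2 * finrank ℝ V ∧
      ∀ b, (I b).card = finrank ℝ V := by
  have hv : ∀ b s, ((I b).filter fun j => j.1 < s).card = finrank ℝ ↥(V ⊓ Fl (R b) s) := by
    intro b s
    rw [← finrank_inf_Fl (hg b) (hI b), hgR]
  have hw : ∀ s, (J.filter fun j => j.1 < s).card =
      finrank ℝ ↥(V ⊓ Fl (R false) (hs false s)) + finrank ℝ ↥(V ⊓ Fl (R true) (hs true s)) := by
    intro s
    rw [← finrank_inf_Fl hG hJ, hGR, finrank_prod2_Fl c R hR]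
  have hcI : ∀ b, (I b).card = finrank ℝ V := by
    intro b
    have := hv b p
    rw [Fl_top (hR b) le_rfl, inf_top_eq, Finset.filter_true_of_mem (fun j _ => j.2)] at this
    exact this
  have hcJ : J.card = 2 * finrank ℝ V := by
    have := hw (2 * p)
    rw [hs_two, hs_two, Fl_top (hR _) le_rfl, Fl_top (hR _) le_rfl, inf_top_eq,
      Finset.filter_true_of_mem (fun j _ => j.2)] at this
    omega
  have hI2 := fun b => cnt_eq (I b)
  have hJ2 := cnt_eq J
  simp only [hv, hcI] at hI2
  simp only [hw, hcJ] at hJ2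
  set v := fun s => finrank ℝ ↥(V ⊓ Fl (R false) s) with hvdef
  set v' := fun s => finrank ℝ ↥(V ⊓ Fl (R true) s) with hvdef'
  have hJ3 : ∑ s ∈ Finset.range (2 * p), (v (hs false (s + 1)) + v' (hs true (s + 1))) =
      2 * ∑ a ∈ Finset.range p, v (a + 1) + (∑ a ∈ Finset.range p, v' a) +
        ∑ a ∈ Finset.range p, v' (a + 1) := by
    rw [sum_two_mul, Finset.mul_sum, ← Finset.sum_add_distrib, ← Finset.sum_add_distrib]
    refine Finset.sum_congr rfl fun a _ => ?_
    have e1 : hs false (2 * a + 1) = a + 1 := by simp [hs]; omega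
    have e2 : hs true (2 * a + 1) = a := by simp [hs]; omega
    have e3 : hs false (2 * a + 1 + 1) = a + 1 := by simp [hs]; omega
    have e4 : hs true (2 * a + 1 + 1) = a + 1 := by simp [hs]; omega
    rw [e1, e2, e3, e4]; ring
  have hv0 : v' 0 = 0 := by
    rw [hvdef']; simp only; rw [Fl_zero, inf_bot_eq, finrank_bot]
  have hvp : v' p = finrank ℝ V := by
    rw [hvdef']; simp only; rw [Fl_top (hR _) le_rfl, inf_top_eq]
  have hJ4 : (∑ a ∈ Finset.range p, v' a) + finrank ℝ V = ∑ a ∈ Finset.range p, v' (a + 1) := by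
    rw [← hvp, ← Finset.sum_range_succ, Finset.sum_range_succ', hv0, add_zero]
  refine ⟨?_, hcJ, hcI⟩
  have a1 := hI2 false
  have a2 := hI2 true
  change _ = 2 * ∑ a ∈ Finset.range p, v (a + 1) at a1
  change _ = 2 * ∑ a ∈ Finset.range p, v' (a + 1) at a2
  change _ = 2 * ∑ s ∈ Finset.range (2 * p), (v (hs false (s + 1)) + v' (hs true (s + 1))) at hJ2
  rw [hJ3] at hJ2
  nlinarith

end HSR

namespace HSR
open Module Matrix

/-- small weights -/
noncomputable def sw {p : ℕ} (σ δ : Fin (2 * p) → ℝ) : Fin 3 → Fin p → ℝ :=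
  ![fun a => σ (ix false a), fun a => σ (ix true a),
    fun a => (δ (ix false a) + δ (ix true a)) / 2]

theorem ix_mono {p : ℕ} (b : Bool) {a a' : Fin p} (h : a ≤ a') : ix b a ≤ ix b a' := by
  simp only [ix, Fin.le_def] at h ⊢; omega

theorem sw_antitone {p : ℕ} {σ δ : Fin (2 * p) → ℝ} (hσ : Antitone σ) (hδ : Antitone δ) (k : Fin 3) :
    Antitone (sw σ δ k) := by
  intro a a' h
  have h1 := ix_mono false h
  have h2 := ix_mono true h
  fin_cases k
  · exact hσ h1
  · exact hσ h2
  · have := hδ h1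
    have := hδ h2
    simp only [sw]
    change (_ : ℝ) / 2 ≤ _ / 2
    linarith

theorem wsum_add {n : ℕ} (α : Fin n → ℝ) (e f : ℕ → ℝ) :
    wsum α (fun s => e s + f s) = wsum α e + wsum α f := by
  simp only [wsum, ← Finset.sum_add_distrib]
  exact Finset.sum_congr rfl fun i _ => by ring

/-- big flags -/
def GG {p : ℕ} (F : Fin 3 → Matrix (Fin p) (Fin p) ℝ) (k : Fin 3) :
    Matrix (Fin (2 * p)) (Fin (2 * p)) ℝ := inter (cc k) (RR F k)

theorem RR_unit {p : ℕ} {F : Fin 3 → Matrix (Fin p) (Fin p) ℝ} (hF : ∀ k, IsUnit (F k).det)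
    (k : Fin 3) (b : Bool) : IsUnit (RR F k b).det := by
  fin_cases k <;> cases b <;> simpa [RR, isUnit_iff_ne_zero] using hF _

theorem deg_GG {p : ℕ} (σ δ : Fin (2 * p) → ℝ) {F : Fin 3 → Matrix (Fin p) (Fin p) ℝ}
    (hF : ∀ k, IsUnit (F k).det) (V : Submodule ℝ (Fin p → ℝ)) :
    deg ![σ, σ, δ] (GG F) (prod2 fun _ => V) = 2 * deg (sw σ δ) F V := by
  have key : ∀ (τ : Fin (2 * p) → ℝ) (k : Fin 3),
      wsum τ (fun s => (finrank ℝ ↥(prod2 (fun _ => V) ⊓ Fl (GG F k) s) : ℝ)) =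
      wsum (fun a => τ (ix false a)) (fun s => (finrank ℝ ↥(V ⊓ Fl (RR F k false) s) : ℝ)) +
      wsum (fun a => τ (ix true a)) (fun s => (finrank ℝ ↥(V ⊓ Fl (RR F k true) s) : ℝ)) := by
    intro τ k
    rw [← wsum_hs, ← wsum_hs, ← wsum_add]
    congr 1
    ext s
    unfold GG
    rw [finrank_prod2_Fl _ _ (RR_unit hF k)]
    push_cast
    rfl
  unfold deg
  rw [Fin.sum_univ_three, Fin.sum_univ_three, key, key, key]
  have h3 : 2 * wsum (sw σ δ 2) (fun s => (finrank ℝ ↥(V ⊓ Fl (F 2) s) : ℝ)) =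
      wsum (fun a => δ (ix false a)) (fun s => (finrank ℝ ↥(V ⊓ Fl (F 2) s) : ℝ)) +
      wsum (fun a => δ (ix true a)) (fun s => (finrank ℝ ↥(V ⊓ Fl (F 2) s) : ℝ)) := by
    unfold wsum
    rw [Finset.mul_sum, ← Finset.sum_add_distrib]
    refine Finset.sum_congr rfl fun a _ => ?_
    change 2 * ((δ (ix false a) + δ (ix true a)) / 2 * _) = _
    ring
  rw [mul_add, h3]
  change (wsum (fun a => σ (ix false a)) (fun s => (finrank ℝ ↥(V ⊓ Fl (F 0) s) : ℝ)) +
    wsum (fun a => σ (ix true a)) (fun s => (finrank ℝ ↥(V ⊓ Fl (F 1) s) : ℝ))) +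
    (wsum (fun a => σ (ix false a)) (fun s => (finrank ℝ ↥(V ⊓ Fl (F 0) s) : ℝ)) +
    wsum (fun a => σ (ix true a)) (fun s => (finrank ℝ ↥(V ⊓ Fl (F 1) s) : ℝ))) +
    _ = 2 * (wsum (fun a => σ (ix false a)) (fun s => (finrank ℝ ↥(V ⊓ Fl (F 0) s) : ℝ)) +
    wsum (fun a => σ (ix true a)) (fun s => (finrank ℝ ↥(V ⊓ Fl (F 1) s) : ℝ))) + _
  have : ∀ a c : ℝ, a + a + c = 2 * a + c := by intros; ring
  rw [this]
  rfl

theorem pres_GG {p : ℕ} {σ δ : Fin (2 * p) → ℝ} (hσ : Antitone σ) (hδ : Antitone δ)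
    {F : Fin 3 → Matrix (Fin p) (Fin p) ℝ}
    (hF : ∀ k, IsUnit (F k).det) {V : Submodule ℝ (Fin p → ℝ)}
    (hV : ∀ U, deg (sw σ δ) F U ≤ deg (sw σ δ) F V)
    (hV2 : ∀ U, deg (sw σ δ) F U = deg (sw σ δ) F V → finrank ℝ U ≤ finrank ℝ V)
    (φ : Matrix (Fin (2 * p)) (Fin (2 * p)) ℝ) (hφ : ∀ k, TF (GG F k) (prod2 fun _ => V) φ) :
    ∀ x ∈ prod2 (fun _ => V), φ *ᵥ x ∈ prod2 (fun _ => V) := by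
  let H : Bool → Fin 3 → ℕ → Submodule ℝ (Fin p → ℝ) := fun b k s =>
    Fl (RR F k (xor b (cc k))) (hs (xor b (cc k)) s)
  let β : Fin 3 → Fin (2 * p) → ℝ := ![σ, σ, fun i => sw σ δ 2 (hf i)]
  have hβ : ∀ k, Antitone (β k) := by
    intro k
    fin_cases k
    · exact hσ
    · exact hσ
    · intro i j hij
      refine sw_antitone hσ hδ 2 ?_
      simp only [hf, Fin.le_def] at hij ⊢
      omega
  have hd : ∀ b U, ∑ k, wsum (β k) (fun s => (finrank ℝ ↥(U ⊓ H b k s) : ℝ)) =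
      deg (sw σ δ) F U := by
    intro b U
    have key : ∀ k, wsum (β k) (fun s => (finrank ℝ ↥(U ⊓ H b k s) : ℝ)) =
      wsum (fun a => β k (ix (xor b (cc k)) a))
        (fun s => (finrank ℝ ↥(U ⊓ Fl (RR F k (xor b (cc k))) s) : ℝ)) := by
      intro k
      rw [← wsum_hs]
    unfold deg
    rw [Fin.sum_univ_three, Fin.sum_univ_three, key, key, key]
    have h2 : (fun a => β 2 (ix (xor b (cc 2)) a)) = sw σ δ 2 := by
      ext a
      change sw σ δ 2 (hf (ix _ a)) = _
      rw [hf_ix]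
    rw [h2]
    cases b
    · rfl
    · have : ∀ a b c d e : ℝ, a = d → b = e → a + b + c = e + d + c := by
        intro a b c d e h1 h2; rw [h1, h2]; ring
      refine this _ _ _ _ _ ?_ ?_
      · rfl
      · rfl
  have main : ∀ a b, ∀ x ∈ V, pr a (φ *ᵥ (inj b x)) ∈ V := by
    intro a b
    refine hom_vanish β hβ (H b) (H a) ?_ ?_ ?_ ?_ (deg (sw σ δ) F) (hd b) (hd a) V hV hV2
      ((pr a).comp (φ.mulVecLin.comp (inj b))) ?_
    · intro k; simp only [H, hs_zero, Fl_zero]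
    · intro k; simp only [H, hs_zero, Fl_zero]
    · intro k; simp only [H, hs_two]; exact Fl_top (RR_unit hF k _) le_rfl
    · intro k; simp only [H, hs_two]; exact Fl_top (RR_unit hF k _) le_rfl
    · intro k s x hx hxs
      have h1 : inj b x ∈ prod2 (fun _ => V) := by
        rw [mem_prod2]
        intro b'
        rw [pr_inj]
        split_ifs
        · exact hx
        · exact V.zero_mem
      have h2 : inj b x ∈ Fl (GG F k) s := by
        unfold GG
        rw [mem_Fl_inter _ _ (RR_unit hF k)]
        intro b'
        rw [pr_inj]
        split_ifs with h
        · have : b' = xor b (cc k) := by rw [← h]; simp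
          rw [this]
          exact hxs
        · exact Submodule.zero_mem _
      obtain ⟨w, hw, h, hh, hwh⟩ := Submodule.mem_sup.1 (hφ k s _ h1 h2)
      change pr a (φ *ᵥ (inj b x)) ∈ _
      rw [← hwh, map_add]
      refine Submodule.add_mem_sup (mem_prod2.1 hw a) ?_
      unfold GG at hh
      rw [mem_Fl_inter _ _ (RR_unit hF k)] at hh
      have := hh (xor a (cc k))
      simpa using this
  intro x hx
  rw [mem_prod2] at hx ⊢
  intro a
  have : x = inj false (pr false x) + inj true (pr true x) := by
    refine ext_pr fun b => ?_
    rw [map_add, pr_inj, pr_inj]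
    cases b <;> simp
  rw [this, mulVec_add, map_add]
  exact V.add_mem (main a _ _ (hx _)) (main a _ _ (hx _))

theorem step3 {p : ℕ} {σ δ : Fin (2 * p) → ℝ} (hσ : Antitone σ) (hδ : Antitone δ)
    {F : Fin 3 → Matrix (Fin p) (Fin p) ℝ}
    (hF : ∀ k, IsUnit (F k).det) (hExt : ∀ V, ExtVan F V)
    (hU : ∃ U, 0 < deg (sw σ δ) F U) :
    ∃ (G : Fin 3 → Matrix (Fin (2 * p)) (Fin (2 * p)) ℝ) (W : Submodule ℝ (Fin (2 * p) → ℝ)),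
      (∀ k, IsUnit (G k).det) ∧ ExtVan G W ∧ 0 < deg ![σ, σ, δ] G W := by
  obtain ⟨U, hU⟩ := hU
  obtain ⟨V, hV, hV2⟩ := exists_maximizer (sw σ δ) F
  have hG : ∀ k, IsUnit (GG F k).det := fun k => inter_unit _ _ (RR_unit hF k)
  refine ⟨GG F, prod2 fun _ => V, hG, ?_, ?_⟩
  · have b1 := fun k => bruhat (hF k) V
    choose g hg hgF I hI using b1
    have b2 := fun k => bruhat (hG k) (prod2 fun _ => V)
    choose g' hg' hgG J hJ using b2
    have c1 := count1 hg hgF hI (hExt V)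
    refine count2 hg' hgG hJ (pres_GG hσ hδ hF hV hV2) ?_
    have hb : ∀ b : Bool, IsUnit (if b then g 1 else g 0).det := by
      intro b; cases b
      · exact hg 0
      · exact hg 1
    have hb1 : ∀ (b : Bool) s, Fl (if b then g 1 else g 0) s = Fl (if b then F 1 else F 0) s := by
      intro b; cases b
      · exact hgF 0
      · exact hgF 1
    have hb2 : ∀ (b : Bool) y, (if b then g 1 else g 0) *ᵥ y ∈ V ↔
        ∀ j, j ∉ (if b then I 1 else I 0) → y j = 0 := by
      intro b; cases b
      · exact hI 0
      · exact hI 1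
    have d0 := cnt_inter (c := cc 0) (R := RR F 0) (RR_unit hF 0) (V := V)
      (g := fun b => if b then g 1 else g 0) (I := fun b => if b then I 1 else I 0)
      hb hb1 hb2 (hg' 0) (hgG 0) (hJ 0)
    have d1 := cnt_inter (c := cc 1) (R := RR F 1) (RR_unit hF 1) (V := V)
      (g := fun b => if b then g 1 else g 0) (I := fun b => if b then I 1 else I 0)
      hb hb1 hb2 (hg' 1) (hgG 1) (hJ 1)
    have d2 := cnt_inter (c := cc 2) (R := RR F 2) (RR_unit hF 2) (V := V)
      (g := fun _ => g 2) (I := fun _ => I 2)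
      (fun _ => hg 2) (fun _ => hgF 2) (fun _ => hI 2) (hg' 2) (hgG 2) (hJ 2)
    have e0 : (I 0).card = finrank ℝ V := d0.2.2 false
    have e1 : (J 0).card = 2 * finrank ℝ V := d0.2.1
    have f0 : cnt (J 0) = 2 * cnt (I 0) + 2 * cnt (I 1) := d0.1
    have f1 : cnt (J 1) = 2 * cnt (I 0) + 2 * cnt (I 1) := d1.1
    have f2 : cnt (J 2) = 2 * cnt (I 2) + 2 * cnt (I 2) := d2.1
    rw [Fin.sum_univ_three] at c1 ⊢
    rw [e0] at c1
    rw [e1, f0, f1, f2]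
    have : 2 * finrank ℝ V * (2 * p - 2 * finrank ℝ V) =
        4 * (finrank ℝ V * (p - finrank ℝ V)) := by
      rw [← Nat.mul_sub]; ring
    rw [this]
    omega
  · rw [deg_GG σ δ hF]
    have := hV U
    linarith

end HSR

namespace HSR
open Module Matrix

/-! ### Part G: openness -/

section
variable {n : ℕ}

/-- endomorphism algebra -/
abbrev EA (n : ℕ) := (Fin n → ℝ) →L[ℝ] (Fin n → ℝ)

/-- matrix to continuous linear map -/
noncomputable def cl : Matrix (Fin n) (Fin n) ℝ →ₗ[ℝ] EA n :=
  LinearMap.toContinuousLinearMap.toLinearMap.comp (Matrix.toLin').toLinearMap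

theorem cl_apply (M : Matrix (Fin n) (Fin n) ℝ) (x : Fin n → ℝ) : cl M x = M *ᵥ x := by
  simp [cl]

theorem cl_surj (a : EA n) : ∃ M, cl M = a := by
  refine ⟨LinearMap.toMatrix' a.toLinearMap, ?_⟩
  ext x : 1
  rw [cl_apply, LinearMap.toMatrix'_mulVec]
  rfl

/-- stabilizer -/
def stab {ι : Type*} (S : ι → Submodule ℝ (Fin n → ℝ)) : Submodule ℝ (EA n) where
  carrier := {a | ∀ i, ∀ x ∈ S i, a x ∈ S i}
  add_mem' ha hb i x hx := (S i).add_mem (ha i x hx) (hb i x hx)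
  zero_mem' i x hx := (S i).zero_mem
  smul_mem' c a ha i x hx := (S i).smul_mem c (ha i x hx)

theorem finrank_map_inj {X Y : Type*} [AddCommGroup X] [Module ℝ X] [AddCommGroup Y] [Module ℝ Y]
    (f : X →ₗ[ℝ] Y) (hf : Function.Injective f) (S : Submodule ℝ X) :
    finrank ℝ ↥(S.map f) = finrank ℝ S :=
  ((Submodule.equivMapOfInjective f hf S).finrank_eq).symm

theorem ift {A T : Type*} [NormedRing A] [NormedAlgebra ℝ A] [CompleteSpace A]
    [NormedAddCommGroup T] [NormedSpace ℝ T] [CompleteSpace T]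
    (p1 : T →L[ℝ] A) (p2 p3 : Fin 3 → T →L[ℝ] A) (g : Fin 3 → A)
    (hs : ∀ η : Fin 3 → A, ∃ t, ∀ k, (p1 t + p2 k t + p3 k t) * g k = η k) :
    ∀ᶠ m in nhds g, ∃ t, IsUnit (1 + p1 t) ∧ (∀ k, IsUnit (1 + p2 k t)) ∧
      (∀ k, IsUnit (1 + p3 k t)) ∧
      ∀ k, m k = (1 + p1 t) * (1 + p2 k t) * (1 + p3 k t) * g k := by
  let f : T → Fin 3 → A := fun t k => (1 + p1 t) * (1 + p2 k t) * (1 + p3 k t) * g k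
  have hd : ∀ k, ∃ f' : T →L[ℝ] A, HasStrictFDerivAt (fun t => f t k) f' 0 ∧
      ∀ t, f' t = (p1 t + p2 k t + p3 k t) * g k := by
    intro k
    have h1 : HasStrictFDerivAt (fun t : T => (1 : A) + p1 t) p1 0 :=
      (p1.hasStrictFDerivAt).const_add (1 : A)
    have h2 : HasStrictFDerivAt (fun t : T => (1 : A) + p2 k t) (p2 k) 0 :=
      ((p2 k).hasStrictFDerivAt).const_add (1 : A)
    have h3 : HasStrictFDerivAt (fun t : T => (1 : A) + p3 k t) (p3 k) 0 :=
      ((p3 k).hasStrictFDerivAt).const_add (1 : A)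
    refine ⟨_, ((h1.mul' h2).mul' h3).mul_const' (g k), fun t => ?_⟩
    simp
    rw [add_mul, add_mul]
    abel
  choose f' hf' hf'2 using hd
  have hstrict : HasStrictFDerivAt f (ContinuousLinearMap.pi f') 0 :=
    hasStrictFDerivAt_pi'.2 fun k => hf' k
  have hsurj : (ContinuousLinearMap.pi f').range = ⊤ := by
    rw [LinearMap.range_eq_top]
    intro η
    obtain ⟨t, ht⟩ := hs η
    refine ⟨t, ?_⟩
    ext k : 1
    exact (hf'2 k t).trans (ht k)
  have hmap := hstrict.map_nhds_eq_of_surj hsurj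
  have hf0 : f 0 = g := by
    ext k : 1
    simp [f]
  rw [hf0] at hmap
  have hu : ∀ q : T →L[ℝ] A, ∀ᶠ t : T in nhds 0, IsUnit (1 + q t) := by
    intro q
    have hc : ContinuousAt (fun t : T => 1 + q t) 0 := by fun_prop
    exact hc (Units.isOpen.mem_nhds (by simp))
  have hev := (hu p1).and ((Filter.eventually_all.2 fun k => hu (p2 k)).and
      (Filter.eventually_all.2 fun k => hu (p3 k)))
  have himg := Filter.image_mem_map (m := f) hev
  rw [hmap] at himg
  filter_upwards [himg]
  rintro m ⟨t, ⟨h1, h2, h3⟩, rfl⟩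
  exact ⟨t, h1, h2, h3, fun k => rfl⟩

theorem ift2 {A X : Type*} [NormedRing A] [NormedAlgebra ℝ A] [CompleteSpace A]
    [NormedAddCommGroup X] [NormedSpace ℝ X] [FiniteDimensional ℝ X] (S : Submodule ℝ X)
    (p1 : X →L[ℝ] A) (p2 p3 : Fin 3 → X →L[ℝ] A) (g : Fin 3 → A)
    (hs : ∀ η : Fin 3 → A, ∃ t ∈ S, ∀ k, (p1 t + p2 k t + p3 k t) * g k = η k) :
    ∀ᶠ m in nhds g, ∃ t ∈ S, IsUnit (1 + p1 t) ∧ (∀ k, IsUnit (1 + p2 k t)) ∧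
      (∀ k, IsUnit (1 + p3 k t)) ∧
      ∀ k, m k = (1 + p1 t) * (1 + p2 k t) * (1 + p3 k t) * g k := by
  have hT : CompleteSpace S := FiniteDimensional.complete ℝ S
  have h := ift (p1.comp S.subtypeL) (fun k => (p2 k).comp S.subtypeL)
    (fun k => (p3 k).comp S.subtypeL) g (by
      intro η
      obtain ⟨t, ht, h⟩ := hs η
      exact ⟨⟨t, ht⟩, h⟩)
  filter_upwards [h]
  rintro m ⟨t, h1, h2, h3, h4⟩
  exact ⟨t.1, t.2, h1, h2, h3, h4⟩

/-- ambient parameter space -/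
abbrev PT (n : ℕ) := EA n × (Fin 3 → EA n) × (Fin 3 → EA n)

/-- parameter subspace -/
def TT (G : Fin 3 → Matrix (Fin n) (Fin n) ℝ) (W : Submodule ℝ (Fin n → ℝ)) :
    Submodule ℝ (PT n) where
  carrier := {t | (∀ k, t.2.1 k ∈ stab (fun _ : Unit => W)) ∧
    ∀ k, t.2.2 k ∈ stab (fun s : ℕ => Fl (G k) s)}
  add_mem' ha hb := ⟨fun k => Submodule.add_mem _ (ha.1 k) (hb.1 k),
    fun k => Submodule.add_mem _ (ha.2 k) (hb.2 k)⟩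
  zero_mem' := ⟨fun k => Submodule.zero_mem _, fun k => Submodule.zero_mem _⟩
  smul_mem' c a ha := ⟨fun k => Submodule.smul_mem _ c (ha.1 k),
    fun k => Submodule.smul_mem _ c (ha.2 k)⟩

theorem open_aux {G : Fin 3 → Matrix (Fin n) (Fin n) ℝ} (hG : ∀ k, IsUnit (G k).det)
    {W : Submodule ℝ (Fin n → ℝ)} (hE : ExtVan G W) :
    ∀ᶠ m in nhds (fun k => cl (G k)), ∃ t ∈ TT G W, IsUnit (1 + t.1) ∧
      (∀ k, IsUnit (1 + t.2.1 k)) ∧ (∀ k, IsUnit (1 + t.2.2 k)) ∧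
      ∀ k, m k = (1 + t.1) * (1 + t.2.1 k) * (1 + t.2.2 k) * cl (G k) := by
  let p1 : PT n →L[ℝ] EA n := ContinuousLinearMap.fst ℝ _ _
  let p2 : Fin 3 → PT n →L[ℝ] EA n := fun k => (ContinuousLinearMap.proj k).comp
    ((ContinuousLinearMap.fst ℝ (Fin 3 → EA n) (Fin 3 → EA n)).comp
      (ContinuousLinearMap.snd ℝ (EA n) _))
  let p3 : Fin 3 → PT n →L[ℝ] EA n := fun k => (ContinuousLinearMap.proj k).comp
    ((ContinuousLinearMap.snd ℝ (Fin 3 → EA n) (Fin 3 → EA n)).comp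
      (ContinuousLinearMap.snd ℝ (EA n) _))
  exact ift2 (TT G W) p1 p2 p3 (fun k => cl (G k)) (by
      intro η
      choose E hE2 using fun k => cl_surj (η k)
      obtain ⟨φ, hφ⟩ := hE (fun k => E k * (G k)⁻¹)
      choose y z hyz hy hz using fun k => TF_split (hG k) (hφ k)
      refine ⟨(cl φ, fun k => cl (y k), fun k => cl (z k)), ?_, ?_⟩
      · exact ⟨fun k _ x hx => by rw [cl_apply]; exact hy k x hx,
          fun k s x hx => by rw [cl_apply]; exact hz k s x hx⟩
      intro k
      rw [← hE2]
      change (cl φ + cl (y k) + cl (z k)) * cl (G k) = cl (E k)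
      rw [add_assoc, ← map_add, ← map_add, ← hyz k, add_sub_cancel]
      ext x : 1
      change cl _ (cl _ x) = _
      rw [cl_apply, cl_apply, cl_apply, mulVec_mulVec, mul_assoc, Matrix.nonsing_inv_mul _ (hG k),
        mul_one])

theorem open_step {G : Fin 3 → Matrix (Fin n) (Fin n) ℝ} (hG : ∀ k, IsUnit (G k).det)
    {W : Submodule ℝ (Fin n → ℝ)} (hE : ExtVan G W) :
    ∃ ε > 0, ∀ M : Fin 3 → Matrix (Fin n) (Fin n) ℝ, (∀ k i j, |M k i j - G k i j| < ε) →
      ∃ W' : Submodule ℝ (Fin n → ℝ), finrank ℝ W' = finrank ℝ W ∧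
        ∀ k s, finrank ℝ ↥(W ⊓ Fl (G k) s) ≤ finrank ℝ ↥(W' ⊓ Fl (M k) s) := by
  have hcont : Continuous (fun M : Fin 3 → Fin n → Fin n → ℝ => fun k => cl (Matrix.of (M k))) := by
    refine continuous_pi fun k => ?_
    let l : (Fin n → Fin n → ℝ) →ₗ[ℝ] EA n :=
      { toFun := fun M => cl (Matrix.of M)
        map_add' := fun a b => map_add cl (Matrix.of a) (Matrix.of b)
        map_smul' := fun c a => map_smul cl c (Matrix.of a) }
    exact (LinearMap.continuous_of_finiteDimensional l).comp (continuous_apply k)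
  have hpre := hcont.continuousAt.preimage_mem_nhds
    (x := fun k => Matrix.of.symm (G k)) (open_aux hG hE)
  obtain ⟨ε, hε, hball⟩ := Metric.mem_nhds_iff.1 hpre
  refine ⟨ε, hε, fun M hM => ?_⟩
  have hmem : (fun k => Matrix.of.symm (M k)) ∈ Metric.ball (fun k => Matrix.of.symm (G k)) ε := by
    rw [Metric.mem_ball, dist_pi_lt_iff hε]
    intro k
    rw [dist_pi_lt_iff hε]
    intro i
    rw [dist_pi_lt_iff hε]
    intro j
    exact hM k i j
  obtain ⟨t, ht2, hx, hy, hz, ht⟩ := hball hmem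
  have ht' : ∀ k, cl (M k) = (1 + t.1) * (1 + (t.2.1 k : EA n)) * (1 + (t.2.2 k : EA n)) * cl (G k) :=
    ht
  have hinj : ∀ a : EA n, IsUnit a → Function.Injective a.toLinearMap := by
    rintro _ ⟨u, rfl⟩ x y hxy
    have := congrArg (u⁻¹).1 hxy
    change ((u⁻¹).1 * u.1) x = ((u⁻¹).1 * u.1) y at this
    simpa using this
  refine ⟨W.map (1 + t.1).toLinearMap, finrank_map_inj _ (hinj _ hx) W, fun k s => ?_⟩
  have hxy := hx.mul (hy k)
  rw [← finrank_map_inj _ (hinj _ hxy) (W ⊓ Fl (G k) s)]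
  apply Submodule.finrank_mono
  rintro _ ⟨x, ⟨hxW, hxF⟩, rfl⟩
  refine ⟨⟨(1 + (t.2.1 k : EA n)) x, ?_, rfl⟩, ?_⟩
  · exact W.add_mem hxW (ht2.1 k () x hxW)
  · have hsub : (Fl (G k) s).map (1 + (t.2.2 k : EA n)).toLinearMap = Fl (G k) s := by
      apply Submodule.eq_of_le_of_finrank_eq
      · rintro _ ⟨v, hv, rfl⟩
        exact Submodule.add_mem _ hv (ht2.2 k s v hv)
      · exact finrank_map_inj _ (hinj _ (hz k)) _
    rw [← hsub] at hxF
    obtain ⟨v, hv, rfl⟩ := hxF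
    obtain ⟨u, hu, rfl⟩ := mem_Fl.1 hv
    refine mem_Fl.2 ⟨u, hu, ?_⟩
    rw [← cl_apply, ht' k]
    change (1 + t.1) ((1 + (t.2.1 k : EA n)) ((1 + (t.2.2 k : EA n)) (cl (G k) u))) = _
    rw [cl_apply]
    rfl

end
end HSR

namespace HSR
open Module Matrix

/-! ### Part H: transfer along a field homomorphism -/

section
variable {n : ℕ}

/-- apply a ring hom entrywise -/
def tv (τ : ℝ →+* ℂ) (x : Fin n → ℝ) : Fin n → ℂ := fun i => τ (x i)

theorem tv_mulVec (τ : ℝ →+* ℂ) (M : Matrix (Fin n) (Fin n) ℝ) (y : Fin n → ℝ) :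
    tv τ (M *ᵥ y) = (M.map τ) *ᵥ (tv τ y) := by
  ext i
  simp [tv, mulVec, dotProduct]

theorem finrank_tv (τ : ℝ →+* ℂ) (S : Submodule ℝ (Fin n → ℝ)) :
    finrank ℂ ↥(Submodule.span ℂ (tv τ '' (S : Set (Fin n → ℝ)))) = finrank ℝ S := by
  let b := Module.finBasis ℝ S
  set d := finrank ℝ S with hd
  let f : (Fin d → ℝ) →ₗ[ℝ] (Fin n → ℝ) := S.subtype ∘ₗ b.equivFun.symm.toLinearMap
  have hf : LinearMap.ker f = ⊥ := by
    rw [LinearMap.ker_eq_bot]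
    exact S.injective_subtype.comp b.equivFun.symm.injective
  obtain ⟨g, hg⟩ := f.exists_leftInverse_of_injective hf
  have hm : LinearMap.toMatrix' g * LinearMap.toMatrix' f = 1 := by
    rw [← LinearMap.toMatrix'_comp, hg, LinearMap.toMatrix'_id]
  have hm2 : (LinearMap.toMatrix' g).map τ * (LinearMap.toMatrix' f).map τ = 1 := by
    rw [← Matrix.map_mul, hm, Matrix.map_one _ (map_zero τ) (map_one τ)]
  have hli : LinearIndependent ℂ ((LinearMap.toMatrix' f).map τ).col := by
    rw [← Matrix.mulVec_injective_iff]
    intro x y hxy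
    have := congrArg (fun v => (LinearMap.toMatrix' g).map τ *ᵥ v) hxy
    simpa [mulVec_mulVec, hm2] using this
  have hsp : Submodule.span ℂ (tv τ '' (S : Set (Fin n → ℝ))) =
      Submodule.span ℂ (Set.range ((LinearMap.toMatrix' f).map τ).col) := by
    apply le_antisymm
    · rw [Submodule.span_le]
      rintro _ ⟨x, hx, rfl⟩
      have hx2 : f (b.equivFun ⟨x, hx⟩) = x := by simp [f]
      have : tv τ x = ∑ j, τ (b.equivFun ⟨x, hx⟩ j) • ((LinearMap.toMatrix' f).map τ).col j := by
        conv_lhs => rw [← hx2]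
        rw [← LinearMap.toMatrix'_mulVec f]
        ext i
        simp [tv, mulVec, dotProduct, Matrix.col, mul_comm]
      rw [this]
      exact Submodule.sum_mem _ fun j _ => Submodule.smul_mem _ _
        (Submodule.subset_span ⟨j, rfl⟩)
    · rw [Submodule.span_le]
      rintro _ ⟨j, rfl⟩
      refine Submodule.subset_span ⟨f (Pi.single j 1), ?_, ?_⟩
      · exact (b.equivFun.symm (Pi.single j 1)).2
      · ext i
        simp [tv, LinearMap.toMatrix'_apply, Matrix.col, ← Pi.single_apply]
  rw [hsp, finrank_span_eq_card hli, Fintype.card_fin]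

theorem transfer {G : Fin 3 → Matrix (Fin n) (Fin n) ℝ} (hG : ∀ k, IsUnit (G k).det)
    {W : Submodule ℝ (Fin n → ℝ)} (hExt : ExtVan G W) (E : Fin 3 → Matrix (Fin n) (Fin n) ℝ)
    (ε : ℝ) (hε : 0 < ε) :
    ∃ M : Fin 3 → Matrix (Fin n) (Fin n) ℝ, (∀ k i j, |M k i j - E k i j| < ε) ∧
      ∃ W' : Submodule ℂ (Fin n → ℂ), finrank ℂ W' = finrank ℝ W ∧
        ∀ k s, finrank ℝ ↥(W ⊓ Fl (G k) s) ≤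
          finrank ℂ ↥(W' ⊓ Fl ((M k).map (algebraMap ℝ ℂ)) s) := by
  obtain ⟨δ, hδ, hop⟩ := open_step hG hExt
  obtain ⟨x, hx⟩ := exists_algInd (Fin 3 × Fin n × Fin n)
  obtain ⟨C, hC0, hC⟩ : ∃ C : ℝ, 0 < C ∧ ∀ q, |x q| ≤ C := by
    refine ⟨1 + ∑ q, |x q|, by positivity, fun q => ?_⟩
    have := Finset.single_le_sum (f := fun q => |x q|) (fun _ _ => abs_nonneg _) (Finset.mem_univ q)
    linarith
  obtain ⟨e, he0, he⟩ := exists_rat_btwn (show (0:ℝ) < min δ ε / (2 * C) by positivity)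
  have he0' : (0:ℝ) < e := he0
  have heC : (e : ℝ) * C < min δ ε / 2 := by
    rw [lt_div_iff₀ (by positivity)] at he
    linarith
  have hex : ∀ q, |(e : ℝ) * x q| < min δ ε / 2 := fun q => by
    rw [abs_mul, abs_of_pos he0']
    exact lt_of_le_of_lt (mul_le_mul_of_nonneg_left (hC q) he0'.le) heC
  have hrat : ∀ a : ℝ, ∃ q : ℚ, |(q : ℝ) - a| < min δ ε / 2 := fun a => by
    obtain ⟨q, hq1, hq2⟩ := exists_rat_btwn (show a < a + min δ ε / 2 by
      have : 0 < min δ ε := lt_min hδ hε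
      linarith)
    exact ⟨q, by rw [abs_lt]; constructor <;> linarith⟩
  choose q hq using fun r : Fin 3 × Fin n × Fin n => hrat (G r.1 r.2.1 r.2.2)
  choose q' hq' using fun r : Fin 3 × Fin n × Fin n => hrat (E r.1 r.2.1 r.2.2)
  obtain ⟨τ, hτ⟩ := exists_hom hx (fun r => (q' r - q r) / e)
  let MG : Fin 3 → Matrix (Fin n) (Fin n) ℝ := fun k => Matrix.of fun i j =>
    (q (k, i, j) : ℝ) + e * x (k, i, j)
  let ME : Fin 3 → Matrix (Fin n) (Fin n) ℝ := fun k => Matrix.of fun i j =>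
    (q' (k, i, j) : ℝ) + e * x (k, i, j)
  have hmap : ∀ k, (MG k).map τ = (ME k).map (algebraMap ℝ ℂ) := by
    intro k
    ext i j
    have : (e : ℂ) ≠ 0 := by exact_mod_cast he0'.ne'
    simp only [MG, ME, Matrix.map_apply, Matrix.of_apply, map_add, map_mul, map_ratCast, hτ]
    push_cast
    simp only [Complex.coe_algebraMap, mul_add]
    field_simp
    ring
  obtain ⟨W1, hW1, hW2⟩ := hop MG (by
    intro k i j
    have h1 := hq (k, i, j)
    have h2 := hex (k, i, j)
    have h3 := min_le_left δ ε
    simp only [MG, Matrix.of_apply]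
    rw [abs_lt] at *
    constructor <;> linarith [h1.1, h1.2, h2.1, h2.2])
  refine ⟨ME, ?_, Submodule.span ℂ (tv τ '' (W1 : Set (Fin n → ℝ))), ?_, fun k s => ?_⟩
  · intro k i j
    have h1 := hq' (k, i, j)
    have h2 := hex (k, i, j)
    have h3 := min_le_right δ ε
    simp only [ME, Matrix.of_apply]
    rw [abs_lt] at *
    constructor <;> linarith [h1.1, h1.2, h2.1, h2.2]
  · rw [finrank_tv, hW1]
  · refine (hW2 k s).trans ?_
    rw [← finrank_tv τ]
    apply Submodule.finrank_mono
    rw [Submodule.span_le]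
    rintro _ ⟨v, ⟨hv1, hv2⟩, rfl⟩
    refine ⟨Submodule.subset_span ⟨v, hv1, rfl⟩, ?_⟩
    obtain ⟨y, hy, rfl⟩ := mem_Fl.1 hv2
    refine mem_Fl.2 ⟨tv τ y, fun j hj => ?_, ?_⟩
    · simp [tv, hy j hj]
    · rw [tv_mulVec, hmap]

end
end HSR

namespace HSR
open Module Matrix

/-! ### Part I: trace inequality -/

section bes
variable {𝕜 H : Type*} [RCLike 𝕜] [NormedAddCommGroup H] [InnerProductSpace 𝕜 H]
  [FiniteDimensional 𝕜 H]

theorem bessel_sub {ι : Type*} [Fintype ι] {w : ι → H} (hw : Orthonormal 𝕜 w)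
    {U : Submodule 𝕜 H} (hU : U ≤ Submodule.span 𝕜 (Set.range w)) {κ : Type*} (S : Finset κ)
    (q : κ → H) (c : ℝ) (hc : ∀ u ∈ U, ‖u‖ = 1 → c ≤ ∑ j ∈ S, ‖inner 𝕜 (q j) u‖ ^ 2) :
    (finrank 𝕜 U : ℝ) * c ≤ ∑ j ∈ S, ∑ i, ‖inner 𝕜 (w i) (q j)‖ ^ 2 := by
  let u := stdOrthonormalBasis 𝕜 U
  have hu : Orthonormal 𝕜 (fun l => (u l : H)) := u.orthonormal.comp_linearIsometry U.subtypeₗᵢ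
  have h1 : ∀ j ∈ S, ∑ l, ‖inner 𝕜 (u l : H) (q j)‖ ^ 2 ≤ ∑ i, ‖inner 𝕜 (w i) (q j)‖ ^ 2 := by
    intro j _
    let P := ∑ i, (inner 𝕜 (w i) (q j)) • w i
    have hP : ∀ v ∈ Submodule.span 𝕜 (Set.range w), inner 𝕜 v (q j) = inner 𝕜 v P := by
      intro v hv
      induction hv using Submodule.span_induction with
      | mem x hx =>
        obtain ⟨i, rfl⟩ := hx
        rw [hw.inner_right_fintype]
      | zero => simp
      | add x y _ _ hx hy => rw [inner_add_left, inner_add_left, hx, hy]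
      | smul a x _ hx => rw [inner_smul_left, inner_smul_left, hx]
    have hPn : ‖P‖ ^ 2 = ∑ i, ‖inner 𝕜 (w i) (q j)‖ ^ 2 := by
      have h2 : (inner 𝕜 P P : 𝕜) = ∑ i, (starRingEnd 𝕜) (inner 𝕜 (w i) (q j)) * (inner 𝕜 (w i) (q j)) := by
        exact hw.inner_sum _ _ _
      have h3 : ((‖P‖ ^ 2 : ℝ) : 𝕜) = ((∑ i, ‖inner 𝕜 (w i) (q j)‖ ^ 2 : ℝ) : 𝕜) := by
        have := inner_self_eq_norm_sq_to_K (𝕜 := 𝕜) P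
        push_cast
        rw [← this, h2]
        refine Finset.sum_congr rfl fun i _ => ?_
        rw [RCLike.conj_mul]
      exact_mod_cast h3
    rw [← hPn]
    have := hu.sum_inner_products_le P (s := Finset.univ)
    refine le_trans (le_of_eq ?_) this
    refine Finset.sum_congr rfl fun l _ => ?_
    rw [hP _ (hU (u l).2)]
  refine le_trans ?_ (Finset.sum_le_sum h1)
  rw [Finset.sum_comm]
  have h2 : ∀ l ∈ Finset.univ, c ≤ ∑ j ∈ S, ‖inner 𝕜 (u l : H) (q j)‖ ^ 2 := by
    intro l _
    refine (hc _ (u l).2 (hu.1 l)).trans (le_of_eq ?_)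
    refine Finset.sum_congr rfl fun j _ => ?_
    rw [norm_inner_symm]
  have := Finset.card_nsmul_le_sum _ _ _ h2
  simpa using this

end bes

section
variable {n : ℕ}

/-- complexified columns -/
noncomputable def qc (E : Matrix (Fin n) (Fin n) ℝ) (j : Fin n) : EuclideanSpace ℂ (Fin n) :=
  WithLp.toLp 2 fun i => (E i j : ℂ)

theorem qc_inner (E : Matrix (Fin n) (Fin n) ℝ) (j : Fin n) (v : EuclideanSpace ℂ (Fin n)) :
    inner ℂ (qc E j) v = ∑ i, (E i j : ℂ) * v i := by
  simp [qc, PiLp.inner_apply, mul_comm]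

theorem qc_orth {E : Matrix (Fin n) (Fin n) ℝ} (hE : Eᵀ * E = 1) : Orthonormal ℂ (qc E) := by
  rw [orthonormal_iff_ite]
  intro i j
  have h := congrFun (congrFun hE i) j
  rw [Matrix.mul_apply, Matrix.one_apply] at h
  rw [qc_inner]
  simp only [transpose_apply] at h
  simp only [qc]
  have h2 := congrArg (fun x : ℝ => (x : ℂ)) h
  push_cast at h2
  rw [h2]
  split_ifs <;> simp

/-- orthonormal basis of columns -/
noncomputable def qb {E : Matrix (Fin n) (Fin n) ℝ} (hE : Eᵀ * E = 1) :
    OrthonormalBasis (Fin n) ℂ (EuclideanSpace ℂ (Fin n)) :=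
  OrthonormalBasis.mk (qc_orth hE) (by
    have := (qc_orth hE).linearIndependent.span_eq_top_of_card_eq_finrank' (by simp)
    rw [this])

theorem qb_apply {E : Matrix (Fin n) (Fin n) ℝ} (hE : Eᵀ * E = 1) (j : Fin n) :
    qb hE j = qc E j := by simp [qb]

theorem parseval {E : Matrix (Fin n) (Fin n) ℝ} (hE : Eᵀ * E = 1) (u : EuclideanSpace ℂ (Fin n)) :
    ∑ j, ‖inner ℂ (qc E j) u‖ ^ 2 = ‖u‖ ^ 2 := by
  rw [← (qb hE).sum_sq_norm_inner_right u]
  simp [qb_apply]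

theorem parseval' {E : Matrix (Fin n) (Fin n) ℝ} (hE : Eᵀ * E = 1) (u : EuclideanSpace ℂ (Fin n)) :
    ∑ j, ‖inner ℂ u (qc E j)‖ ^ 2 = ‖u‖ ^ 2 := by
  rw [← parseval hE]
  simp [norm_inner_symm]

theorem small_mul {N : Matrix (Fin n) (Fin n) ℝ} {ε : ℝ} (hε : 0 ≤ ε) (hN : ∀ i j, |N i j| ≤ ε)
    (y : EuclideanSpace ℂ (Fin n)) :
    ‖WithLp.toLp 2 (fun i => ∑ j, (N i j : ℂ) * y j)‖ ≤ ε * n ^ 2 * ‖y‖ := by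
  have h1 : ∀ i, ‖∑ j, (N i j : ℂ) * y j‖ ≤ ε * n * ‖y‖ := by
    intro i
    refine (norm_sum_le _ _).trans ?_
    have : ∀ j ∈ Finset.univ, ‖(N i j : ℂ) * y j‖ ≤ ε * ‖y‖ := by
      intro j _
      rw [norm_mul, Complex.norm_real]
      exact mul_le_mul (hN i j) (PiLp.norm_apply_le y j) (norm_nonneg _) hε
    refine (Finset.sum_le_card_nsmul _ _ _ this).trans (le_of_eq ?_)
    simp
    ring
  have h0 : 0 ≤ ε * n * ‖y‖ := by positivity
  have h2 : ‖WithLp.toLp 2 (fun i => ∑ j, (N i j : ℂ) * y j)‖ ^ 2 ≤ (ε * n ^ 2 * ‖y‖) ^ 2 := by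
    rw [EuclideanSpace.norm_sq_eq]
    have : ∀ i ∈ Finset.univ, ‖∑ j, (N i j : ℂ) * y j‖ ^ 2 ≤ (ε * n * ‖y‖) ^ 2 := fun i _ =>
      pow_le_pow_left₀ (norm_nonneg _) (h1 i) 2
    refine (Finset.sum_le_card_nsmul _ _ _ this).trans ?_
    simp only [Finset.card_univ, Fintype.card_fin, nsmul_eq_mul]
    have hn : (n : ℝ) ≤ n ^ 2 := by
      exact_mod_cast Nat.le_self_pow (by norm_num) n
    have : (ε * n ^ 2 * ‖y‖) ^ 2 = (n : ℝ) ^ 2 * (ε * n * ‖y‖) ^ 2 := by ring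
    rw [this]
    exact mul_le_mul_of_nonneg_right hn (sq_nonneg _)
  exact (pow_le_pow_iff_left₀ (norm_nonneg _) (by positivity) (by norm_num)).1 h2

theorem near {E M : Matrix (Fin n) (Fin n) ℝ} (hE : Eᵀ * E = 1) {ε : ℝ} (hε : 0 ≤ ε)
    (hM : ∀ i j, |M i j - E i j| ≤ ε) (hε2 : ε * n ^ 2 ≤ 1 / 2) (s : ℕ)
    (u : EuclideanSpace ℂ (Fin n)) (hu : ‖u‖ = 1)
    (huF : WithLp.ofLp u ∈ Fl (M.map (algebraMap ℝ ℂ)) s) :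
    1 - 4 * (ε * n ^ 2) ^ 2 ≤ ∑ j with j.1 < s, ‖inner ℂ (qc E j) u‖ ^ 2 := by
  obtain ⟨y0, hy0, hyu⟩ := mem_Fl.1 huF
  let y : EuclideanSpace ℂ (Fin n) := WithLp.toLp 2 y0
  let r : EuclideanSpace ℂ (Fin n) :=
    WithLp.toLp 2 (fun i => ∑ j, (((M - E) i j : ℝ) : ℂ) * y j)
  let v : EuclideanSpace ℂ (Fin n) := WithLp.toLp 2 (fun i => ∑ j, ((E i j : ℝ) : ℂ) * y j)
  have huv : u = v + r := by
    ext i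
    rw [← hyu]
    simp [v, r, y, mulVec, dotProduct, ← Finset.sum_add_distrib]
    refine Finset.sum_congr rfl fun j _ => ?_
    ring
  have hv : v = ∑ j, y j • qc E j := by
    ext i
    simp [v, qc, mul_comm]
  have hvin : ∀ j, inner ℂ (qc E j) v = y j := by
    intro j
    rw [hv, (qc_orth hE).inner_right_fintype]
  have hvn : ‖v‖ = ‖y‖ := by
    have h1 := parseval hE v
    simp only [hvin] at h1
    rw [← EuclideanSpace.norm_sq_eq] at h1
    exact ((pow_left_inj₀ (norm_nonneg _) (norm_nonneg _) two_ne_zero).1 h1).symm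
  have hr : ‖r‖ ≤ ε * n ^ 2 * ‖y‖ := small_mul hε (fun i j => hM i j) y
  have hy2 : ‖y‖ ≤ 2 := by
    have h1 : v = u - r := by rw [huv]; simp
    have h2 : ‖v‖ ≤ ‖u‖ + ‖r‖ := by rw [h1]; exact norm_sub_le _ _
    rw [hvn, hu] at h2
    nlinarith [norm_nonneg y]
  have hr2 : ‖r‖ ^ 2 ≤ 4 * (ε * n ^ 2) ^ 2 := by
    have h1 : ‖r‖ ≤ ε * n ^ 2 * 2 := hr.trans (by gcongr)
    calc ‖r‖ ^ 2 ≤ (ε * n ^ 2 * 2) ^ 2 := pow_le_pow_left₀ (norm_nonneg _) h1 2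
      _ = _ := by ring
  have hp := parseval hE u
  rw [hu, ← Finset.sum_filter_add_sum_filter_not Finset.univ (fun j : Fin n => j.1 < s)] at hp
  have hrest : ∑ j with ¬ (j.1 < s), ‖inner ℂ (qc E j) u‖ ^ 2 ≤ ‖r‖ ^ 2 := by
    rw [← parseval hE r]
    have : ∑ j with ¬ (j.1 < s), ‖inner ℂ (qc E j) u‖ ^ 2 =
        ∑ j with ¬ (j.1 < s), ‖inner ℂ (qc E j) r‖ ^ 2 := by
      refine Finset.sum_congr rfl fun j hj => ?_
      have hj2 : s ≤ j.1 := by simpa using hj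
      rw [huv, inner_add_right, hvin]
      have : y j = 0 := hy0 j hj2
      rw [this, zero_add]
    rw [this]
    exact Finset.sum_le_sum_of_subset_of_nonneg (Finset.filter_subset _ _)
      fun _ _ _ => by positivity
  linarith

theorem trace_zero {α : Fin 3 → Fin n → ℝ} {E : Fin 3 → Matrix (Fin n) (Fin n) ℝ}
    (hsum : ∑ k, E k * diagonal (α k) * (E k)ᵀ = 0) (w : EuclideanSpace ℂ (Fin n)) :
    ∑ k, ∑ j, α k j * ‖inner ℂ w (qc (E k) j)‖ ^ 2 = 0 := by
  have h : ∀ a b, ∑ k, ∑ j, E k a j * α k j * E k b j = 0 := by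
    intro a b
    have := congrFun (congrFun hsum a) b
    rw [Matrix.sum_apply] at this
    refine Eq.trans (Finset.sum_congr rfl fun k _ => ?_) this
    rw [Matrix.mul_apply]
    refine Finset.sum_congr rfl fun j _ => ?_
    rw [Matrix.mul_diagonal, transpose_apply]
  have h2 : ∀ k j, ((α k j * ‖inner ℂ w (qc (E k) j)‖ ^ 2 : ℝ) : ℂ) =
      ∑ a, ∑ b, ((E k a j * α k j * E k b j : ℝ) : ℂ) * (w a * star (w b)) := by
    intro k j
    rw [norm_inner_symm]
    push_cast
    rw [← Complex.mul_conj', qc_inner, map_sum, Finset.sum_mul_sum, Finset.mul_sum]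
    refine Finset.sum_congr rfl fun a _ => ?_
    rw [Finset.mul_sum]
    refine Finset.sum_congr rfl fun b _ => ?_
    simp
    ring
  have h3 : ((∑ k, ∑ j, α k j * ‖inner ℂ w (qc (E k) j)‖ ^ 2 : ℝ) : ℂ) = 0 := by
    rw [Complex.ofReal_sum]
    simp_rw [Complex.ofReal_sum, h2]
    calc _ = ∑ a, ∑ b, ((∑ k, ∑ j, E k a j * α k j * E k b j : ℝ) : ℂ) * (w a * star (w b)) := by
          push_cast
          simp_rw [Finset.sum_mul]
          rw [show (∑ a, ∑ b, ∑ k, ∑ j, (E k a j : ℂ) * α k j * E k b j * (w a * star (w b))) =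
            ∑ k, ∑ j, ∑ a, ∑ b, (E k a j : ℂ) * α k j * E k b j * (w a * star (w b)) from ?_]
          simp_rw [Finset.sum_comm (s := (Finset.univ : Finset (Fin n))) (t := (Finset.univ : Finset (Fin 3)))]
          refine Finset.sum_congr rfl fun k _ => ?_
          calc _ = ∑ a, ∑ j, ∑ b, (E k a j : ℂ) * α k j * E k b j * (w a * star (w b)) :=
                Finset.sum_congr rfl fun a _ => Finset.sum_comm
            _ = _ := Finset.sum_comm
      _ = 0 := by simp [h]
  exact_mod_cast h3

theorem trace_contra {α : Fin 3 → Fin n → ℝ} (hα : ∀ k, Antitone (α k))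
    {E : Fin 3 → Matrix (Fin n) (Fin n) ℝ} (hE : ∀ k, (E k)ᵀ * E k = 1)
    (hsum : ∑ k, E k * diagonal (α k) * (E k)ᵀ = 0) (w : Fin 3 → ℕ → ℕ) (d : ℕ)
    (hw0 : ∀ k, w k 0 = 0) (hwn : ∀ k s, n ≤ s → w k s = d)
    (H : ∀ ε > 0, ∃ M : Fin 3 → Matrix (Fin n) (Fin n) ℝ, (∀ k i j, |M k i j - E k i j| < ε) ∧
      ∃ W' : Submodule ℂ (Fin n → ℂ), finrank ℂ W' = d ∧
        ∀ k s, w k s ≤ finrank ℂ ↥(W' ⊓ Fl ((M k).map (algebraMap ℝ ℂ)) s)) :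
    ∑ k, wsum (α k) (fun s => (w k s : ℝ)) ≤ 0 := by
  by_contra! hD
  set D := ∑ k, wsum (α k) (fun s => (w k s : ℝ)) with hDdef
  let g : Fin 3 → ℕ → ℝ := fun k s => if s < n then (w k s : ℝ) else 0
  set C := ∑ k, wsum (α k) (g k) with hC
  obtain ⟨ε, hε, hεn, hεD⟩ : ∃ ε : ℝ, 0 < ε ∧ ε * n ^ 2 ≤ 1 / 2 ∧
      4 * (ε * n ^ 2) ^ 2 * C < D := by
    have h1 : Filter.Tendsto (fun ε : ℝ => ε * n ^ 2) (nhdsWithin 0 (Set.Ioi 0)) (nhds 0) := by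
      have : Continuous (fun ε : ℝ => ε * (n:ℝ) ^ 2) := by fun_prop
      have := this.tendsto 0
      simp only [zero_mul] at this
      exact this.mono_left nhdsWithin_le_nhds
    have h2 : Filter.Tendsto (fun ε : ℝ => 4 * (ε * n ^ 2) ^ 2 * C) (nhdsWithin 0 (Set.Ioi 0))
        (nhds 0) := by
      have : Continuous (fun ε : ℝ => 4 * (ε * (n:ℝ) ^ 2) ^ 2 * C) := by fun_prop
      have := this.tendsto 0
      simp only [zero_mul, ne_eq, OfNat.ofNat_ne_zero, not_false_eq_true, zero_pow, mul_zero] at this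
      exact this.mono_left nhdsWithin_le_nhds
    have h3 := (h1.eventually_lt_const (show (0:ℝ) < 1/2 by norm_num)).and
      ((h2.eventually_lt_const hD).and self_mem_nhdsWithin)
    obtain ⟨ε, a, b, c⟩ := h3.exists
    exact ⟨ε, c, a.le, b⟩
  obtain ⟨M, hM, W, hWd, hW⟩ := H ε hε
  set θ := 4 * (ε * (n:ℝ) ^ 2) ^ 2 with hθ
  have hθ0 : 0 ≤ θ := by positivity
  let L := WithLp.linearEquiv 2 ℂ (Fin n → ℂ)
  let lift : Submodule ℂ (Fin n → ℂ) → Submodule ℂ (EuclideanSpace ℂ (Fin n)) :=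
    fun S => S.map L.symm.toLinearMap
  have hlift : ∀ S, finrank ℂ (lift S) = finrank ℂ S := fun S => LinearEquiv.finrank_map_eq L.symm S
  let b := stdOrthonormalBasis ℂ (lift W)
  let bw : Fin (finrank ℂ (lift W)) → EuclideanSpace ℂ (Fin n) := fun i => b i
  have hbw : Orthonormal ℂ bw := b.orthonormal.comp_linearIsometry (lift W).subtypeₗᵢ
  have hspan : lift W ≤ Submodule.span ℂ (Set.range bw) := by
    intro x hx
    have h1 := b.sum_repr ⟨x, hx⟩
    have h2 : x = ∑ i, (b.repr ⟨x, hx⟩ i) • bw i := by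
      have := congrArg Subtype.val h1
      refine Eq.trans this.symm ?_
      simp [bw]
    rw [h2]
    exact Submodule.sum_mem _ fun i _ => Submodule.smul_mem _ _ (Submodule.subset_span ⟨i, rfl⟩)
  let e : Fin 3 → ℕ → ℝ := fun k s => ∑ j with j.1 < s, ∑ i, ‖inner ℂ (bw i) (qc (E k) j)‖ ^ 2
  have he0 : ∀ k, e k 0 = 0 := by intro k; simp [e]
  have hen : ∀ k s, n ≤ s → e k s = d := by
    intro k s hs
    have : (Finset.univ.filter fun j : Fin n => j.1 < s) = Finset.univ := by
      ext j
      simp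
      omega
    simp only [e, this]
    rw [Finset.sum_comm]
    simp_rw [parseval' (hE k), hbw.1]
    simp [hlift, hWd]
  have hle : ∀ k s, (w k s : ℝ) * (1 - θ) ≤ e k s := by
    intro k s
    have h1 := bessel_sub hbw (U := lift (W ⊓ Fl ((M k).map (algebraMap ℝ ℂ)) s))
      ((Submodule.map_mono inf_le_left).trans hspan) (Finset.univ.filter fun j : Fin n => j.1 < s)
      (qc (E k)) (1 - θ) (by
        rintro _ ⟨x, hx, rfl⟩ hu
        exact near (hE k) hε.le (fun i j => (hM k i j).le) hεn s _ hu hx.2)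
    refine le_trans ?_ h1
    have h2 : 0 ≤ 1 - θ := by
      have : (ε * (n:ℝ)^2)^2 ≤ (1/2)^2 := pow_le_pow_left₀ (by positivity) hεn 2
      rw [hθ]; linarith
    rw [hlift]
    have := hW k s
    gcongr
  have hstep : ∀ k, wsum (α k) (fun s => (w k s : ℝ)) - θ * wsum (α k) (g k) ≤
      wsum (α k) (e k) := by
    intro k
    have h1 := abel_le (α k) (hα k) (e k) (fun s => (w k s : ℝ) - θ * g k s)
      (by
        rw [he0]
        simp only [g, hw0]
        simp)
      (by
        rw [hen k n le_rfl]
        simp [g, hwn k n le_rfl])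
      (by
        intro s
        by_cases hs : s < n
        · simp only [g, hs, if_true]
          linarith [hle k s]
        · rw [hen k s (not_lt.1 hs)]
          simp [g, hs, hwn k s (not_lt.1 hs)])
    refine le_trans (le_of_eq ?_) h1
    simp only [wsum]
    rw [Finset.mul_sum, ← Finset.sum_sub_distrib]
    refine Finset.sum_congr rfl fun i _ => ?_
    ring
  have hzero : ∑ k, wsum (α k) (e k) = 0 := by
    have h1 : ∀ k (j : Fin n), e k (j.1 + 1) - e k j.1 =
        ∑ i, ‖inner ℂ (bw i) (qc (E k) j)‖ ^ 2 := by
      intro k j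
      have : (Finset.univ.filter fun l : Fin n => l.1 < j.1 + 1) =
          insert j (Finset.univ.filter fun l : Fin n => l.1 < j.1) := by
        ext l
        simp [Fin.ext_iff]
        omega
      simp only [e, this]
      rw [Finset.sum_insert (by simp)]
      ring
    simp only [wsum, h1, Finset.mul_sum]
    calc _ = ∑ i, ∑ k, ∑ j, α k j * ‖inner ℂ (bw i) (qc (E k) j)‖ ^ 2 := by
          rw [Finset.sum_comm (s := (Finset.univ : Finset (Fin (finrank ℂ (lift W)))))]
          refine Finset.sum_congr rfl fun k _ => Finset.sum_comm
      _ = 0 := by simp [trace_zero hsum]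
  have hfin := Finset.sum_le_sum fun k (_ : k ∈ Finset.univ) => hstep k
  rw [hzero, Finset.sum_sub_distrib, ← Finset.mul_sum] at hfin
  linarith

end
end HSR

namespace HSR
open Module Matrix

/-! ### Part J: semistability -/

theorem semistable {p : ℕ} {σ δ : Fin (2 * p) → ℝ} (hσ : Antitone σ) (hδ : Antitone δ)
    {E : Fin 3 → Matrix (Fin (2 * p)) (Fin (2 * p)) ℝ} (hE : ∀ k, (E k)ᵀ * E k = 1)
    (hsum : ∑ k, E k * diagonal ((![σ, σ, δ] : Fin 3 → Fin (2 * p) → ℝ) k) * (E k)ᵀ = 0) :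
    ∃ F : Fin 3 → Matrix (Fin p) (Fin p) ℝ, (∀ k, IsUnit (F k).det) ∧
      ∀ U, deg (sw σ δ) F U ≤ 0 := by
  obtain ⟨F, hF⟩ := exists_generic p
  refine ⟨F, hF.det, ?_⟩
  by_contra! hU
  obtain ⟨G, W, hG, hW, hpos⟩ := step3 hσ hδ hF.det (extVan_generic hF) hU
  have h := trace_contra (α := ![σ, σ, δ]) (by
      intro k
      fin_cases k
      · exact hσ
      · exact hσ
      · exact hδ) hE hsum (fun k s => finrank ℝ ↥(W ⊓ Fl (G k) s)) (finrank ℝ W)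
    (by intro k; rw [Fl_zero, inf_bot_eq, finrank_bot])
    (by intro k s hs; rw [Fl_top (hG k) hs, inf_top_eq])
    (fun ε hε => transfer hG hW E ε hε)
  exact absurd hpos (not_lt.2 h)

end HSR

namespace HSR
open Module Matrix

/-! ### Part K: Gram minors and QR -/

section
variable {n : ℕ}

/-- leading block -/
def lead (A : Matrix (Fin n) (Fin n) ℝ) (s : ℕ) : Matrix {j : Fin n // j.1 < s} {j : Fin n // j.1 < s} ℝ :=
  A.submatrix Subtype.val Subtype.val

/-- leading Gram minors -/
noncomputable def DD (N : Matrix (Fin n) (Fin n) ℝ) (s : ℕ) : ℝ := (lead (Nᵀ * N) s).det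

/-- upper triangular -/
def UT (R : Matrix (Fin n) (Fin n) ℝ) : Prop := ∀ i j, j < i → R i j = 0

theorem qr {N : Matrix (Fin n) (Fin n) ℝ} :
    ∃ Q R : Matrix (Fin n) (Fin n) ℝ, Qᵀ * Q = 1 ∧ UT R ∧ N = Q * R := by
  let f : Fin n → EuclideanSpace ℝ (Fin n) := fun j => WithLp.toLp 2 fun i => N i j
  let g := InnerProductSpace.gramSchmidtOrthonormalBasis (𝕜 := ℝ)
    (E := EuclideanSpace ℝ (Fin n)) (ι := Fin n) (by simp) f
  let Q : Matrix (Fin n) (Fin n) ℝ := Matrix.of fun i j => g j i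
  have hQ : Qᵀ * Q = 1 := by
    ext i j
    have h := (orthonormal_iff_ite.1 g.orthonormal) i j
    rw [Matrix.mul_apply, Matrix.one_apply, ← h]
    simp [Q, PiLp.inner_apply, mul_comm]
  refine ⟨Q, Qᵀ * N, hQ, ?_, ?_⟩
  · intro i j hij
    have h := InnerProductSpace.gramSchmidtOrthonormalBasis_inv_triangular (𝕜 := ℝ)
      (E := EuclideanSpace ℝ (Fin n)) (ι := Fin n) (by simp) f hij
    rw [Matrix.mul_apply]
    refine Eq.trans ?_ h
    simp [PiLp.inner_apply, Q, g, f, mul_comm]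
  · rw [← mul_assoc, mul_eq_one_comm.1 hQ, one_mul]

theorem lead_mul_UT {R : Matrix (Fin n) (Fin n) ℝ} (hR : UT R) (A : Matrix (Fin n) (Fin n) ℝ) (s : ℕ) :
    lead (A * R) s = lead A s * lead R s := by
  ext i j
  simp only [lead, submatrix_apply, Matrix.mul_apply]
  rw [← Finset.sum_subtype (Finset.univ.filter fun a : Fin n => a.1 < s)
      (p := fun a : Fin n => a.1 < s) (by simp) (fun a => A i.1 a * R a j.1)]
  rw [Finset.sum_filter_of_ne]
  · intro a _ ha
    by_contra hs
    apply ha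
    have : j.1 < a := by
      rw [Fin.lt_def]
      have := j.2
      omega
    rw [hR a j.1 this, mul_zero]

theorem lead_transpose (A : Matrix (Fin n) (Fin n) ℝ) (s : ℕ) : lead Aᵀ s = (lead A s)ᵀ := rfl

theorem lead_conj {R : Matrix (Fin n) (Fin n) ℝ} (hR : UT R) (X : Matrix (Fin n) (Fin n) ℝ) (s : ℕ) :
    lead (Rᵀ * X * R) s = (lead R s)ᵀ * lead X s * lead R s := by
  rw [lead_mul_UT hR]
  congr 1
  have : Rᵀ * X = (Xᵀ * R)ᵀ := by simp
  rw [this, lead_transpose, lead_mul_UT hR, transpose_mul, lead_transpose, transpose_transpose]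

theorem DD_eq {Q R : Matrix (Fin n) (Fin n) ℝ} (hQ : Qᵀ * Q = 1) (hR : UT R) (s : ℕ) :
    DD (Q * R) s = (lead R s).det ^ 2 := by
  have : (Q * R)ᵀ * (Q * R) = Rᵀ * 1 * R := by
    rw [transpose_mul, mul_assoc, ← mul_assoc Qᵀ, hQ, mul_assoc]
  rw [DD, this, lead_conj hR, det_mul, det_mul, det_transpose]
  have : lead (1 : Matrix (Fin n) (Fin n) ℝ) s = 1 := by
    ext i j
    simp [lead, Matrix.one_apply, Subtype.ext_iff]
  rw [this, det_one]
  ring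

theorem lead_det {R : Matrix (Fin n) (Fin n) ℝ} (hR : UT R) (s : ℕ) :
    (lead R s).det = ∏ j with j.1 < s, R j j := by
  rw [det_of_isUpperTriangular]
  · rw [Finset.prod_subtype (Finset.univ.filter fun j : Fin n => j.1 < s)
      (p := fun j : Fin n => j.1 < s) (by simp)]
    rfl
  · intro i j hij
    exact hR _ _ hij

theorem UT_diag {R : Matrix (Fin n) (Fin n) ℝ} (hR : UT R) (hd : R.det ≠ 0) (i : Fin n) :
    R i i ≠ 0 := by
  rw [det_of_isUpperTriangular (fun i j hij => hR i j hij)] at hd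
  exact Finset.prod_ne_zero_iff.1 hd i (Finset.mem_univ i)

theorem UT_inv {R R' : Matrix (Fin n) (Fin n) ℝ} (hR : UT R) (h : R * R' = 1) (i : Fin n) :
    R i i * R' i i = 1 := by
  let inv : Invertible R := invertibleOfRightInverse R R' h
  have h2 : R⁻¹ = R' := inv_eq_right_inv h
  have h3 : R⁻¹.BlockTriangular id := blockTriangular_inv_of_blockTriangular
    (M := R) (b := id) (fun i j hij => hR i j hij)
  rw [h2] at h3
  have h4 := congrFun (congrFun h i) i
  rw [Matrix.mul_apply, Matrix.one_apply_eq, Finset.sum_eq_single i] at h4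
  · exact h4
  · intro j _ hj
    rcases lt_or_gt_of_ne hj with h | h
    · rw [hR i j h, zero_mul]
    · rw [h3 h, mul_zero]
  · simp

theorem DD_pos {Q R : Matrix (Fin n) (Fin n) ℝ} (hQ : Qᵀ * Q = 1) (hR : UT R) (hd : R.det ≠ 0)
    (s : ℕ) : 0 < DD (Q * R) s := by
  rw [DD_eq hQ hR, lead_det hR]
  have : ∏ j with j.1 < s, R j j ≠ 0 := Finset.prod_ne_zero_iff.2 fun i _ => UT_diag hR hd i
  positivity

theorem DD_log {Q R : Matrix (Fin n) (Fin n) ℝ} (hQ : Qᵀ * Q = 1) (hR : UT R) (hd : R.det ≠ 0)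
    (i : Fin n) : Real.log (DD (Q * R) (i.1 + 1)) - Real.log (DD (Q * R) i.1) =
      2 * Real.log |R i i| := by
  rw [DD_eq hQ hR, lead_det hR, DD_eq hQ hR, lead_det hR]
  have : (Finset.univ.filter fun l : Fin n => l.1 < i.1 + 1) =
      insert i (Finset.univ.filter fun l : Fin n => l.1 < i.1) := by
    ext l
    simp [Fin.ext_iff]
    omega
  rw [this, Finset.prod_insert (by simp), mul_pow, Real.log_mul, Real.log_pow, Real.log_abs]
  · push_cast
    ring
  · exact pow_ne_zero _ (UT_diag hR hd i)
  · exact pow_ne_zero _ (Finset.prod_ne_zero_iff.2 fun i _ => UT_diag hR hd i)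

/-- rank one scaling -/
noncomputable def KK (u : ℝ) (v : Fin n → ℝ) : Matrix (Fin n) (Fin n) ℝ :=
  1 + (u - 1) • vecMulVec v v

theorem KK_transpose (u : ℝ) (v : Fin n → ℝ) : (KK u v)ᵀ = KK u v := by
  simp [KK, transpose_vecMulVec]

theorem KK_mul (u u' : ℝ) {v : Fin n → ℝ} (hv : v ⬝ᵥ v = 1) : KK u v * KK u' v = KK (u * u') v := by
  simp only [KK, mul_add, add_mul, smul_mul_assoc, mul_smul_comm, vecMulVec_mul_vecMulVec, hv,
    one_smul, mul_one, one_mul, smul_smul]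
  module

theorem DD_var {Q R : Matrix (Fin n) (Fin n) ℝ} (hQ : Qᵀ * Q = 1) (hR : UT R)
    (u : ℝ) {v : Fin n → ℝ} (hv : v ⬝ᵥ v = 1) (s : ℕ) :
    DD (KK u v * (Q * R)) s = DD (Q * R) s * (1 + (u * u - 1) * ∑ j with j.1 < s, ((Qᵀ *ᵥ v) j) ^ 2) := by
  have h1 : (KK u v * (Q * R))ᵀ * (KK u v * (Q * R)) = Rᵀ * (Qᵀ * KK (u * u) v * Q) * R := by
    rw [← KK_mul u u hv, transpose_mul, transpose_mul, KK_transpose]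
    simp only [mul_assoc]
  have h2 : Qᵀ * KK (u * u) v * Q = 1 + (u * u - 1) • vecMulVec (Qᵀ *ᵥ v) (Qᵀ *ᵥ v) := by
    rw [KK, mul_add, add_mul, mul_one, hQ, mul_smul_comm, smul_mul_assoc, mul_vecMulVec,
      vecMulVec_mul, ← mulVec_transpose]
  have h3 : lead (Qᵀ * KK (u * u) v * Q) s = 1 + replicateCol Unit (fun j => (u * u - 1) * (Qᵀ *ᵥ v) j.1) *
      replicateRow Unit (fun j => (Qᵀ *ᵥ v) j.1) := by
    rw [h2]
    ext i j
    simp [lead, Matrix.one_apply, Matrix.mul_apply, vecMulVec_apply, Subtype.ext_iff, mul_assoc]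
  rw [DD, h1, lead_conj hR, det_mul, det_mul, det_transpose, h3,
    det_one_add_replicateCol_mul_replicateRow, DD_eq hQ hR]
  have h4 : ((fun j : {j : Fin n // j.1 < s} => (Qᵀ *ᵥ v) j.1) ⬝ᵥ fun j => (u * u - 1) * (Qᵀ *ᵥ v) j.1)
      = (u * u - 1) * ∑ j with j.1 < s, ((Qᵀ *ᵥ v) j) ^ 2 := by
    rw [Finset.sum_subtype (Finset.univ.filter fun j : Fin n => j.1 < s)
      (p := fun j : Fin n => j.1 < s) (by simp), Finset.mul_sum]
    refine Finset.sum_congr rfl fun j _ => ?_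
    ring
  rw [h4]
  ring

end
end HSR

namespace HSR
open Module Matrix

/-! ### Part L: minimization -/

section
variable {n : ℕ}

theorem sym_zero {S : Matrix (Fin n) (Fin n) ℝ} (hS : Sᵀ = S)
    (h : ∀ v : Fin n → ℝ, v ⬝ᵥ v = 1 → v ⬝ᵥ S *ᵥ v = 0) : S = 0 := by
  have h1 : ∀ w : Fin n → ℝ, w ⬝ᵥ S *ᵥ w = 0 := by
    intro w
    by_cases hw : w = 0
    · simp [hw]
    have hpos : 0 < w ⬝ᵥ w := by
      rcases lt_or_eq_of_le (show 0 ≤ w ⬝ᵥ w from Finset.sum_nonneg fun i _ => mul_self_nonneg _) with h | h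
      · exact h
      · exact absurd (dotProduct_self_eq_zero.1 h.symm) hw
    have h2 := h ((Real.sqrt (w ⬝ᵥ w))⁻¹ • w) (by
      rw [smul_dotProduct, dotProduct_smul, smul_eq_mul, smul_eq_mul, ← mul_assoc, ← mul_inv,
        Real.mul_self_sqrt hpos.le, inv_mul_cancel₀ hpos.ne'])
    rw [mulVec_smul, smul_dotProduct, dotProduct_smul, smul_eq_mul, smul_eq_mul] at h2
    have h3 : (Real.sqrt (w ⬝ᵥ w))⁻¹ ≠ 0 := inv_ne_zero (Real.sqrt_ne_zero'.2 hpos)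
    simpa [h3] using h2
  have hd : ∀ i j, Pi.single i (1:ℝ) ⬝ᵥ S *ᵥ Pi.single j 1 = S i j := by
    intro i j
    simp
  ext i j
  have h2 := h1 (Pi.single i 1 + Pi.single j 1)
  rw [mulVec_add, add_dotProduct, dotProduct_add, dotProduct_add, hd, hd, hd, hd] at h2
  have h3 := h1 (Pi.single i 1)
  have h4 := h1 (Pi.single j 1)
  rw [hd] at h3 h4
  have h5 : S j i = S i j := congrFun (congrFun hS i) j
  simp only [Matrix.zero_apply]
  linarith

theorem entry_mul {A B : Matrix (Fin n) (Fin n) ℝ} {a b : ℝ} (ha : ∀ i j, |A i j| ≤ a)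
    (hb : ∀ i j, |B i j| ≤ b) (i j : Fin n) : |(A * B) i j| ≤ n * (a * b) := by
  rw [Matrix.mul_apply]
  refine (Finset.abs_sum_le_sum_abs _ _).trans ?_
  have : ∀ l ∈ Finset.univ, |A i l * B l j| ≤ a * b := fun l _ => by
    rw [abs_mul]
    exact mul_le_mul (ha i l) (hb l j) (abs_nonneg _) ((abs_nonneg _).trans (ha i l))
  refine (Finset.sum_le_card_nsmul _ _ _ this).trans (le_of_eq ?_)
  simp

theorem orth_entry {Q : Matrix (Fin n) (Fin n) ℝ} (hQ : Qᵀ * Q = 1) (i j : Fin n) : |Q i j| ≤ 1 := by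
  have h := congrFun (congrFun hQ j) j
  rw [Matrix.mul_apply, Matrix.one_apply_eq] at h
  simp only [transpose_apply] at h
  have h2 := Finset.single_le_sum (f := fun a => Q a j * Q a j) (fun a _ => mul_self_nonneg _)
    (Finset.mem_univ i)
  rw [h] at h2
  rw [← sq_le_one_iff_abs_le_one]
  nlinarith

/-- size -/
noncomputable def tt (h h' : Matrix (Fin n) (Fin n) ℝ) : ℝ := (hᵀ * h).trace + (h' * h'ᵀ).trace

theorem tt_eq (h h' : Matrix (Fin n) (Fin n) ℝ) :
    tt h h' = ∑ i, ∑ j, h j i ^ 2 + ∑ i, ∑ j, h' i j ^ 2 := by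
  simp [tt, Matrix.trace, Matrix.mul_apply, pow_two]

theorem tt_nonneg (h h' : Matrix (Fin n) (Fin n) ℝ) : 0 ≤ tt h h' := by
  rw [tt_eq]
  positivity

theorem tt_entry1 (h h' : Matrix (Fin n) (Fin n) ℝ) (i j : Fin n) : |h i j| ≤ Real.sqrt (tt h h') := by
  rw [← Real.sqrt_sq_eq_abs]
  apply Real.sqrt_le_sqrt
  rw [tt_eq]
  have h1 := Finset.single_le_sum (f := fun b => ∑ a, h a b ^ 2) (fun a _ => by positivity)
    (Finset.mem_univ j)
  have h2 := Finset.single_le_sum (f := fun a => h a j ^ 2) (fun a _ => by positivity)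
    (Finset.mem_univ i)
  have h3 : 0 ≤ ∑ i, ∑ j, h' i j ^ 2 := by positivity
  linarith

theorem tt_entry2 (h h' : Matrix (Fin n) (Fin n) ℝ) (i j : Fin n) : |h' i j| ≤ Real.sqrt (tt h h') := by
  rw [← Real.sqrt_sq_eq_abs]
  apply Real.sqrt_le_sqrt
  rw [tt_eq]
  have h1 := Finset.single_le_sum (f := fun b => ∑ a, h' b a ^ 2) (fun a _ => by positivity)
    (Finset.mem_univ i)
  have h2 := Finset.single_le_sum (f := fun a => h' i a ^ 2) (fun a _ => by positivity)
    (Finset.mem_univ j)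
  have h3 : 0 ≤ ∑ i, ∑ j, h j i ^ 2 := by positivity
  linarith

/-- potential -/
noncomputable def Psi (α : Fin 3 → Fin n → ℝ) (M : Fin 3 → Matrix (Fin n) (Fin n) ℝ)
    (h : Matrix (Fin n) (Fin n) ℝ) : ℝ :=
  ∑ k, wsum (α k) (fun s => Real.log (DD (h * M k) s))

theorem det_ne_of_mul {h h' : Matrix (Fin n) (Fin n) ℝ} (hh : h * h' = 1) : h.det ≠ 0 := by
  have := congrArg Matrix.det hh
  rw [det_mul, det_one] at this
  exact left_ne_zero_of_mul_eq_one this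

theorem log_bound {N N' : Matrix (Fin n) (Fin n) ℝ} (hN : N * N' = 1) {c : ℝ}
    (h1 : ∀ i j, |N i j| ≤ c) (h2 : ∀ i j, |N' i j| ≤ c) (i : Fin n) :
    |Real.log (DD N (i.1 + 1)) - Real.log (DD N i.1)| ≤ 2 * (n * c) := by
  obtain ⟨Q, R, hQ, hR, rfl⟩ := qr (N := N)
  have hd : R.det ≠ 0 := by
    have := det_ne_of_mul hN
    rw [det_mul] at this
    exact right_ne_zero_of_mul this
  rw [DD_log hQ hR hd, abs_mul, abs_two]
  have hRe : R = Qᵀ * (Q * R) := by rw [← mul_assoc, hQ, one_mul]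
  have hinv : R * (N' * Q) = 1 := by
    have : R * N' = Qᵀ := by
      calc R * N' = Qᵀ * (Q * R * N') := by rw [← mul_assoc, ← mul_assoc, hQ, one_mul]
        _ = Qᵀ := by rw [hN, mul_one]
    rw [← mul_assoc, this, hQ]
  have hb1 : |R i i| ≤ n * c := by
    rw [hRe]
    have := entry_mul (A := Qᵀ) (B := Q * R) (fun i j => orth_entry hQ j i) h1 i i
    simpa using this
  have hb2 : |(N' * Q) i i| ≤ n * c := by
    have := entry_mul (A := N') (B := Q) h2 (fun i j => orth_entry hQ i j) i i
    simpa using this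
  have hp : |R i i| * |(N' * Q) i i| = 1 := by
    rw [← abs_mul, UT_inv hR hinv, abs_one]
  have hpos1 : 0 < |R i i| := abs_pos.2 (UT_diag hR hd i)
  have hinv2 : |(N' * Q) i i| = |R i i|⁻¹ := eq_inv_of_mul_eq_one_right hp
  have hl1 := Real.log_le_sub_one_of_pos hpos1
  have hl2 := Real.log_le_sub_one_of_pos (inv_pos.2 hpos1)
  rw [Real.log_inv] at hl2
  rw [hinv2] at hb2
  have : |Real.log (|R i i|)| ≤ n * c := by
    rw [abs_le]
    constructor <;> linarith
  linarith

theorem Psi_bound (α : Fin 3 → Fin n → ℝ) {M : Fin 3 → Matrix (Fin n) (Fin n) ℝ}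
    (hM : ∀ k, IsUnit (M k).det) : ∃ C, 0 ≤ C ∧ ∀ h h' : Matrix (Fin n) (Fin n) ℝ, h * h' = 1 →
      |Psi α M h| ≤ C * Real.sqrt (tt h h') := by
  let m : ℝ := ∑ k, ∑ i, ∑ j, (|M k i j| + |(M k)⁻¹ i j|)
  have hm0 : ∀ k i j, |M k i j| + |(M k)⁻¹ i j| ≤ m := by
    intro k i j
    have h1 := Finset.single_le_sum (f := fun k => ∑ i, ∑ j, (|M k i j| + |(M k)⁻¹ i j|))
      (fun a _ => by positivity) (Finset.mem_univ k)
    have h2 := Finset.single_le_sum (f := fun i => ∑ j, (|M k i j| + |(M k)⁻¹ i j|))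
      (fun a _ => by positivity) (Finset.mem_univ i)
    have h3 := Finset.single_le_sum (f := fun j => (|M k i j| + |(M k)⁻¹ i j|))
      (fun a _ => by positivity) (Finset.mem_univ j)
    exact (h3.trans h2).trans h1
  have hmn : 0 ≤ m := by positivity
  refine ⟨∑ k, ∑ i, |α k i| * (2 * (n * (n * m))), by positivity, fun h h' hh => ?_⟩
  rw [Psi, Finset.sum_mul]
  refine (Finset.abs_sum_le_sum_abs _ _).trans (Finset.sum_le_sum fun k _ => ?_)
  rw [wsum, Finset.sum_mul]
  refine (Finset.abs_sum_le_sum_abs _ _).trans (Finset.sum_le_sum fun i _ => ?_)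
  rw [abs_mul, mul_assoc]
  refine mul_le_mul_of_nonneg_left ?_ (abs_nonneg _)
  have hNN : h * M k * ((M k)⁻¹ * h') = 1 := by
    rw [mul_assoc, ← mul_assoc (M k), Matrix.mul_nonsing_inv _ (hM k), one_mul, hh]
  have := log_bound hNN (c := n * (m * Real.sqrt (tt h h')))
    (fun i j => by
      have := entry_mul (A := h) (B := M k) (tt_entry1 h h')
        (fun i j => (le_add_of_nonneg_right (abs_nonneg _)).trans (hm0 k i j)) i j
      rwa [mul_comm m])
    (fun i j => entry_mul (A := (M k)⁻¹) (B := h')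
        (fun i j => (le_add_of_nonneg_left (abs_nonneg _)).trans (hm0 k i j))
        (tt_entry2 h h') i j) i
  refine this.trans (le_of_eq ?_)
  ring

theorem DD_ne {N N' : Matrix (Fin n) (Fin n) ℝ} (hN : N * N' = 1) (s : ℕ) : DD N s ≠ 0 := by
  obtain ⟨Q, R, hQ, hR, rfl⟩ := qr (N := N)
  have hd : R.det ≠ 0 := by
    have := det_ne_of_mul hN
    rw [det_mul] at this
    exact right_ne_zero_of_mul this
  exact (DD_pos hQ hR hd s).ne'

theorem DD_cont (A : Matrix (Fin n) (Fin n) ℝ) (s : ℕ) :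
    Continuous (fun h : Matrix (Fin n) (Fin n) ℝ => DD (h * A) s) := by
  unfold DD lead
  refine Continuous.matrix_det ?_
  refine Continuous.matrix_submatrix ?_ _ _
  fun_prop

theorem exists_min (α : Fin 3 → Fin n → ℝ) {M : Fin 3 → Matrix (Fin n) (Fin n) ℝ}
    (hM : ∀ k, IsUnit (M k).det) {ε : ℝ} (hε : 0 < ε) :
    ∃ h h' : Matrix (Fin n) (Fin n) ℝ, h * h' = 1 ∧ ∀ g g', g * g' = 1 →
      Psi α M h + ε * tt h h' ≤ Psi α M g + ε * tt g g' := by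
  obtain ⟨C, hC, hb⟩ := Psi_bound α hM
  set P0 := Psi α M 1 + ε * tt (1 : Matrix (Fin n) (Fin n) ℝ) 1 with hP0
  -- outside a big ball the value is large
  obtain ⟨b, hb0, hbig⟩ : ∃ b : ℝ, 0 ≤ b ∧ ∀ x, b < x → P0 < ε * x ^ 2 - C * x := by
    refine ⟨(C + 1 + |P0|) / ε + 1, by positivity, fun x hx => ?_⟩
    have h1 : (C + 1 + |P0|) / ε < x := by linarith
    rw [div_lt_iff₀ hε] at h1
    have h2 : 0 ≤ (C + 1 + |P0|) / ε := by positivity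
    have h3 : 1 < x := by linarith
    have h4 := le_abs_self P0
    have h5 := abs_nonneg P0
    nlinarith
  let S : Set (Matrix (Fin n) (Fin n) ℝ × Matrix (Fin n) (Fin n) ℝ) :=
    {x | x.1 * x.2 = 1 ∧ Real.sqrt (tt x.1 x.2) ≤ max b (Real.sqrt (tt (1 : Matrix (Fin n) (Fin n) ℝ) 1))}
  let c := max b (Real.sqrt (tt (1 : Matrix (Fin n) (Fin n) ℝ) 1))
  have httc : Continuous (fun x : Matrix (Fin n) (Fin n) ℝ × Matrix (Fin n) (Fin n) ℝ => tt x.1 x.2) := by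
    unfold tt
    fun_prop
  let box : Set (Matrix (Fin n) (Fin n) ℝ) :=
    Set.pi Set.univ fun _ => Set.pi Set.univ fun _ => Set.Icc (-c) c
  have hbox : IsCompact box := isCompact_univ_pi fun _ => isCompact_univ_pi fun _ => isCompact_Icc
  have hScl : IsClosed S := by
    refine IsClosed.inter (isClosed_eq (by fun_prop) continuous_const) ?_
    exact isClosed_le (Real.continuous_sqrt.comp httc) continuous_const
  have hS : IsCompact S := by
    refine (hbox.prod hbox).of_isClosed_subset hScl ?_
    rintro ⟨h, h'⟩ ⟨_, h2⟩
    refine ⟨fun i _ j _ => abs_le.1 ((tt_entry1 h h' i j).trans h2),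
      fun i _ j _ => abs_le.1 ((tt_entry2 h h' i j).trans h2)⟩
  have hcont : ContinuousOn (fun x : Matrix (Fin n) (Fin n) ℝ × Matrix (Fin n) (Fin n) ℝ =>
      Psi α M x.1 + ε * tt x.1 x.2) S := by
    refine ContinuousOn.add ?_ (httc.const_smul ε).continuousOn
    unfold Psi wsum
    refine continuousOn_finsetSum _ fun k _ => continuousOn_finsetSum _ fun i _ => ?_
    have hl : ∀ s, ContinuousOn (fun x : Matrix (Fin n) (Fin n) ℝ × Matrix (Fin n) (Fin n) ℝ =>
        Real.log (DD (x.1 * M k) s)) S := by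
      intro s
      refine ContinuousOn.log ((DD_cont (M k) s).comp continuous_fst).continuousOn ?_
      rintro ⟨h, h'⟩ ⟨h1, _⟩
      refine DD_ne (N' := (M k)⁻¹ * h') ?_ s
      change h * h' = 1 at h1
      rw [mul_assoc, ← mul_assoc (M k), Matrix.mul_nonsing_inv _ (hM k), one_mul, h1]
    exact continuousOn_const.mul ((hl _).sub (hl _))
  have h1S : ((1, 1) : Matrix (Fin n) (Fin n) ℝ × Matrix (Fin n) (Fin n) ℝ) ∈ S :=
    ⟨by simp, le_max_right _ _⟩
  obtain ⟨⟨h, h'⟩, hmem, hmin⟩ := hS.exists_isMinOn ⟨_, h1S⟩ hcont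
  refine ⟨h, h', hmem.1, fun g g' hg => ?_⟩
  by_cases hgS : (g, g') ∈ S
  · exact isMinOn_iff.1 hmin (g, g') hgS
  · have h2 : b < Real.sqrt (tt g g') := by
      by_contra! h3
      exact hgS ⟨hg, h3.trans (le_max_left _ _)⟩
    have h3 := hbig _ h2
    rw [Real.sq_sqrt (tt_nonneg g g')] at h3
    have h4 := (abs_le.1 (hb g g' hg)).1
    have h5 : Psi α M h + ε * tt h h' ≤ P0 := isMinOn_iff.1 hmin (1, 1) h1S
    linarith

end
end HSR

namespace HSR
open Module Matrix

/-! ### Part M: critical point equation -/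

section
variable {n : ℕ}

theorem dot_conj (h : Matrix (Fin n) (Fin n) ℝ) (v : Fin n → ℝ) :
    (hᵀ * vecMulVec v v * h).trace = v ⬝ᵥ (h * hᵀ) *ᵥ v := by
  rw [mul_vecMulVec, vecMulVec_mul, trace_vecMulVec, ← mulVec_transpose, ← mulVec_mulVec,
    dotProduct_mulVec, ← mulVec_transpose, transpose_transpose, dotProduct_comm]

theorem tt_var (h h' : Matrix (Fin n) (Fin n) ℝ) (u : ℝ) {v : Fin n → ℝ} (hv : v ⬝ᵥ v = 1) :
    tt (KK u v * h) (h' * KK u⁻¹ v) = tt h h' + (u * u - 1) * (v ⬝ᵥ (h * hᵀ) *ᵥ v) +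
      ((u * u)⁻¹ - 1) * (v ⬝ᵥ (h'ᵀ * h') *ᵥ v) := by
  have h1 : (KK u v * h)ᵀ * (KK u v * h) = hᵀ * KK (u * u) v * h := by
    rw [← KK_mul u u hv, transpose_mul, KK_transpose]
    simp only [mul_assoc]
  have h2 : (h' * KK u⁻¹ v) * (h' * KK u⁻¹ v)ᵀ = h'ᵀᵀ * KK ((u * u)⁻¹) v * h'ᵀ := by
    rw [mul_inv, ← KK_mul u⁻¹ u⁻¹ hv, transpose_mul, KK_transpose, transpose_transpose]
    simp only [mul_assoc]
  have h3 : ∀ (g : Matrix (Fin n) (Fin n) ℝ) (x : ℝ), (gᵀ * KK x v * g).trace =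
      (gᵀ * g).trace + (x - 1) * (v ⬝ᵥ (g * gᵀ) *ᵥ v) := by
    intro g x
    rw [← dot_conj, KK, mul_add, add_mul, mul_one, trace_add, mul_smul_comm, smul_mul_assoc,
      trace_smul, smul_eq_mul]
  rw [tt, h1, h2, h3, h3, tt, transpose_transpose]
  ring

theorem crit (α : Fin 3 → Fin n → ℝ) {M : Fin 3 → Matrix (Fin n) (Fin n) ℝ}
    (hM : ∀ k, IsUnit (M k).det) {ε : ℝ} (hε : 0 < ε) :
    ∃ h h' : Matrix (Fin n) (Fin n) ℝ, ∃ Q R : Fin 3 → Matrix (Fin n) (Fin n) ℝ,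
      h * h' = 1 ∧ (∀ k, (Q k)ᵀ * Q k = 1) ∧ (∀ k, UT (R k)) ∧ (∀ k, h * M k = Q k * R k) ∧
      ∑ k, Q k * diagonal (α k) * (Q k)ᵀ = -(ε • (h * hᵀ - h'ᵀ * h')) := by
  obtain ⟨h, h', hh, hmin⟩ := exists_min α hM hε
  choose Q R hQ hR hQR using fun k => qr (N := h * M k)
  refine ⟨h, h', Q, R, hh, hQ, hR, hQR, ?_⟩
  rw [← add_eq_zero_iff_eq_neg]
  apply sym_zero
  · rw [transpose_add, transpose_smul, transpose_sub, transpose_mul, transpose_mul, transpose_sum]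
    simp [mul_assoc]
  intro v hv
  set a := v ⬝ᵥ (h * hᵀ) *ᵥ v with ha
  set b := v ⬝ᵥ (h'ᵀ * h') *ᵥ v with hb
  let e : Fin 3 → ℕ → ℝ := fun k s => ∑ j with j.1 < s, (((Q k)ᵀ *ᵥ v) j) ^ 2
  have he0 : ∀ k s, 0 ≤ e k s := fun k s => by positivity
  have hz : ∀ k, ∑ j, (((Q k)ᵀ *ᵥ v) j) ^ 2 = 1 := by
    intro k
    have : ((Q k)ᵀ *ᵥ v) ⬝ᵥ ((Q k)ᵀ *ᵥ v) = 1 := by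
      rw [dotProduct_mulVec, ← mulVec_transpose, transpose_transpose, mulVec_mulVec,
        mul_eq_one_comm.1 (hQ k), one_mulVec, hv]
    rw [← this]
    simp [dotProduct, pow_two]
  have he1 : ∀ k s, e k s ≤ 1 := by
    intro k s
    rw [← hz k]
    exact Finset.sum_le_sum_of_subset_of_nonneg (Finset.filter_subset _ _)
      fun _ _ _ => by positivity
  let c : Fin 3 → ℕ → ℝ := fun k s => Real.log (DD (h * M k) s)
  let ψ : ℝ → ℝ := fun x => ∑ k, ∑ i : Fin n, α k i *
      ((c k (i.1 + 1) + Real.log (1 + (x - 1) * e k (i.1 + 1))) -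
        (c k i.1 + Real.log (1 + (x - 1) * e k i.1))) +
      ε * (tt h h' + (x - 1) * a + (x⁻¹ - 1) * b)
  have hDne : ∀ k s, DD (h * M k) s ≠ 0 := by
    intro k s
    refine DD_ne (N' := (M k)⁻¹ * h') ?_ s
    rw [mul_assoc, ← mul_assoc (M k), Matrix.mul_nonsing_inv _ (hM k), one_mul, hh]
  have hψ : ∀ x, 0 < x → ψ x = Psi α M (KK (Real.sqrt x) v * h) +
      ε * tt (KK (Real.sqrt x) v * h) (h' * KK (Real.sqrt x)⁻¹ v) := by
    intro x hx
    have hlog : ∀ k s, Real.log (DD (KK (Real.sqrt x) v * h * M k) s) =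
        c k s + Real.log (1 + (x - 1) * e k s) := by
      intro k s
      have hp : 1 + (x - 1) * e k s ≠ 0 := by
        have h1 := he0 k s
        have h2 := he1 k s
        rcases le_or_gt 1 x with h3 | h3
        · nlinarith
        · nlinarith
      rw [← Real.log_mul (hDne k s) hp, mul_assoc, hQR, DD_var (hQ k) (hR k) _ hv,
        Real.mul_self_sqrt hx.le]
    rw [tt_var h h' _ hv, Real.mul_self_sqrt hx.le]
    simp only [ψ, Psi, wsum, hlog, ← ha, ← hb]
  have hψ1 : ψ 1 = Psi α M h + ε * tt h h' := by
    simp [ψ, Psi, wsum, c]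
  have hloc : IsLocalMin ψ 1 := by
    filter_upwards [Ioi_mem_nhds (show (0:ℝ) < 1 by norm_num)] with x hx
    rw [hψ1, hψ x hx]
    apply hmin
    have h1 : Real.sqrt x ≠ 0 := Real.sqrt_ne_zero'.2 hx
    rw [mul_assoc, ← mul_assoc h, hh, one_mul, KK_mul _ _ hv, mul_inv_cancel₀ h1]
    simp [KK]
  have hder : HasDerivAt ψ (∑ k, ∑ i : Fin n, α k i * (e k (i.1 + 1) - e k i.1) +
      ε * (a - b)) 1 := by
    have hl : ∀ k s, HasDerivAt (fun x : ℝ => c k s + Real.log (1 + (x - 1) * e k s)) (e k s) 1 := by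
      intro k s
      have h1 : HasDerivAt (fun x : ℝ => 1 + (x - 1) * e k s) (1 * e k s) 1 :=
        (((hasDerivAt_id (1:ℝ)).sub_const 1).mul_const (e k s)).const_add 1
      have h2 := (h1.log (by simp)).const_add (c k s)
      simpa using h2
    refine HasDerivAt.add ?_ ?_
    · refine HasDerivAt.fun_sum fun k _ => HasDerivAt.fun_sum fun i _ => ?_
      exact ((hl k _).sub (hl k _)).const_mul (α k i)
    · refine HasDerivAt.const_mul ε ?_
      have h1 : HasDerivAt (fun x : ℝ => tt h h' + (x - 1) * a) (1 * a) 1 :=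
        (((hasDerivAt_id (1:ℝ)).sub_const 1).mul_const a).const_add _
      have h2 : HasDerivAt (fun x : ℝ => (x⁻¹ - 1) * b) ((-(1 ^ 2)⁻¹) * b) 1 :=
        ((hasDerivAt_inv (by norm_num : (1:ℝ) ≠ 0)).sub_const 1).mul_const b
      have h3 := h1.add h2
      exact h3.congr_deriv (by ring)
  have hzero := hloc.hasDerivAt_eq_zero hder
  have hq : ∀ k, ∑ i : Fin n, α k i * (e k (i.1 + 1) - e k i.1) =
      v ⬝ᵥ (Q k * diagonal (α k) * (Q k)ᵀ) *ᵥ v := by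
    intro k
    have h1 : ∀ i : Fin n, e k (i.1 + 1) - e k i.1 = (((Q k)ᵀ *ᵥ v) i) ^ 2 := by
      intro i
      have : (Finset.univ.filter fun l : Fin n => l.1 < i.1 + 1) =
          insert i (Finset.univ.filter fun l : Fin n => l.1 < i.1) := by
        ext l
        simp [Fin.ext_iff]
        omega
      simp only [e, this]
      rw [Finset.sum_insert (by simp)]
      ring
    rw [← mulVec_mulVec, ← mulVec_mulVec, dotProduct_mulVec, ← mulVec_transpose, dotProduct]
    refine Finset.sum_congr rfl fun i _ => ?_
    rw [h1, mulVec_diagonal]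
    ring
  rw [add_mulVec, dotProduct_add, smul_mulVec, dotProduct_smul, sub_mulVec, dotProduct_sub,
    sum_mulVec, dotProduct_sum, smul_eq_mul, ← ha, ← hb, ← hzero]
  congr 1
  exact Finset.sum_congr rfl fun k _ => (hq k).symm

end
end HSR

namespace HSR
open Module Matrix

/-! ### Part N: limits -/

section
variable {n : ℕ}

theorem finrank_Fl {N : Matrix (Fin n) (Fin n) ℝ} (hN : IsUnit N.det) (s : ℕ) :
    finrank ℝ ↥(Fl N s) = (Finset.univ.filter fun j : Fin n => j.1 < s).card := by
  have h : lt n s = ↑(Finset.univ.filter fun j : Fin n => j.1 < s) := by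
    ext j
    simp [lt]
  rw [← finrank_csS (K := ℝ)]
  unfold Fl
  rw [finrank_map_inj _ (mulVec_inj hN), h]

/-- vectors whose image vanishes off `J` -/
def LJ (V : Matrix (Fin n) (Fin n) ℝ) (J : Finset (Fin n)) : Submodule ℝ (Fin n → ℝ) where
  carrier := {x | ∀ i, i ∉ J → (V *ᵥ x) i = 0}
  add_mem' ha hb i hi := by rw [mulVec_add, Pi.add_apply, ha i hi, hb i hi, add_zero]
  zero_mem' i _ := by simp
  smul_mem' c a ha i hi := by rw [mulVec_smul, Pi.smul_apply, ha i hi, smul_zero]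

theorem exists_compl (F L : Submodule ℝ (Fin n → ℝ)) : ∃ F' ≤ F, F' ⊓ L = ⊥ ∧
    finrank ℝ F' + finrank ℝ ↥(L ⊓ F) = finrank ℝ F := by
  obtain ⟨C, hC⟩ := Submodule.exists_isCompl (L ⊓ F)
  refine ⟨C ⊓ F, inf_le_right, ?_, ?_⟩
  · rw [inf_assoc, inf_comm F L, inf_comm]
    exact hC.inf_eq_bot
  · have h := Submodule.finrank_sup_add_finrank_inf_eq (L ⊓ F) (C ⊓ F)
    have h1 : (L ⊓ F) ⊔ (C ⊓ F) = F := by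
      rw [← sup_inf_assoc_of_le C (show L ⊓ F ≤ F from inf_le_right), hC.sup_eq_top, top_inf_eq]
    have h2 : (L ⊓ F) ⊓ (C ⊓ F) = ⊥ := by
      rw [← inf_assoc, hC.inf_eq_bot, bot_inf_eq]
    rw [h1, h2, finrank_bot] at h
    omega

/-- truncated multiplication -/
def TJ (V : Matrix (Fin n) (Fin n) ℝ) (J : Finset (Fin n)) (x : Fin n → ℝ) : Fin n → ℝ :=
  fun i => if i ∈ J then 0 else (V *ᵥ x) i

theorem exists_K (V : Matrix (Fin n) (Fin n) ℝ) (J : Finset (Fin n)) {F' : Submodule ℝ (Fin n → ℝ)}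
    (h : F' ⊓ LJ V J = ⊥) : ∃ K : ℝ, 0 < K ∧ ∀ x ∈ F', ‖x‖ ≤ K * ‖TJ V J x‖ := by
  let T : F' →ₗ[ℝ] (Fin n → ℝ) :=
    { toFun := fun x => TJ V J x
      map_add' := by
        intro a b
        ext i
        by_cases hi : i ∈ J <;> simp [TJ, hi, mulVec_add]
      map_smul' := by
        intro c a
        ext i
        by_cases hi : i ∈ J <;> simp [TJ, hi, mulVec_smul] }
  have hk : LinearMap.ker T = ⊥ := by
    rw [LinearMap.ker_eq_bot']
    intro x hx
    have hxL : (x : Fin n → ℝ) ∈ F' ⊓ LJ V J := by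
      refine ⟨x.2, fun i hi => ?_⟩
      have := congrFun hx i
      simpa [T, TJ, hi] using this
    rw [h] at hxL
    exact Subtype.ext hxL
  obtain ⟨K, hK, hKl⟩ := T.exists_antilipschitzWith hk
  refine ⟨K, hK, fun x hx => ?_⟩
  have := hKl.le_mul_dist ⟨x, hx⟩ 0
  rw [map_zero, dist_zero_right, dist_zero_right] at this
  exact this

theorem mulVec_bound {V : Matrix (Fin n) (Fin n) ℝ} {c : ℝ} (hV : ∀ i j, |V i j| ≤ c)
    (x : Fin n → ℝ) (i : Fin n) : |(V *ᵥ x) i| ≤ n * (c * ‖x‖) := by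
  rw [mulVec, dotProduct]
  refine (Finset.abs_sum_le_sum_abs _ _).trans ?_
  have : ∀ l ∈ Finset.univ, |V i l * x l| ≤ c * ‖x‖ := fun l _ => by
    rw [abs_mul]
    exact mul_le_mul (hV i l) (norm_le_pi_norm x l) (abs_nonneg _) ((abs_nonneg _).trans (hV i l))
  refine (Finset.sum_le_card_nsmul _ _ _ this).trans (le_of_eq ?_)
  simp

theorem est_one {N V Q R : Matrix (Fin n) (Fin n) ℝ} {r : Fin n → ℝ} (hV : Vᵀ * V = 1)
    (hr : ∀ i, 0 < r i) (hQ : Qᵀ * Q = 1) (hR : UT R) (he : diagonal r * V * N = Q * R)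
    (J : Finset (Fin n)) {θ K : ℝ} (hθ : 0 < θ) (hK : 0 < K)
    (hrat : ∀ j ∈ J, ∀ i, i ∉ J → r j ≤ θ * r i) (s : ℕ) {F' : Submodule ℝ (Fin n → ℝ)}
    (hF' : F' ≤ Fl N s) (hTK : ∀ x ∈ F', ‖x‖ ≤ K * ‖TJ V J x‖) :
    (finrank ℝ F' : ℝ) * (1 - n * (n * K * θ) ^ 2) ≤
      ∑ j ∈ Jᶜ, ∑ i with i.1 < s, Q j i ^ 2 := by
  let w : {i : Fin n // i.1 < s} → EuclideanSpace ℝ (Fin n) :=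
    fun i => WithLp.toLp 2 fun a => Q a i
  have hw : Orthonormal ℝ w := by
    rw [orthonormal_iff_ite]
    intro i j
    have h := congrFun (congrFun hQ i) j
    rw [Matrix.mul_apply, Matrix.one_apply] at h
    simp only [Subtype.ext_iff]
    rw [← h]
    simp [w, PiLp.inner_apply, mul_comm]
  let g : (Fin n → ℝ) →ₗ[ℝ] EuclideanSpace ℝ (Fin n) :=
    (WithLp.linearEquiv 2 ℝ (Fin n → ℝ)).symm.toLinearMap ∘ₗ (diagonal r * V).mulVecLin
  have hgap : ∀ x a, g x a = r a * (V *ᵥ x) a := by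
    intro x a
    simp [g, ← mulVec_mulVec, mulVec_diagonal]
  have hginj : Function.Injective g := by
    refine (WithLp.linearEquiv 2 ℝ (Fin n → ℝ)).symm.injective.comp ?_
    apply mulVec_inj
    rw [det_mul, det_diagonal]
    refine IsUnit.mul (isUnit_iff_ne_zero.2 (Finset.prod_ne_zero_iff.2 fun i _ => (hr i).ne')) ?_
    exact isUnit_iff_ne_zero.2 (det_ne_of_mul (mul_eq_one_comm.1 hV))
  have hU : F'.map g ≤ Submodule.span ℝ (Set.range w) := by
    rintro _ ⟨x, hx, rfl⟩
    obtain ⟨y, hy, rfl⟩ := mem_Fl.1 (hF' hx)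
    have h1 : g (N *ᵥ y) = ∑ i : {i : Fin n // i.1 < s}, (R *ᵥ y) i.1 • w i := by
      ext a
      have : g (N *ᵥ y) a = (Q *ᵥ (R *ᵥ y)) a := by
        rw [mulVec_mulVec, ← he, ← mulVec_mulVec]
        rfl
      rw [this, mulVec, dotProduct]
      have h2 : ∀ i : Fin n, s ≤ i.1 → (R *ᵥ y) i = 0 := by
        intro i hi
        rw [mulVec, dotProduct]
        refine Finset.sum_eq_zero fun j _ => ?_
        by_cases hj : s ≤ j.1
        · rw [hy j hj, mul_zero]
        · rw [hR i j (by rw [Fin.lt_def]; omega), zero_mul]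
      have h3 : ∑ i, Q a i * (R *ᵥ y) i = ∑ i with i.1 < s, Q a i * (R *ᵥ y) i := by
        rw [Finset.sum_filter_of_ne]
        intro i _ hi
        by_contra hc
        exact hi (by rw [h2 i (by omega), mul_zero])
      have h4 := Finset.sum_subtype (Finset.univ.filter fun j : Fin n => j.1 < s)
        (F := inferInstance) (p := fun j : Fin n => j.1 < s) (by simp) (fun i => Q a i * (R *ᵥ y) i)
      rw [h3, h4]
      simp [w, mul_comm]
    rw [h1]
    exact Submodule.sum_mem _ fun i _ => Submodule.smul_mem _ _ (Submodule.subset_span ⟨i, rfl⟩)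
  have hb := bessel_sub hw hU Jᶜ (fun j => EuclideanSpace.single j (1:ℝ))
    (1 - n * (n * K * θ) ^ 2) (by
      rintro _ ⟨x, hx, rfl⟩ hu
      have hin : ∀ j, ‖inner ℝ (EuclideanSpace.single j (1:ℝ)) (g x)‖ ^ 2 = (g x j) ^ 2 := by
        intro j
        rw [EuclideanSpace.inner_single_left]
        simp
      simp_rw [hin]
      have htot : ∑ j ∈ J, (g x j) ^ 2 + ∑ j ∈ Jᶜ, (g x j) ^ 2 = 1 := by
        rw [Finset.sum_add_sum_compl]
        have := EuclideanSpace.norm_sq_eq (g x)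
        rw [hu] at this
        simpa using this.symm
      have hle1 : ∀ i, |g x i| ≤ 1 := by
        intro i
        rw [← hu]
        exact PiLp.norm_apply_le (g x) i
      have hJ : ∀ j ∈ J, (g x j) ^ 2 ≤ (n * K * θ) ^ 2 := by
        intro j hj
        have h1 : r j * ‖TJ V J x‖ ≤ θ := by
          rw [mul_comm, ← le_div_iff₀ (hr j), pi_norm_le_iff_of_nonneg (by have := hr j; positivity)]
          intro i
          by_cases hi : i ∈ J
          · simp only [TJ, hi, if_true, norm_zero]
            have := hr j
            positivity
          · simp only [TJ, hi, if_false]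
            rw [le_div_iff₀ (hr j), mul_comm]
            have h2 := hle1 i
            rw [hgap, abs_mul, abs_of_pos (hr i)] at h2
            calc r j * ‖(V *ᵥ x) i‖ ≤ θ * r i * ‖(V *ᵥ x) i‖ :=
                  mul_le_mul_of_nonneg_right (hrat j hj i hi) (norm_nonneg _)
              _ = θ * (r i * |(V *ᵥ x) i|) := by rw [mul_assoc]; rfl
              _ ≤ θ * 1 := mul_le_mul_of_nonneg_left h2 hθ.le
              _ = θ := mul_one _
        rw [← sq_abs, hgap, abs_mul, abs_of_pos (hr j)]
        refine pow_le_pow_left₀ (mul_nonneg (hr j).le (abs_nonneg _)) ?_ 2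
        have h3 := mulVec_bound (orth_entry hV) x j
        calc r j * |(V *ᵥ x) j| ≤ r j * (n * (1 * (K * ‖TJ V J x‖))) := by
              refine mul_le_mul_of_nonneg_left (h3.trans ?_) (hr j).le
              have := hTK x hx
              gcongr
          _ = n * K * (r j * ‖TJ V J x‖) := by ring
          _ ≤ n * K * θ := by gcongr
      have hsumJ : ∑ j ∈ J, (g x j) ^ 2 ≤ n * (n * K * θ) ^ 2 := by
        refine (Finset.sum_le_card_nsmul _ _ _ hJ).trans ?_
        rw [nsmul_eq_mul]
        refine mul_le_mul_of_nonneg_right ?_ (sq_nonneg _)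
        have := Finset.card_le_univ J
        simp at this
        exact_mod_cast this
      linarith)
  rw [finrank_map_inj g hginj] at hb
  refine hb.trans (le_of_eq ?_)
  refine Finset.sum_congr rfl fun j _ => ?_
  rw [Finset.sum_subtype (Finset.univ.filter fun j : Fin n => j.1 < s)
        (p := fun j : Fin n => j.1 < s) (by simp)]
  refine Finset.sum_congr rfl fun i _ => ?_
  rw [EuclideanSpace.inner_single_right, Real.norm_eq_abs, sq_abs]
  simp [w]

theorem lim_est {l : Filter ℕ} [l.NeBot] {N : Matrix (Fin n) (Fin n) ℝ} (hN : IsUnit N.det)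
    {V Q R : ℕ → Matrix (Fin n) (Fin n) ℝ} {r : ℕ → Fin n → ℝ} {V' Q' : Matrix (Fin n) (Fin n) ℝ}
    (hV : ∀ m, (V m)ᵀ * V m = 1) (hr : ∀ m i, 0 < r m i) (hQ : ∀ m, (Q m)ᵀ * Q m = 1)
    (hR : ∀ m, UT (R m)) (he : ∀ m, diagonal (r m) * V m * N = Q m * R m)
    (hV' : ∀ i j, Filter.Tendsto (fun m => V m i j) l (nhds (V' i j)))
    (hQ' : ∀ i j, Filter.Tendsto (fun m => Q m i j) l (nhds (Q' i j)))
    (hQ'o : Q'ᵀ * Q' = 1) (J : Finset (Fin n))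
    (hrat : ∀ θ > 0, ∀ᶠ m in l, ∀ j ∈ J, ∀ i, i ∉ J → r m j ≤ θ * r m i) (s : ℕ) :
    ∑ i with i.1 < s, ∑ j ∈ J, Q' j i ^ 2 ≤ finrank ℝ ↥(LJ V' J ⊓ Fl N s) := by
  obtain ⟨F', hF', hFL, hdim⟩ := exists_compl (Fl N s) (LJ V' J)
  obtain ⟨K, hK, hTK⟩ := exists_K V' J hFL
  have hev : ∀ᶠ m in l, ∀ x ∈ F', ‖x‖ ≤ (2 * K) * ‖TJ (V m) J x‖ := by
    have hd : 0 < 1 / (2 * K * (n + 1)) := by positivity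
    have h1 : ∀ᶠ m in l, ∀ i j, |V m i j - V' i j| ≤ 1 / (2 * K * (n + 1)) := by
      rw [Filter.eventually_all]
      intro i
      rw [Filter.eventually_all]
      intro j
      have := (hV' i j).eventually (Metric.ball_mem_nhds _ hd)
      filter_upwards [this] with m hm
      exact le_of_lt hm
    filter_upwards [h1] with m hm x hx
    have h2 : ‖TJ V' J x - TJ (V m) J x‖ ≤ 1 / (2 * K) * ‖x‖ := by
      rw [pi_norm_le_iff_of_nonneg (by positivity)]
      intro i
      by_cases hi : i ∈ J
      · simp only [Pi.sub_apply, TJ, hi, if_true, sub_zero, norm_zero]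
        positivity
      · simp only [Pi.sub_apply, TJ, hi, if_false]
        rw [← Pi.sub_apply, ← sub_mulVec]
        have h3 := mulVec_bound (V := V' - V m) (c := 1 / (2 * K * (n + 1)))
          (fun i j => by rw [Matrix.sub_apply, abs_sub_comm]; exact hm i j) x i
        refine h3.trans ?_
        rw [← mul_assoc]
        refine mul_le_mul_of_nonneg_right ?_ (norm_nonneg _)
        rw [mul_one_div, div_le_div_iff₀ (by positivity) (by positivity)]
        nlinarith
    have h4 := hTK x hx
    have h5 : ‖TJ V' J x‖ ≤ ‖TJ (V m) J x‖ + 1 / (2 * K) * ‖x‖ := by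
      have := norm_le_norm_add_norm_sub (TJ (V m) J x) (TJ V' J x)
      rw [norm_sub_rev] at this
      linarith
    have h6 : ‖x‖ ≤ K * (‖TJ (V m) J x‖ + 1 / (2 * K) * ‖x‖) :=
      h4.trans (mul_le_mul_of_nonneg_left h5 hK.le)
    have h7 : K * (‖TJ (V m) J x‖ + 1 / (2 * K) * ‖x‖) = K * ‖TJ (V m) J x‖ + ‖x‖ / 2 := by
      field_simp
    linarith
  have hX : ∀ θ > 0, (finrank ℝ F' : ℝ) * (1 - n * (n * (2 * K) * θ) ^ 2) ≤
      ∑ j ∈ Jᶜ, ∑ i with i.1 < s, Q' j i ^ 2 := by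
    intro θ hθ
    have ht : Filter.Tendsto (fun m => ∑ j ∈ Jᶜ, ∑ i with i.1 < s, Q m j i ^ 2) l
        (nhds (∑ j ∈ Jᶜ, ∑ i with i.1 < s, Q' j i ^ 2)) :=
      tendsto_finsetSum _ fun j _ => tendsto_finsetSum _ fun i _ => (hQ' j i).pow 2
    refine ge_of_tendsto ht ?_
    filter_upwards [hev, hrat θ hθ] with m h1 h2
    exact est_one (hV m) (hr m) (hQ m) (hR m) (he m) J hθ (by positivity) h2 s hF' h1
  have hX0 : (finrank ℝ F' : ℝ) ≤ ∑ j ∈ Jᶜ, ∑ i with i.1 < s, Q' j i ^ 2 := by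
    have hc : Continuous (fun θ : ℝ => (finrank ℝ F' : ℝ) * (1 - n * (n * (2 * K) * θ) ^ 2)) := by
      fun_prop
    have ht := (hc.tendsto 0).mono_left (nhdsWithin_le_nhds (s := Set.Ioi 0))
    have h0 : (finrank ℝ F' : ℝ) * (1 - n * (n * (2 * K) * 0) ^ 2) = finrank ℝ F' := by simp
    rw [h0] at ht
    refine le_of_tendsto ht ?_
    filter_upwards [self_mem_nhdsWithin] with θ hθ
    exact hX θ hθ
  have hcol : ∀ i, ∑ j ∈ J, Q' j i ^ 2 + ∑ j ∈ Jᶜ, Q' j i ^ 2 = 1 := by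
    intro i
    rw [Finset.sum_add_sum_compl]
    have h := congrFun (congrFun hQ'o i) i
    rw [Matrix.mul_apply, Matrix.one_apply_eq] at h
    rw [← h]
    simp [pow_two]
  have hsum : ∑ i with i.1 < s, ∑ j ∈ J, Q' j i ^ 2 + ∑ j ∈ Jᶜ, ∑ i with i.1 < s, Q' j i ^ 2 =
      (finrank ℝ ↥(Fl N s) : ℝ) := by
    rw [finrank_Fl hN, Finset.sum_comm (s := Jᶜ), ← Finset.sum_add_distrib]
    simp [hcol]
  rw [← hdim] at hsum
  push_cast at hsum
  linarith

end
end HSR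

namespace HSR
open Module Matrix

/-! ### Part O: the Kempf-Ness type statement -/

section
variable {n : ℕ}

theorem diag_sym {S : Matrix (Fin n) (Fin n) ℝ} (hS : S.IsHermitian) :
    ∃ U : Matrix (Fin n) (Fin n) ℝ, Uᵀ * U = 1 ∧ U * Uᵀ = 1 ∧
      S = U * diagonal hS.eigenvalues * Uᵀ := by
  refine ⟨hS.eigenvectorUnitary, ?_, ?_, ?_⟩
  · have := Unitary.coe_star_mul_self hS.eigenvectorUnitary
    rwa [star_eq_conjTranspose, conjTranspose_eq_transpose_of_trivial] at this
  · have := Unitary.coe_mul_star_self hS.eigenvectorUnitary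
    rwa [Unitary.coe_star, star_eq_conjTranspose, conjTranspose_eq_transpose_of_trivial] at this
  · have := hS.spectral_theorem
    rw [Unitary.conjStarAlgAut_apply, star_eq_conjTranspose,
      conjTranspose_eq_transpose_of_trivial] at this
    exact this

theorem crit2 (α : Fin 3 → Fin n → ℝ) {M : Fin 3 → Matrix (Fin n) (Fin n) ℝ}
    (hM : ∀ k, IsUnit (M k).det) {ε : ℝ} (hε : 0 < ε) :
    ∃ (V : Matrix (Fin n) (Fin n) ℝ) (r : Fin n → ℝ) (Q R : Fin 3 → Matrix (Fin n) (Fin n) ℝ),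
      Vᵀ * V = 1 ∧ (∀ i, 0 < r i) ∧ (∀ k, (Q k)ᵀ * Q k = 1) ∧ (∀ k, UT (R k)) ∧
      (∀ k, diagonal r * V * M k = Q k * R k) ∧
      ∑ k, Q k * diagonal (α k) * (Q k)ᵀ =
        -(ε • diagonal (fun i => r i ^ 2 - (r i ^ 2)⁻¹)) := by
  obtain ⟨h, h', Q, R, hh, hQ, hR, hM', hsum⟩ := crit α hM hε
  have hS : (h * hᵀ).IsHermitian := by
    rw [IsHermitian, conjTranspose_eq_transpose_of_trivial]
    simp
  obtain ⟨U, hU, hU', hd⟩ := diag_sym hS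
  generalize hS.eigenvalues = d at hd
  have hgg : Uᵀ * h * (Uᵀ * h)ᵀ = diagonal d := by
    calc Uᵀ * h * (Uᵀ * h)ᵀ = Uᵀ * (h * hᵀ) * U := by
          simp [Matrix.mul_assoc]
      _ = (Uᵀ * U) * diagonal d * (Uᵀ * U) := by rw [hd]; simp only [Matrix.mul_assoc]
      _ = diagonal d := by rw [hU]; simp
  have hdet : (diagonal d).det ≠ 0 := by
    rw [← hgg, det_mul, det_transpose, det_mul]
    have h1 : (Uᵀ).det ≠ 0 := det_ne_of_mul hU
    have h2 : h.det ≠ 0 := det_ne_of_mul hh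
    exact mul_ne_zero (mul_ne_zero h1 h2) (mul_ne_zero h1 h2)
  have hpos : ∀ i, 0 < d i := by
    intro i
    rw [det_diagonal, Finset.prod_ne_zero_iff] at hdet
    refine lt_of_le_of_ne ?_ (hdet i (Finset.mem_univ i)).symm
    have := congrFun (congrFun hgg i) i
    rw [diagonal_apply_eq, Matrix.mul_apply] at this
    rw [← this]
    exact Finset.sum_nonneg fun j _ => mul_self_nonneg _
  have hr : ∀ i, 0 < √(d i) := fun i => Real.sqrt_pos.2 (hpos i)
  have hrr : ∀ i, √(d i) ^ 2 = d i := fun i => Real.sq_sqrt (hpos i).le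
  have hX : Uᵀ * h'ᵀ * (h' * U) = diagonal (fun i => (d i)⁻¹) := by
    have h1 : diagonal d * (Uᵀ * h'ᵀ * (h' * U)) = 1 := by
      have hhT : hᵀ * h'ᵀ = 1 := by
        rw [← transpose_mul, mul_eq_one_comm.1 hh, transpose_one]
      calc diagonal d * (Uᵀ * h'ᵀ * (h' * U))
          = Uᵀ * h * (hᵀ * (U * Uᵀ) * h'ᵀ) * h' * U := by
            rw [← hgg]; simp [Matrix.mul_assoc]
        _ = Uᵀ * (h * h') * U := by
            rw [hU', Matrix.mul_one, hhT, Matrix.mul_one, Matrix.mul_assoc Uᵀ]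
        _ = 1 := by rw [hh, Matrix.mul_one, hU]
    have h2 : diagonal (fun i => (d i)⁻¹) * diagonal d = 1 := by
      rw [diagonal_mul_diagonal, ← diagonal_one]
      congr 1
      ext i
      exact inv_mul_cancel₀ (hpos i).ne'
    calc _ = (diagonal (fun i => (d i)⁻¹) * diagonal d) * (Uᵀ * h'ᵀ * (h' * U)) := by
          rw [h2, Matrix.one_mul]
      _ = _ := by rw [Matrix.mul_assoc, h1, Matrix.mul_one]
  have hV : diagonal (fun i => √(d i)) * (diagonal (fun i => (√(d i))⁻¹) * (Uᵀ * h)) = Uᵀ * h := by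
    rw [← Matrix.mul_assoc, diagonal_mul_diagonal]
    have : (diagonal fun i => √(d i) * (√(d i))⁻¹) = (1 : Matrix (Fin n) (Fin n) ℝ) := by
      rw [← diagonal_one]
      congr 1
      ext i
      exact mul_inv_cancel₀ (hr i).ne'
    rw [this, Matrix.one_mul]
  refine ⟨diagonal (fun i => (√(d i))⁻¹) * (Uᵀ * h), fun i => √(d i), fun k => Uᵀ * Q k, R, ?_, hr,
    ?_, hR, ?_, ?_⟩
  · rw [mul_eq_one_comm]
    rw [transpose_mul, diagonal_transpose, ← Matrix.mul_assoc,
      Matrix.mul_assoc (diagonal _) (Uᵀ * h), hgg, diagonal_mul_diagonal, diagonal_mul_diagonal,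
      ← diagonal_one]
    congr 1
    ext i
    have := hr i
    have h2 := hrr i
    field_simp
    linarith
  · intro k
    rw [transpose_mul, transpose_transpose, Matrix.mul_assoc, ← Matrix.mul_assoc U, hU',
      Matrix.one_mul, hQ]
  · intro k
    rw [hV, Matrix.mul_assoc, hM', Matrix.mul_assoc]
  · have h1 : ∀ k, Uᵀ * Q k * diagonal (α k) * (Uᵀ * Q k)ᵀ =
        Uᵀ * (Q k * diagonal (α k) * (Q k)ᵀ) * U := by
      intro k
      simp [Matrix.mul_assoc]
    simp_rw [h1]
    rw [← Finset.sum_mul, ← Finset.mul_sum, hsum]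
    have h2 : Uᵀ * -(ε • (h * hᵀ - h'ᵀ * h')) * U =
        -(ε • (Uᵀ * h * (Uᵀ * h)ᵀ - Uᵀ * h'ᵀ * (h' * U))) := by
      simp [Matrix.mul_assoc, Matrix.mul_sub, Matrix.sub_mul]
    rw [h2, hgg, hX, diagonal_sub]
    simp_rw [hrr]

theorem orth_lim (l : Ultrafilter ℕ) {V : ℕ → Matrix (Fin n) (Fin n) ℝ}
    (hV : ∀ m, (V m)ᵀ * V m = 1) : ∃ V' : Matrix (Fin n) (Fin n) ℝ,
      (∀ i j, Filter.Tendsto (fun m => V m i j) l (nhds (V' i j))) ∧ V'ᵀ * V' = 1 := by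
  have h : ∀ i j, ∃ x, Filter.Tendsto (fun m => V m i j) l (nhds x) := by
    intro i j
    obtain ⟨x, _, hx⟩ := (isCompact_Icc (a := (-1:ℝ)) (b := 1)).ultrafilter_le_nhds
      (l.map fun m => V m i j) (by
        rw [Filter.le_principal_iff]
        have h0 : ∀ᶠ m in (l : Filter ℕ), V m i j ∈ Set.Icc (-1:ℝ) 1 :=
          Filter.Eventually.of_forall fun m => abs_le.1 (orth_entry (hV m) i j)
        exact h0)
    exact ⟨x, hx⟩
  choose V' hV' using h
  refine ⟨Matrix.of V', hV', ?_⟩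
  ext i j
  have h1 : Filter.Tendsto (fun m => ((V m)ᵀ * V m) i j) l (nhds (((Matrix.of V')ᵀ * Matrix.of V') i j)) := by
    simp_rw [Matrix.mul_apply]
    exact tendsto_finsetSum _ fun a _ => (hV' a i).mul (hV' a j)
  simp_rw [hV] at h1
  exact tendsto_nhds_unique h1 tendsto_const_nhds

theorem finrank_LJ_le {V : Matrix (Fin n) (Fin n) ℝ} (hV : Vᵀ * V = 1) (J : Finset (Fin n)) :
    finrank ℝ ↥(LJ V J) ≤ J.card := by
  have hu : IsUnit V.det := isUnit_iff_ne_zero.2 (det_ne_of_mul (mul_eq_one_comm.1 hV))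
  rw [← finrank_map_inj V.mulVecLin (mulVec_inj hu), ← finrank_csS (K := ℝ)]
  apply Submodule.finrank_mono
  rintro _ ⟨x, hx, rfl⟩ i hi
  exact hx i (by simpa using hi)

theorem qdq_diag (Q : Matrix (Fin n) (Fin n) ℝ) (a : Fin n → ℝ) (j : Fin n) :
    (Q * diagonal a * Qᵀ) j j = ∑ i, a i * Q j i ^ 2 := by
  rw [Matrix.mul_apply]
  refine Finset.sum_congr rfl fun i _ => ?_
  rw [mul_diagonal, transpose_apply]
  ring

theorem wsum_filter (a : Fin n → ℝ) (t : Fin n → ℝ) :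
    wsum a (fun s => ∑ i with i.1 < s, t i) = ∑ i, a i * t i := by
  unfold wsum
  refine Finset.sum_congr rfl fun i _ => ?_
  have : (Finset.univ.filter fun x : Fin n => x.1 < i.1 + 1) =
      insert i (Finset.univ.filter fun x : Fin n => x.1 < i.1) := by
    ext x
    simp [Fin.ext_iff]
    omega
  beta_reduce
  rw [this, Finset.sum_insert (by simp)]
  ring

theorem ratio_one {ε c η θ x y : ℝ} (hε : 0 < ε) (hc : 0 < c) (hθ : 0 < θ) (hx : 0 < x) (hy : 0 < y)
    (h1 : c ≤ -(ε * (x ^ 2 - (x ^ 2)⁻¹))) (h2 : -(ε * (y ^ 2 - (y ^ 2)⁻¹)) ≤ η)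
    (h3 : ε + η ≤ c * θ ^ 2) (hη : 0 < η) : x ≤ θ * y := by
  have hx2 : 0 < x ^ 2 := by positivity
  have hy2 : 0 < y ^ 2 := by positivity
  have e1 : c * x ^ 2 ≤ ε := by
    have := mul_le_mul_of_nonneg_right h1 hx2.le
    have h4 : -(ε * (x ^ 2 - (x ^ 2)⁻¹)) * x ^ 2 = ε - ε * (x ^ 2) ^ 2 := by
      field_simp
      ring
    have : 0 < ε * (x ^ 2) ^ 2 := by positivity
    linarith
  have e2 : ε ≤ (ε + η) * y ^ 2 := by
    rcases le_or_gt (y ^ 2) 1 with hy1 | hy1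
    · have := mul_le_mul_of_nonneg_right h2 hy2.le
      have h4 : -(ε * (y ^ 2 - (y ^ 2)⁻¹)) * y ^ 2 = ε - ε * (y ^ 2) ^ 2 := by
        field_simp
        ring
      have : ε * (y ^ 2) ^ 2 ≤ ε * y ^ 2 := by
        apply mul_le_mul_of_nonneg_left _ hε.le
        nlinarith
      linarith
    · nlinarith
  have e3 : (ε + η) * y ^ 2 ≤ c * θ ^ 2 * y ^ 2 := mul_le_mul_of_nonneg_right h3 hy2.le
  have e4 : x ^ 2 ≤ (θ * y) ^ 2 := by
    refine le_of_mul_le_mul_left ?_ hc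
    calc c * x ^ 2 ≤ c * θ ^ 2 * y ^ 2 := by linarith
      _ = c * (θ * y) ^ 2 := by ring
  exact le_of_sq_le_sq e4 (by positivity)

theorem kempf_ness (α : Fin 3 → Fin n → ℝ) (hα : ∀ k, Antitone (α k)) (htr : ∑ k, ∑ i, α k i = 0)
    {M : Fin 3 → Matrix (Fin n) (Fin n) ℝ} (hM : ∀ k, IsUnit (M k).det)
    (hss : ∀ U, deg α M U ≤ 0) :
    ∃ Q : Fin 3 → Matrix (Fin n) (Fin n) ℝ, (∀ k, (Q k)ᵀ * Q k = 1) ∧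
      ∑ k, Q k * diagonal (α k) * (Q k)ᵀ = 0 := by
  choose V r Q R hV hr hQ hR he hsum using fun m : ℕ =>
    crit2 α hM (ε := 1 / ((m : ℝ) + 1)) Nat.one_div_pos_of_nat
  let l : Ultrafilter ℕ := Filter.hyperfilter ℕ
  have hε : Filter.Tendsto (fun m : ℕ => 1 / ((m : ℝ) + 1)) l (nhds 0) :=
    (tendsto_one_div_add_atTop_nhds_zero_nat (𝕜 := ℝ)).mono_left Nat.hyperfilter_le_atTop
  obtain ⟨V', hV', hV'o⟩ := orth_lim l hV
  choose Q' hQ' hQ'o using fun k => orth_lim l (V := fun m => Q m k) (fun m => hQ m k)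
  have hS : ∀ i j, Filter.Tendsto (fun m => (∑ k, Q m k * diagonal (α k) * (Q m k)ᵀ) i j) l
      (nhds ((∑ k, Q' k * diagonal (α k) * (Q' k)ᵀ) i j)) := by
    intro i j
    simp_rw [Matrix.sum_apply]
    refine tendsto_finsetSum _ fun k _ => ?_
    simp_rw [Matrix.mul_apply (M := _ * _), mul_diagonal, transpose_apply]
    exact tendsto_finsetSum _ fun a _ => ((hQ' k i a).mul_const _).mul (hQ' k j a)
  refine ⟨Q', hQ'o, ?_⟩
  set S := ∑ k, Q' k * diagonal (α k) * (Q' k)ᵀ with hSdef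
  simp_rw [hsum] at hS
  have hoff : ∀ i j, i ≠ j → S i j = 0 := by
    intro i j hij
    have := hS i j
    simp only [Matrix.neg_apply, Matrix.smul_apply, diagonal_apply_ne _ hij, smul_zero, neg_zero] at this
    exact (tendsto_nhds_unique this tendsto_const_nhds)
  have hdiag : ∀ i, Filter.Tendsto (fun m : ℕ => -(1 / ((m : ℝ) + 1) * (r m i ^ 2 - (r m i ^ 2)⁻¹))) l
      (nhds (S i i)) := by
    intro i
    have := hS i i
    simpa only [Matrix.neg_apply, Matrix.smul_apply, diagonal_apply_eq, smul_eq_mul] using this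
  let J : Finset (Fin n) := Finset.univ.filter fun i => 0 < S i i
  have hrat : ∀ θ > 0, ∀ᶠ m in (l : Filter ℕ), ∀ j ∈ J, ∀ i, i ∉ J → r m j ≤ θ * r m i := by
    intro θ hθ
    rw [Filter.eventually_all]
    intro j
    rw [Filter.eventually_imp_distrib_left]
    intro hj
    rw [Filter.eventually_all]
    intro i
    rw [Filter.eventually_imp_distrib_left]
    intro hi
    have hj' : 0 < S j j := by simpa [J] using hj
    have hi' : S i i ≤ 0 := by simpa [J] using hi
    have hc : 0 < S j j / 2 * θ ^ 2 / 2 := by positivity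
    filter_upwards [(hdiag j).eventually (lt_mem_nhds (half_lt_self hj')),
      (hdiag i).eventually (gt_mem_nhds (lt_of_le_of_lt hi' hc)),
      hε.eventually (gt_mem_nhds hc)] with m h1 h2 h3
    exact ratio_one Nat.one_div_pos_of_nat (half_pos hj') hθ (hr m j) (hr m i) h1.le h2.le
      (by linarith) hc
  have hSjj : ∀ j, S j j = ∑ k, ∑ i, α k i * Q' k j i ^ 2 := by
    intro j
    rw [hSdef, Matrix.sum_apply]
    simp_rw [qdq_diag]
  have hest : ∀ k s, ∑ i with i.1 < s, ∑ j ∈ J, Q' k j i ^ 2 ≤ finrank ℝ ↥(LJ V' J ⊓ Fl (M k) s) :=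
    fun k s => lim_est (l := (l : Filter ℕ)) (hM k) hV hr (fun m => hQ m k) (fun m => hR m k)
      (fun m => he m k) hV' (hQ' k) (hQ'o k) J hrat s
  have hrow : ∀ k j, ∑ i, Q' k j i ^ 2 = 1 := by
    intro k j
    have h0 : Q' k * (Q' k)ᵀ = 1 := mul_eq_one_comm.1 (hQ'o k)
    have h := congrFun (congrFun h0 j) j
    rw [Matrix.mul_apply, Matrix.one_apply_eq] at h
    rw [← h]
    simp [pow_two]
  have hw : ∀ k, ∑ j ∈ J, ∑ i, α k i * Q' k j i ^ 2 ≤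
      wsum (α k) (fun s => (finrank ℝ ↥(LJ V' J ⊓ Fl (M k) s) : ℝ)) := by
    intro k
    have h1 : ∑ j ∈ J, ∑ i, α k i * Q' k j i ^ 2 =
        wsum (α k) (fun s => ∑ i with i.1 < s, ∑ j ∈ J, Q' k j i ^ 2) := by
      rw [wsum_filter, Finset.sum_comm]
      simp_rw [Finset.mul_sum]
    rw [h1]
    refine abel_le _ (hα k) _ _ ?_ ?_ (hest k)
    · simp [Fl_zero]
    · refine le_antisymm ?_ (hest k n)
      have h2 : ∑ i with i.1 < n, ∑ j ∈ J, Q' k j i ^ 2 = (J.card : ℝ) := by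
        rw [Finset.filter_true_of_mem (fun i _ => i.2), Finset.sum_comm]
        simp [hrow]
      rw [h2, Fl_top (hM k) le_rfl, inf_top_eq]
      exact_mod_cast finrank_LJ_le hV'o J
  have hJle : ∑ j ∈ J, S j j ≤ 0 := by
    refine le_trans ?_ (hss (LJ V' J))
    simp_rw [hSjj]
    rw [Finset.sum_comm]
    exact Finset.sum_le_sum fun k _ => hw k
  have hJ0 : ∀ i, S i i ≤ 0 := by
    intro i
    by_contra hi
    push Not at hi
    have hiJ : i ∈ J := by simpa [J] using hi
    have := Finset.sum_pos (s := J) (f := fun j => S j j) (fun j hj => by simpa [J] using hj) ⟨i, hiJ⟩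
    linarith
  have htrS : ∑ j, S j j = 0 := by
    simp_rw [hSjj]
    rw [Finset.sum_comm, ← htr]
    refine Finset.sum_congr rfl fun k _ => ?_
    rw [Finset.sum_comm]
    refine Finset.sum_congr rfl fun i _ => ?_
    rw [← Finset.mul_sum]
    have h := congrFun (congrFun (hQ'o k) i) i
    rw [Matrix.mul_apply, Matrix.one_apply_eq] at h
    have h2 : ∑ j, Q' k j i ^ 2 = 1 := by
      rw [← h]
      simp [pow_two]
    rw [h2, mul_one]
  have hz := (Finset.sum_eq_zero_iff_of_nonpos (fun i _ => hJ0 i)).1 htrS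
  ext i j
  by_cases hij : i = j
  · subst hij
    exact hz i (Finset.mem_univ i)
  · exact hoff i j hij

end
end HSR

namespace HSR
open Module Matrix

/-! ### Part P: assembly -/

section
variable {n : ℕ}

theorem charpoly_conj {O : Matrix (Fin n) (Fin n) ℝ} (hO : Oᵀ * O = 1) (d : Fin n → ℝ) :
    (O * diagonal d * Oᵀ).charpoly = ∏ i, (Polynomial.X - Polynomial.C (d i)) := by
  rw [charpoly_mul_comm, ← Matrix.mul_assoc, hO, Matrix.one_mul, charpoly_diagonal]

theorem isSymm_conj (O : Matrix (Fin n) (Fin n) ℝ) (d : Fin n → ℝ) :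
    (O * diagonal d * Oᵀ).IsSymm := by
  rw [IsSymm]
  simp [Matrix.mul_assoc]

theorem orth_diag {A : Matrix (Fin n) (Fin n) ℝ} (hA : A.IsSymm) {d : Fin n → ℝ}
    (h : A.charpoly = ∏ i, (Polynomial.X - Polynomial.C (d i))) :
    ∃ O : Matrix (Fin n) (Fin n) ℝ, Oᵀ * O = 1 ∧ O * diagonal d * Oᵀ = A := by
  have hAH : A.IsHermitian := by
    rw [IsHermitian, conjTranspose_eq_transpose_of_trivial]
    exact hA
  have hDH : (diagonal d).IsHermitian := by
    rw [IsHermitian, conjTranspose_eq_transpose_of_trivial, diagonal_transpose]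
  have he : hAH.eigenvalues = hDH.eigenvalues := by
    rw [IsHermitian.eigenvalues_eq_eigenvalues_iff, h, charpoly_diagonal]
  obtain ⟨U, hU, hU', hAU⟩ := diag_sym hAH
  obtain ⟨W, hW, hW', hDW⟩ := diag_sym hDH
  rw [he] at hAU
  refine ⟨U * Wᵀ, ?_, ?_⟩
  · calc (U * Wᵀ)ᵀ * (U * Wᵀ) = W * (Uᵀ * U) * Wᵀ := by simp [Matrix.mul_assoc]
      _ = 1 := by rw [hU, Matrix.mul_one, hW']
  · calc U * Wᵀ * diagonal d * (U * Wᵀ)ᵀ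
        = U * Wᵀ * (W * diagonal hDH.eigenvalues * Wᵀ) * (U * Wᵀ)ᵀ := by rw [← hDW]
      _ = U * (Wᵀ * W) * diagonal hDH.eigenvalues * (Wᵀ * W) * Uᵀ := by simp [Matrix.mul_assoc]
      _ = A := by rw [hW, Matrix.mul_one, Matrix.mul_one, ← hAU]

theorem trace_conj {O : Matrix (Fin n) (Fin n) ℝ} (hO : Oᵀ * O = 1) (d : Fin n → ℝ) :
    (O * diagonal d * Oᵀ).trace = ∑ i, d i := by
  rw [trace_mul_comm, ← Matrix.mul_assoc, hO, Matrix.one_mul, trace_diagonal]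

theorem neg_conj (O : Matrix (Fin n) (Fin n) ℝ) (d : Fin n → ℝ) :
    -(O * diagonal d * Oᵀ) = O * diagonal (fun i => -d i) * Oᵀ := by
  rw [← Matrix.neg_mul, ← Matrix.mul_neg, diagonal_neg]

end

theorem core {p : ℕ} {σ γ : Fin (2 * p) → ℝ} (hσ : Antitone σ) (hγ : Antitone γ)
    {A B : Matrix (Fin (2 * p)) (Fin (2 * p)) ℝ} (hA : A.IsSymm) (hB : B.IsSymm)
    (hsA : A.charpoly = ∏ i, (Polynomial.X - Polynomial.C (σ i)))
    (hsB : B.charpoly = ∏ i, (Polynomial.X - Polynomial.C (σ i)))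
    (hsC : (A + B).charpoly = ∏ i, (Polynomial.X - Polynomial.C (γ i))) :
    ∃ a b : Matrix (Fin p) (Fin p) ℝ, a.IsSymm ∧ b.IsSymm ∧
      a.charpoly = ∏ i, (Polynomial.X - Polynomial.C (σ (ix false i))) ∧
      b.charpoly = ∏ i, (Polynomial.X - Polynomial.C (σ (ix true i))) ∧
      (a + b).charpoly = ∏ i, (Polynomial.X -
        Polynomial.C ((γ (ix false i) + γ (ix true i)) / 2)) := by
  obtain ⟨O₁, hO₁, hA'⟩ := orth_diag hA hsA
  obtain ⟨O₂, hO₂, hB'⟩ := orth_diag hB hsB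
  obtain ⟨O₃, hO₃, hC'⟩ := orth_diag (hA.add hB) hsC
  let δ : Fin (2 * p) → ℝ := fun i => -γ (Fin.rev i)
  have hδ : Antitone δ := fun i j h => neg_le_neg (hγ (Fin.rev_le_rev.2 h))
  have hnC : (-(A + B)).charpoly = ∏ i, (Polynomial.X - Polynomial.C (δ i)) := by
    rw [← hC', neg_conj, charpoly_conj hO₃, ← Equiv.prod_comp Fin.revPerm]
    rfl
  obtain ⟨O₄, hO₄, hC''⟩ := orth_diag (hA.add hB).neg hnC
  have hE : ∀ k, ((![O₁, O₂, O₄] : Fin 3 → _) k)ᵀ * (![O₁, O₂, O₄] : Fin 3 → _) k = 1 := by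
    intro k
    fin_cases k
    · exact hO₁
    · exact hO₂
    · exact hO₄
  have hsum : ∑ k, (![O₁, O₂, O₄] : Fin 3 → _) k *
      diagonal ((![σ, σ, δ] : Fin 3 → Fin (2 * p) → ℝ) k) *
      ((![O₁, O₂, O₄] : Fin 3 → _) k)ᵀ = 0 := by
    rw [Fin.sum_univ_three]
    change O₁ * diagonal σ * O₁ᵀ + O₂ * diagonal σ * O₂ᵀ + O₄ * diagonal δ * O₄ᵀ = 0
    rw [hA', hB', hC'', add_neg_cancel]
  obtain ⟨F, hF, hss⟩ := semistable hσ hδ hE hsum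
  have htr : ∑ k, ∑ i, sw σ δ k i = 0 := by
    have h1 : A.trace = ∑ i, σ i := by rw [← hA', trace_conj hO₁]
    have h2 : B.trace = ∑ i, σ i := by rw [← hB', trace_conj hO₂]
    have h3 : (-(A + B)).trace = ∑ i, δ i := by rw [← hC'', trace_conj hO₄]
    rw [trace_neg, trace_add, h1, h2] at h3
    rw [sum_ix σ, sum_ix δ, Fintype.sum_bool, Fintype.sum_bool] at h3
    rw [Fin.sum_univ_three]
    change ∑ a, σ (ix false a) + ∑ a, σ (ix true a) +
      ∑ a, (δ (ix false a) + δ (ix true a)) / 2 = 0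
    rw [← Finset.sum_div, Finset.sum_add_distrib]
    linarith
  obtain ⟨Q, hQ, hQs⟩ := kempf_ness (sw σ δ) (sw_antitone hσ hδ) htr hF hss
  refine ⟨Q 0 * diagonal (sw σ δ 0) * (Q 0)ᵀ, Q 1 * diagonal (sw σ δ 1) * (Q 1)ᵀ,
    isSymm_conj _ _, isSymm_conj _ _, charpoly_conj (hQ 0) _, charpoly_conj (hQ 1) _, ?_⟩
  rw [Fin.sum_univ_three] at hQs
  rw [eq_neg_of_add_eq_zero_left hQs, neg_conj, charpoly_conj (hQ 2),
    ← Equiv.prod_comp Fin.revPerm]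
  refine Finset.prod_congr rfl fun i _ => ?_
  congr 2
  change -((-γ (Fin.rev (ix false (Fin.rev i))) + -γ (Fin.rev (ix true (Fin.rev i)))) / 2) = _
  have e1 : Fin.rev (ix false (Fin.rev i)) = ix true i := by
    have := i.2
    simp only [ix, Fin.ext_iff, Fin.val_rev, Bool.toNat_false, Bool.toNat_true]
    omega
  have e2 : Fin.rev (ix true (Fin.rev i)) = ix false i := by
    have := i.2
    simp only [ix, Fin.ext_iff, Fin.val_rev, Bool.toNat_false, Bool.toNat_true]
    omega
  rw [e1, e2]
  ring

end HSR


/-- If `A, B` are real symmetric `2p×2p` matrices, each of ordered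
spectrum `σ`, and `A + B` has ordered spectrum `γ`, then
`ν = ((γ₁+γ₂)/2, …, (γ_{2p-1}+γ_{2p})/2)` is the ordered spectrum of `a + b` for
some real symmetric `p×p` matrices `a, b` with ordered spectra `σ₋, σ₊`. -/
theorem halved_spectrum_realized (p : ℕ)
    (σ : Fin (2 * p) → ℝ) (hσ : Antitone σ)
    (A B : Matrix (Fin (2 * p)) (Fin (2 * p)) ℝ) (hA : A.IsSymm) (hB : B.IsSymm)
    (hsA : HasOrdSpecR A σ) (hsB : HasOrdSpecR B σ)
    (γ : Fin (2 * p) → ℝ) (hγ : HasOrdSpecR (A + B) γ) :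
    ∃ a b : Matrix (Fin p) (Fin p) ℝ, a.IsSymm ∧ b.IsSymm ∧
      HasOrdSpecR a (sminusR σ) ∧ HasOrdSpecR b (splusR σ) ∧
      HasOrdSpecR (a + b)
        (fun i => (γ ⟨2 * i.1, by have := i.2; omega⟩ +
          γ ⟨2 * i.1 + 1, by have := i.2; omega⟩) / 2) := by
  obtain ⟨a, b, ha, hb, h1, h2, h3⟩ := HSR.core hσ hγ.1 hA hB hsA.2 hsB.2 hγ.2
  refine ⟨a, b, ha, hb, ⟨?_, h1⟩, ⟨?_, h2⟩, ⟨?_, h3⟩⟩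
  · intro i j h
    exact hσ (HSR.ix_mono false h)
  · intro i j h
    exact hσ (HSR.ix_mono true h)
  · intro i j h
    have e1 := hγ.1 (HSR.ix_mono false h)
    have e2 := hγ.1 (HSR.ix_mono true h)
    exact div_le_div_of_nonneg_right (add_le_add e1 e2) zero_le_two
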